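/- arXiv:1109.1911 — 2 statements merged into one kernel-verified Lean document; each statement's English description precedes it below -/
import Mathlib

section
/- Let D be a division algebra that is finite-dimensional over its center Z(D), and let F ⊆ Z(D) be a subfield such that the extension Z(D)/F is finite and separable. If D contains a maximal subfield that is a normal extension of F, then D also contains a maximal subfield that is a Galois extension of F. -/
/- Formalization of notions from:
   T. Hanke, "Galois subfields of inertially split division algebras". -/

noncomputable section
open scoped TensorProduct
universe u v

namespace Paper
/-! ### Subfields of division rings -/

/-- A subring `K` of a division ring `D` is a (commutative) subfield if it is
commutative and closed under inverses. -/
def IsSubfield {D : Type u} [DivisionRing D] (K : Subring D) : Prop :=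
  (∀ x ∈ K, ∀ y ∈ K, x * y = y * x) ∧ ∀ x ∈ K, x⁻¹ ∈ K

/-- A maximal subfield of a division ring: a subfield which is maximal with
respect to inclusion among subfields. -/
def IsMaximalSubfield {D : Type u} [DivisionRing D] (K : Subring D) : Prop :=
  IsSubfield K ∧ ∀ K' : Subring D, IsSubfield K' → K ≤ K' → K' = K

/-- A witness that the division ring `D` contains a maximal subfield which is Galois
over `F` (where `F` maps to the center of `D` via the algebra structure). -/
structure GaloisMaximalSubfield (F : Type v) (D : Type u) [Field F] [DivisionRing D]
    [Algebra F D] where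
  /-- the abstract maximal subfield -/
  L : Type u
  [fieldL : Field L]
  [algebraL : Algebra F L]
  /-- the embedding of `L` into `D` -/
  emb : L →ₐ[F] D
  inj : Function.Injective emb
  maximal : IsMaximalSubfield emb.toRingHom.range
  galois : IsGalois F L

attribute [instance] GaloisMaximalSubfield.fieldL GaloisMaximalSubfield.algebraL

/-- `D` contains a maximal subfield Galois over `F`; in the case where `F` is the
center of `D` this says precisely that `D` is a crossed product. -/
def HasMaximalGaloisSubfield (F : Type v) (D : Type u) [Field F] [DivisionRing D]
    [Algebra F D] : Prop :=
  Nonempty (GaloisMaximalSubfield F D)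

/-- A witness that the division ring `D` contains a maximal subfield which is a normal
extension of `F`. -/
structure NormalMaximalSubfield (F : Type v) (D : Type u) [Field F] [DivisionRing D]
    [Algebra F D] where
  /-- the abstract maximal subfield -/
  L : Type u
  [fieldL : Field L]
  [algebraL : Algebra F L]
  /-- the embedding of `L` into `D` -/
  emb : L →ₐ[F] D
  inj : Function.Injective emb
  maximal : IsMaximalSubfield emb.toRingHom.range
  normal : Normal F L

attribute [instance] NormalMaximalSubfield.fieldL NormalMaximalSubfield.algebraL

/-- `D` contains a maximal subfield normal over `F`. -/
def HasMaximalNormalSubfield (F : Type v) (D : Type u) [Field F] [DivisionRing D]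
    [Algebra F D] : Prop :=
  Nonempty (NormalMaximalSubfield F D)
/-! ### The center of a division algebra -/

/-- The algebra map `F → D` factors through the center of `D`. -/
def centerRingHom (F : Type v) (D : Type u) [Field F] [DivisionRing D] [Algebra F D] :
    F →+* Subring.center D :=
  (algebraMap F D).codRestrict (Subring.center D) fun x =>
    Subring.mem_center_iff.mpr fun g => (Algebra.commutes x g).symm

/-- `F`-algebra structure on the center `Z(D)` of a division algebra `D` over `F`. -/
instance centerAlgebra (F : Type v) (D : Type u) [Field F] [DivisionRing D] [Algebra F D] :
    Algebra F (Subring.center D) :=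
  (centerRingHom F D).toAlgebra

/-- A division ring is an algebra over its center. -/
instance centerAlgebraSelf (D : Type u) [DivisionRing D] : Algebra (Subring.center D) D :=
  RingHom.toAlgebra' (Subring.center D).subtype fun c x =>
    (Subring.mem_center_iff.mp c.2 x).symm

/-- Restrict a ring homomorphism with central image to the center of the target. -/
def centralCodRestrict {k : Type v} {D : Type u} [Field k] [DivisionRing D] (ι : k →+* D)
    (hc : ∀ a d, ι a * d = d * ι a) : k →+* Subring.center D :=
  ι.codRestrict (Subring.center D) fun a => Subring.mem_center_iff.mpr fun g => (hc a g).symm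

section CentralizerDimension

open Module MulOpposite

/-- For a simple module `M` over a `k`-algebra `R`, density computes the dimension of the image of
`R` in `End k M`. -/
theorem finrank_range_lsmul_mul_finrank_end (k R M : Type*) [Field k] [Ring R] [Algebra k R]
    [AddCommGroup M] [Module k M] [Module R M] [IsScalarTower k R M] [FiniteDimensional k M]
    [IsSimpleModule R M] :
    finrank k (LinearMap.range (Algebra.lsmul k k M : R →ₐ[k] End k M).toLinearMap)
        * finrank k (End R M) = finrank k M * finrank k M := by
  classical
  let _ : DivisionRing (End R M) := Module.End.instDivisionRing
  have : IsScalarTower k (End R M) M := ⟨fun a f m => rfl⟩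
  have : SMulCommClass (End R M) k M := ⟨fun f a m => by simp⟩
  have : SMulCommClass k (End R M) M := SMulCommClass.symm _ _ _
  have : Module.Finite (End R M) M := Module.Finite.of_restrictScalars_finite k _ _
  have h1 : finrank k (End R M) * finrank (End R M) M = finrank k M :=
    Module.finrank_mul_finrank k (End R M) M
  have h2 : finrank k (M →ₗ[End R M] M) = finrank (End R M) M * finrank k M := by
    let b := Module.finBasis (End R M) M
    rw [← (b.constr (M' := M) k).finrank_eq, finrank_pi_fintype]
    simp
  let φ : (M →ₗ[End R M] M) →ₗ[k] End k M :=
    { toFun := fun f => f.restrictScalars k, map_add' := fun _ _ => rfl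
      map_smul' := fun _ _ => rfl }
  have hφ : Function.Injective φ := fun f g h => by
    ext m; exact congrArg (fun F : End k M => F m) h
  have h3 : LinearMap.range (Algebra.lsmul k k M : R →ₐ[k] End k M).toLinearMap
      = LinearMap.range φ := by
    apply le_antisymm
    · rintro _ ⟨r, rfl⟩
      exact ⟨Module.toModuleEnd (End R M) (S := R) M r, rfl⟩
    · rintro _ ⟨f, rfl⟩
      obtain ⟨r, hr⟩ := Module.Finite.toModuleEnd_moduleEnd_surjective (R := R) (M := M) f
      refine ⟨r, ?_⟩
      ext m
      exact congrArg (fun F : M →ₗ[End R M] M => F m) hr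
  rw [h3, LinearMap.finrank_range_of_inj hφ, h2, ← h1]
  ring

variable {k D : Type*} [Field k] [DivisionRing D] [Algebra k D]

attribute [local instance] TensorProduct.Algebra.module

theorem tmul_smul_eq_mul_mul (K : Subalgebra k D) (d : D) (a : K.op) (x : D) :
    (d ⊗ₜ[k] a) • x = d * (x * (a : Dᵐᵒᵖ).unop) := rfl

theorem isScalarTower_tensor_op (K : Subalgebra k D) : IsScalarTower k (D ⊗[k] K.op) D where
  smul_assoc c t x := by
    induction t with
    | zero =>
      exact (congrArg (· • x) (smul_zero (A := D ⊗[k] K.op) c)).trans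
        ((zero_smul (D ⊗[k] K.op) x).trans
          ((smul_zero c).symm.trans (congrArg (c • ·) (zero_smul (D ⊗[k] K.op) x).symm)))
    | tmul d a => rw [TensorProduct.smul_tmul', tmul_smul_eq_mul_mul, tmul_smul_eq_mul_mul,
        smul_mul_assoc]
    | add s t hs ht => rw [smul_add, add_smul, add_smul, hs, ht, smul_add]

theorem isSimpleModule_tensor_op (K : Subalgebra k D) : IsSimpleModule (D ⊗[k] K.op) D := by
  rw [isSimpleModule_iff_toSpanSingleton_surjective]
  refine ⟨inferInstance, fun x hx y => ⟨(y * x⁻¹) ⊗ₜ 1, ?_⟩⟩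
  rw [LinearMap.toSpanSingleton_apply, tmul_smul_eq_mul_mul]
  simp [hx]

attribute [local instance] isScalarTower_tensor_op isSimpleModule_tensor_op

/-- Endomorphisms of `D` commuting with left multiplications and with right multiplications by `K`
are right multiplications by elements of the centralizer of `K`. -/
def endTensorOpEquiv (K : Subalgebra k D) :
    End (D ⊗[k] K.op) D ≃ₗ[k] Subalgebra.centralizer k (K : Set D) where
  toFun f := ⟨f 1, by
    rw [Subalgebra.mem_centralizer_iff]
    intro g hg
    have h1 := f.map_smul ((1 : D) ⊗ₜ[k] (⟨op g, hg⟩ : K.op)) 1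
    have h2 := f.map_smul (g ⊗ₜ[k] (1 : K.op)) 1
    rw [tmul_smul_eq_mul_mul, tmul_smul_eq_mul_mul] at h1 h2
    simp only [one_mul, unop_op, OneMemClass.coe_one, unop_one, mul_one] at h1 h2
    rw [← h1, ← h2]⟩
  map_add' _ _ := rfl
  map_smul' _ _ := rfl
  invFun c :=
    { toFun := fun x => x * c
      map_add' := fun x y => add_mul _ _ _
      map_smul' := fun t x => by
        induction t with
        | zero =>
          exact (congrArg (· * (c : D)) (zero_smul (D ⊗[k] K.op) x)).trans
            ((zero_mul _).trans (zero_smul (D ⊗[k] K.op) (x * (c : D))).symm)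
        | tmul d a =>
          have := (Subalgebra.mem_centralizer_iff k).1 c.2 _ a.2
          simp only [tmul_smul_eq_mul_mul, RingHom.id_apply, mul_assoc]
          rw [← this]
        | add s t hs ht =>
          rw [add_smul, add_mul, hs, ht, RingHom.id_apply, RingHom.id_apply, RingHom.id_apply,
            add_smul] }
  left_inv f := by
    ext x
    have h2 := f.map_smul (x ⊗ₜ[k] (1 : K.op)) 1
    rw [tmul_smul_eq_mul_mul, tmul_smul_eq_mul_mul] at h2
    simp only [OneMemClass.coe_one, unop_one, mul_one] at h2
    simp [h2]
  right_inv c := by simp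

variable [FiniteDimensional k D]

theorem lsmul_tensor_top_injective (hc : Algebra.IsCentral k D) :
    Function.Injective
      (Algebra.lsmul k k D : D ⊗[k] (⊤ : Subalgebra k D).op →ₐ[k] End k D).toLinearMap := by
  have h1 := finrank_range_lsmul_mul_finrank_end k (D ⊗[k] (⊤ : Subalgebra k D).op) D
  have h2 : finrank k (End (D ⊗[k] (⊤ : Subalgebra k D).op) D) = 1 := by
    rw [(endTensorOpEquiv _).finrank_eq]
    have : Subalgebra.centralizer k ((⊤ : Subalgebra k D) : Set D) = ⊥ := by
      rw [eq_bot_iff, Algebra.coe_top, Subalgebra.centralizer_univ]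
      exact hc.out
    rw [this, Subalgebra.finrank_bot]
  rw [h2, mul_one] at h1
  rw [← LinearMap.ker_eq_bot, ← Submodule.finrank_eq_zero]
  have h3 := LinearMap.finrank_range_add_finrank_ker
    (Algebra.lsmul k k D : D ⊗[k] (⊤ : Subalgebra k D).op →ₐ[k] End k D).toLinearMap
  rw [h1, finrank_tensorProduct, ← (Subalgebra.linearEquivOp ⊤).finrank_eq] at h3
  have h4 : finrank k (⊤ : Subalgebra k D) = finrank k D :=
    subalgebra_top_finrank_eq_submodule_top_finrank.trans (finrank_top k D)
  rw [h4] at h3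
  omega

theorem lsmul_tensor_injective (hc : Algebra.IsCentral k D) (K : Subalgebra k D) :
    Function.Injective (Algebra.lsmul k k D : D ⊗[k] K.op →ₐ[k] End k D).toLinearMap := by
  have hle : K.op ≤ (⊤ : Subalgebra k D).op := fun _ _ => trivial
  let i : K.op →ₗ[k] (⊤ : Subalgebra k D).op := (Subalgebra.inclusion hle).toLinearMap
  have hi : Function.Injective i := Subalgebra.inclusion_injective hle
  have h2 := Module.Flat.lTensor_preserves_injective_linearMap (M := D) i hi
  have h3 := (lsmul_tensor_top_injective (k := k) (D := D) hc).comp h2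
  have h4 : (Algebra.lsmul k k D : D ⊗[k] K.op →ₐ[k] End k D).toLinearMap =
      (Algebra.lsmul k k D : D ⊗[k] (⊤ : Subalgebra k D).op →ₐ[k] End k D).toLinearMap ∘ₗ
        i.lTensor D :=
    TensorProduct.ext' fun d a => rfl
  rw [h4, LinearMap.coe_comp]
  exact h3

/-- The centralizer dimension formula in a central division algebra. -/
theorem finrank_mul_finrank_centralizer (hc : Algebra.IsCentral k D) (K : Subalgebra k D) :
    finrank k K * finrank k (Subalgebra.centralizer k (K : Set D)) = finrank k D := by
  have h1 := finrank_range_lsmul_mul_finrank_end k (D ⊗[k] K.op) D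
  rw [(endTensorOpEquiv K).finrank_eq,
    LinearMap.finrank_range_of_inj (lsmul_tensor_injective hc K),
    finrank_tensorProduct, ← (Subalgebra.linearEquivOp K).finrank_eq, mul_assoc] at h1
  exact Nat.eq_of_mul_eq_mul_left finrank_pos h1

theorem centralizer_centralizer_eq (hc : Algebra.IsCentral k D) (K : Subalgebra k D) :
    Subalgebra.centralizer k (Subalgebra.centralizer k (K : Set D) : Set D) = K := by
  have h1 := finrank_mul_finrank_centralizer hc K
  have h2 := finrank_mul_finrank_centralizer hc (Subalgebra.centralizer k (K : Set D))
  rw [← h1, mul_comm] at h2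
  refine (Subalgebra.eq_of_le_of_finrank_eq ?_
    (Nat.eq_of_mul_eq_mul_right finrank_pos h2).symm).symm
  exact Set.subset_centralizer_centralizer

end CentralizerDimension

section NoncommutativeFrobenius

open Polynomial Finset

variable (p : ℕ) [Fact p.Prime]

theorem eq_X_pow_sub_X_of_eval_eq_zero {f : (ZMod p)[X]} (hf : f.Monic) (hd : f.natDegree = p)
    (h0 : ∀ a, f.eval a = 0) : f = X ^ p - X := by
  have hp : 1 < p := (Fact.out : p.Prime).one_lt
  refine eq_of_degree_sub_lt_of_eval_finset_eq univ ?_ fun a _ => by simp [h0 a]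
  have hd2 := FiniteField.X_pow_card_sub_X_natDegree_eq (ZMod p) hp
  have hm : (X ^ p - X : (ZMod p)[X]).Monic := by
    refine monic_X_pow_sub ?_
    rw [degree_X]; exact_mod_cast hp
  have : f.degree = ((univ : Finset (ZMod p)).card : WithBot ℕ) := by
    rw [degree_eq_natDegree hf.ne_zero, hd, card_univ, ZMod.card]
  rw [← this]
  refine degree_sub_lt_left ?_ hf.ne_zero (by rw [hf.leadingCoeff, hm.leadingCoeff])
  rw [degree_eq_natDegree hf.ne_zero, degree_eq_natDegree hm.ne_zero, hd, hd2]

theorem descPochhammer_eval_zmod (a : ZMod p) : (descPochhammer (ZMod p) p).eval a = 0 := by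
  conv_lhs => rw [← ZMod.natCast_zmod_val a]
  rw [descPochhammer_eval_eq_descFactorial, Nat.descFactorial_eq_zero_iff_lt.2 (ZMod.val_lt a),
    Nat.cast_zero]

theorem descPochhammer_zmod : descPochhammer (ZMod p) p = X ^ p - X :=
  eq_X_pow_sub_X_of_eval_eq_zero p (monic_descPochhammer _ _) (descPochhammer_natDegree _ _)
    (descPochhammer_eval_zmod p)

theorem ascPochhammer_zmod : ascPochhammer (ZMod p) p = X ^ p - X :=
  eq_X_pow_sub_X_of_eval_eq_zero p (monic_ascPochhammer _ _) (ascPochhammer_natDegree _ _)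
    fun a => by
      have := ascPochhammer_eval_neg_eq_descPochhammer _ (-a) p
      rwa [neg_neg, descPochhammer_eval_zmod, mul_zero] at this

variable {R : Type*} [Ring R] {y u : R}

theorem mul_pow_eq_pow_mul_sub (h : y * u = u * (y - 1)) (n : ℕ) :
    y * u ^ n = u ^ n * (y - n) := by
  induction n with
  | zero => simp
  | succ n ih =>
    rw [pow_succ, ← mul_assoc, ih, mul_assoc, sub_mul, h, (Nat.cast_commute n u).eq, mul_assoc,
      ← mul_sub]
    congr 2
    push_cast
    abel

variable [Algebra (ZMod p) R]

theorem aeval_ascPochhammer_succ (z : R) (n : ℕ) :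
    aeval z (ascPochhammer (ZMod p) (n + 1)) = (z + n) * aeval z (ascPochhammer (ZMod p) n) := by
  rw [ascPochhammer_succ_right, mul_comm, map_mul, map_add, aeval_X, map_natCast]

theorem aeval_descPochhammer_succ (z : R) (n : ℕ) :
    aeval z (descPochhammer (ZMod p) (n + 1)) = (z - n) * aeval z (descPochhammer (ZMod p) n) := by
  rw [descPochhammer_succ_right, mul_comm, map_mul, map_sub, aeval_X, map_natCast]

theorem aeval_add_ascPochhammer (h : y * u = u * (y - 1)) (n : ℕ) :
    aeval (y + u) (ascPochhammer (ZMod p) n) =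
      ∑ ij ∈ antidiagonal n, n.choose ij.1 • (u ^ ij.1 * aeval y (ascPochhammer (ZMod p) ij.2)) := by
  induction n with
  | zero => simp
  | succ n ih =>
    rw [sum_antidiagonal_choose_succ_nsmul
      (fun i j => u ^ i * aeval y (ascPochhammer (ZMod p) j)) n, aeval_ascPochhammer_succ, ih,
      mul_sum, ← sum_add_distrib]
    refine sum_congr rfl fun ij hij => ?_
    obtain ⟨i, j⟩ := ij
    rw [HasAntidiagonal.mem_antidiagonal] at hij
    dsimp only at hij ⊢
    have hn : (n : R) = i + j := by rw [← hij]; push_cast; rfl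
    rw [Nat.choose_symm_of_eq_add (a := i) (b := j) hij.symm, ← nsmul_add, mul_smul_comm]
    congr 1
    rw [aeval_ascPochhammer_succ, hn, pow_succ', ← mul_assoc, ← mul_assoc, ← add_mul]
    congr 1
    have h1 := mul_pow_eq_pow_mul_sub h i
    have h2 : ((i : R) + j) * u ^ i = u ^ i * (i + j) :=
      (((Nat.cast_commute i u).add_left (Nat.cast_commute j u)).pow_right i).eq
    rw [add_mul, add_mul, h1, h2]
    noncomm_ring

theorem add_pow_char_sub_of_mul_eq (h : y * u = u * (y - 1)) :
    (y + u) ^ p - (y + u) = y ^ p - y + u ^ p := by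
  have hp : p.Prime := Fact.out
  have h1 := aeval_add_ascPochhammer p h p
  rw [ascPochhammer_zmod] at h1
  simp only [map_sub, map_pow, aeval_X] at h1
  rw [h1, ← sum_subset (s₁ := {(0, p), (p, 0)})]
  · rw [sum_pair (by simp [hp.ne_zero.symm]), ascPochhammer_zmod]
    simp
  · intro ij hij
    simp only [mem_insert, mem_singleton] at hij
    rcases hij with rfl | rfl <;> simp
  · rintro ⟨i, j⟩ hij hne
    simp only [mem_insert, mem_singleton, Prod.mk.injEq, not_or, HasAntidiagonal.mem_antidiagonal] at hij hne
    have hdvd : p ∣ p.choose i := hp.dvd_choose_self (by omega) (by omega)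
    obtain ⟨m, hm⟩ := hdvd
    have : CharP R p ∨ Subsingleton R := by
      rcases subsingleton_or_nontrivial R with h | h
      · exact Or.inr h
      · exact Or.inl (charP_of_injective_algebraMap (algebraMap (ZMod p) R).injective p)
    rcases this with h | h
    · dsimp only
      rw [hm, nsmul_eq_mul, Nat.cast_mul, CharP.cast_eq_zero, zero_mul, zero_mul]
    · exact Subsingleton.elim _ _

theorem mul_pow_eq_pow_mul_descPochhammer (h : y * u = u * (y - 1)) (n : ℕ) :
    (u * y) ^ n = u ^ n * aeval y (descPochhammer (ZMod p) n) := by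
  induction n with
  | zero => simp
  | succ n ih =>
    rw [pow_succ', ih, aeval_descPochhammer_succ, pow_succ', mul_assoc, ← mul_assoc y,
      mul_pow_eq_pow_mul_sub h]
    simp only [mul_assoc]

theorem mul_pow_char_of_mul_eq (h : y * u = u * (y - 1)) :
    (u * y) ^ p = u ^ p * (y ^ p - y) := by
  rw [mul_pow_eq_pow_mul_descPochhammer p h, descPochhammer_zmod]
  simp

/-- The Artin-Schreier expression of `(y + v) + t x (y + s)` when `y x = x (y - 1)`. -/
theorem artinSchreier_of_mul_eq {x v s t : R} (h : y * x = x * (y - 1))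
    (hvx : Commute v x) (hsx : Commute s x) (htx : Commute t x)
    (hvy : Commute v y) (hsy : Commute s y) (hty : Commute t y)
    (hvs : Commute v s) (hvt : Commute v t) (hts : Commute t s) :
    ((y + v) + t * (x * (y + s))) ^ p - ((y + v) + t * (x * (y + s))) =
      (y + v) ^ p - (y + v) + t ^ p * (x ^ p * ((y + s) ^ p - (y + s))) := by
  have h1 : (y + s) * x = x * (y + s - 1) := by
    rw [add_mul, h, hsx.eq]; noncomm_ring
  have h0 : (y + v) * x = x * (y + v - 1) := by
    rw [add_mul, h, hvx.eq]; noncomm_ring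
  have h2 : Commute t (x * (y + s)) := htx.mul_right (hty.add_right hts)
  have h3 : Commute (y + v) (y + s) :=
    ((Commute.refl y).add_left hvy).add_right (hsy.symm.add_left hvs)
  have h4 : (y + v) * (t * (x * (y + s))) = t * (x * (y + s)) * (y + v - 1) := by
    have h5 : Commute (y + v) t := hty.symm.add_left hvt
    have h6 : Commute (y + v - 1) (y + s) := h3.sub_left (Commute.one_left _)
    rw [← mul_assoc, h5.eq, mul_assoc, ← mul_assoc _ x, h0, mul_assoc x, h6.eq]
    simp only [mul_assoc]
  rw [add_pow_char_sub_of_mul_eq p h4, h2.mul_pow, mul_pow_char_of_mul_eq p h1]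

end NoncommutativeFrobenius

section ArtinSchreierExtension

open Polynomial IntermediateField

theorem separable_X_pow_sub_X_sub_C (p : ℕ) {K : Type*} [Field K] [CharP K p] (a : K) :
    (X ^ p - X - C a : K[X]).Separable := by
  refine ⟨0, -1, ?_⟩
  simp [derivative_X_pow, CharP.cast_eq_zero]

variable (p : ℕ) [Fact p.Prime]

theorem exists_eq_natCast_of_pow_char_eq {R : Type*} [Ring R] [IsDomain R] [CharP R p] {z : R}
    (h : z ^ p = z) : ∃ n : ℕ, z = n := by
  let _ : Algebra (ZMod p) R := ZMod.algebra R p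
  have key : ∀ n : ℕ, aeval z (descPochhammer (ZMod p) n) = 0 → ∃ n : ℕ, z = n := by
    intro n
    induction n with
    | zero => intro h0; simp at h0
    | succ n ih =>
      intro h0
      rw [aeval_descPochhammer_succ] at h0
      rcases mul_eq_zero.1 h0 with h1 | h1
      · exact ⟨n, sub_eq_zero.1 h1⟩
      · exact ih h1
  refine key p ?_
  rw [descPochhammer_zmod]
  simp [h]

section Poly

variable {K : Type*} [Field K]

theorem natDegree_X_pow_sub_X_sub_C (a : K) : (X ^ p - X - C a : K[X]).natDegree = p := by
  have hp : 1 < p := (Fact.out : p.Prime).one_lt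
  rw [natDegree_sub_C, FiniteField.X_pow_card_sub_X_natDegree_eq K hp]

theorem monic_X_pow_sub_X_sub_C (a : K) : (X ^ p - X - C a : K[X]).Monic := by
  have hp : 1 < p := (Fact.out : p.Prime).one_lt
  rw [sub_sub]
  refine monic_X_pow_sub ?_
  refine (degree_add_le _ _).trans_lt (max_lt ?_ (degree_C_le.trans_lt ?_))
  · rw [degree_X]; exact_mod_cast hp
  · exact_mod_cast hp.trans' zero_lt_one

variable [CharP K p]

theorem splits_X_pow_sub_X_sub_C_of_root {a α : K} (hα : α ^ p - α = a) :
    (X ^ p - X - C a : K[X]).Splits := by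
  let _ : Algebra (ZMod p) K := ZMod.algebra K p
  have h1 : (X ^ p - X : K[X]).Splits := by
    have := (FiniteField.splits_X_pow_card_sub_X p (K := ZMod p)).map (algebraMap (ZMod p) K)
    simpa [ZMod.card] using this
  have h2 := h1.comp_X_add_C (-α)
  have h3 : (X ^ p - X : K[X]).comp (X + C (-α)) = X ^ p - X - C a := by
    rw [sub_comp, X_pow_comp, X_comp, add_pow_char, ← C_pow, ← hα]
    have : (-α) ^ p = - α ^ p := by rw [neg_pow, neg_one_pow_char]; ring
    rw [this]
    simp only [map_neg, map_sub]
    ring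
  rwa [h3] at h2

theorem irreducible_X_pow_sub_X_sub_C {a : K} (ha : ∀ x : K, x ^ p - x ≠ a) :
    Irreducible (X ^ p - X - C a : K[X]) := by
  have hp : p.Prime := Fact.out
  rw [(monic_X_pow_sub_X_sub_C p a).irreducible_iff_natDegree']
  refine ⟨fun h => ?_, fun f g _ hg hfg hmem => ?_⟩
  · have := natDegree_X_pow_sub_X_sub_C p a
    rw [h, natDegree_one] at this
    exact hp.ne_zero this.symm
  rw [natDegree_X_pow_sub_X_sub_C, Finset.mem_Ioc] at hmem
  let Ω := AlgebraicClosure K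
  have : CharP Ω p := charP_of_injective_algebraMap (algebraMap K Ω).injective p
  let i := algebraMap K Ω
  have hsplit : (g.map i).Splits := IsAlgClosed.splits _
  have hroot : ∀ x ∈ (g.map i).roots, x ^ p - x = i a := by
    intro x hx
    have h1 : (g.map i).eval x = 0 := (mem_roots'.1 hx).2
    have h2 : ((X ^ p - X - C a : K[X]).map i).eval x = 0 := by
      rw [← hfg, Polynomial.map_mul, eval_mul, h1, mul_zero]
    simp only [Polynomial.map_sub, Polynomial.map_pow, map_X, map_C, eval_sub, eval_pow, eval_X,
      eval_C] at h2
    exact sub_eq_zero.1 h2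
  have hcard : (g.map i).roots.card = g.natDegree := by
    rw [← hsplit.natDegree_eq_card_roots, natDegree_map]
  obtain ⟨α, hα⟩ : ∃ α, α ∈ (g.map i).roots :=
    Multiset.card_pos_iff_exists_mem.1 (by omega)
  have hsum : ∀ s : Multiset Ω, (∀ x ∈ s, x ^ p - x = i a) →
      ∃ n : ℕ, s.sum = s.card * α + n := by
    intro s
    induction s using Multiset.induction_on with
    | empty => intro _; exact ⟨0, by simp⟩
    | cons x s ih =>
      intro hs
      obtain ⟨n, hn⟩ := ih fun y hy => hs y (Multiset.mem_cons_of_mem hy)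
      obtain ⟨m, hm⟩ : ∃ m : ℕ, x - α = m := by
        refine exists_eq_natCast_of_pow_char_eq p ?_
        rw [sub_pow_char]
        linear_combination hs x (Multiset.mem_cons_self x s) - hroot α hα
      refine ⟨n + m, ?_⟩
      rw [Multiset.sum_cons, Multiset.card_cons, hn]
      push_cast
      linear_combination hm
  obtain ⟨n, hn⟩ := hsum _ hroot
  have hc := hsplit.nextCoeff_eq_neg_sum_roots_of_monic (hg.map i)
  rw [hn, hcard, nextCoeff_map i.injective] at hc
  have hd : (g.natDegree : K) ≠ 0 := by
    rw [Ne, CharP.cast_eq_zero_iff K p]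
    intro hdvd
    have := Nat.le_of_dvd hmem.1 hdvd
    have := hp.two_le
    omega
  have hαK : α = i (-(g.nextCoeff + n) / g.natDegree) := by
    have hd' : (g.natDegree : Ω) ≠ 0 := by
      have := (map_ne_zero i).2 hd
      simpa using this
    rw [map_div₀, eq_div_iff (by simpa using hd')]
    simp only [map_neg, map_add, map_natCast]
    linear_combination hc
  have h1 := hroot α hα
  rw [hαK, ← map_pow, ← map_sub] at h1
  exact ha _ (i.injective h1)

end Poly

/-- Adjoining a root of an Artin-Schreier polynomial over `E` to a Galois extension `S` of `E`
inside a division ring. -/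
theorem exists_isGalois_of_artinSchreier {E : Type*} {S : Type u} {D : Type*} [Field E] [Field S]
    [DivisionRing D] [Algebra E S] [FiniteDimensional E S] [IsGalois E S] [CharP E p]
    (i : S →+* D) {q : D} (hq : ∀ s, Commute (i s) q) (hqS : q ∉ i.range) {e : E}
    (he : q ^ p - q = i (algebraMap E S e)) :
    ∃ (L : Type u) (_ : Field L) (_ : Algebra E L) (_ : Algebra S L) (_ : IsScalarTower E S L)
      (j : L →+* D), IsGalois E L ∧ Module.finrank S L = p ∧ j.comp (algebraMap S L) = i ∧
        q ∈ j.range := by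
  have hp : p.Prime := Fact.out
  have : CharP S p := charP_of_injective_algebraMap (algebraMap E S).injective p
  have : CharP D p := charP_of_injective_ringHom i.injective p
  let P : S[X] := X ^ p - X - C (algebraMap E S e)
  have hPq : eval₂ i q P = 0 := by
    simp [P, he]
  have hirr : Irreducible P := by
    refine irreducible_X_pow_sub_X_sub_C p fun x hx => hqS ?_
    obtain ⟨n, hn⟩ : ∃ n : ℕ, q - i x = n := by
      refine exists_eq_natCast_of_pow_char_eq p ?_
      rw [sub_pow_char_of_commute _ (hq x).symm, ← map_pow, ← sub_eq_zero, sub_sub_sub_comm, he,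
        ← map_sub, hx, sub_self]
    exact ⟨x + n, by rw [map_add, map_natCast, ← hn, add_sub_cancel]⟩
  have : Fact (Irreducible P) := ⟨hirr⟩
  let L := AdjoinRoot P
  have : CharP L p := charP_of_injective_algebraMap (algebraMap S L).injective p
  let j : L →+* D := Ideal.Quotient.lift _ (eval₂RingHom' i q hq) (by
    intro f hf
    obtain ⟨g, rfl⟩ := Ideal.mem_span_singleton'.1 hf
    change eval₂ i q (g * P) = 0
    rw [eval₂_mul_noncomm _ _ fun k => hq _, hPq, mul_zero])
  have hfin : Module.finrank S L = p := by
    have := (AdjoinRoot.powerBasis' (monic_X_pow_sub_X_sub_C p (algebraMap E S e))).finrank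
    rw [AdjoinRoot.powerBasis'_dim, natDegree_X_pow_sub_X_sub_C] at this
    exact this
  refine ⟨L, inferInstance, inferInstance, inferInstance, inferInstance, j, ?_, hfin, ?_, ?_⟩
  · have hfd : FiniteDimensional S L := Module.finite_of_finrank_pos (by rw [hfin]; exact hp.pos)
    have hfdE : FiniteDimensional E L := FiniteDimensional.trans E S L
    let α : L := AdjoinRoot.root P
    have hα : α ^ p - α = algebraMap E L e := by
      have h1 := AdjoinRoot.eval₂_root P
      simp only [P, eval₂_sub, eval₂_X_pow, eval₂_X, eval₂_C] at h1
      exact sub_eq_zero.1 h1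
    let K1 : IntermediateField E L := (IsScalarTower.toAlgHom E S L).fieldRange
    have hK1 : IsGalois E K1 :=
      IsGalois.of_algEquiv (AlgEquiv.ofInjectiveField (IsScalarTower.toAlgHom E S L))
    let P0 : E[X] := X ^ p - X - C e
    have hP0 : P0.map (algebraMap E L) = X ^ p - X - C (algebraMap E L e) := by
      simp [P0]
    let K2 : IntermediateField E L := adjoin E (P0.rootSet L)
    have hs : P0.IsSplittingField E K2 := by
      refine adjoin_rootSet_isSplittingField ?_
      rw [hP0]
      exact splits_X_pow_sub_X_sub_C_of_root p hα
    have hK2 : IsGalois E K2 :=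
      IsGalois.of_separable_splitting_field (separable_X_pow_sub_X_sub_C p e)
    have htop : K1 ⊔ K2 = ⊤ := by
      suffices h : ∀ x, x ∈ K1 ⊔ K2 from top_le_iff.1 fun x _ => h x
      intro x
      obtain ⟨f, rfl⟩ := AdjoinRoot.mk_surjective x
      have hαK : α ∈ K1 ⊔ K2 := by
        refine (le_sup_right : K2 ≤ K1 ⊔ K2) (subset_adjoin E _ ?_)
        rw [mem_rootSet]
        refine ⟨(monic_X_pow_sub_X_sub_C p e).ne_zero, ?_⟩
        simp [P0, hα]
      induction f using Polynomial.induction_on' with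
      | add f g hf hg => rw [map_add]; exact add_mem hf hg
      | monomial n s =>
        rw [← C_mul_X_pow_eq_monomial, map_mul, map_pow]
        exact mul_mem ((le_sup_left : K1 ≤ K1 ⊔ K2) ⟨s, rfl⟩) (pow_mem hαK n)
    have hsup : IsGalois E ↥(K1 ⊔ K2) :=
      { to_isSeparable := inferInstance, to_normal := inferInstance }
    rw [htop] at hsup
    exact IsGalois.of_algEquiv topEquiv
  · ext s
    change eval₂ i q (C s) = i s
    simp
  · refine ⟨AdjoinRoot.root P, ?_⟩
    change eval₂ i q X = q
    simp

end ArtinSchreierExtension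

section ArtinSchreierDescent

open Polynomial IntermediateField

variable {E S : Type*} [Field E] [Field S] [Algebra E S] [FiniteDimensional E S] [IsGalois E S]

theorem exists_adjoin_pow_eq_top [Infinite E] {m : ℕ} (hm : m ≠ 0) :
    ∃ r : S, r ≠ 0 ∧ E⟮r ^ m⟯ = ⊤ := by
  classical
  suffices h : ∃ r : S, E⟮r ^ m⟯ = ⊤ by
    obtain ⟨r, hr⟩ := h
    by_cases h0 : r = 0
    · refine ⟨1, one_ne_zero, ?_⟩
      rw [one_pow, adjoin_one]
      rwa [h0, zero_pow hm, adjoin_zero] at hr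
    · exact ⟨r, h0, hr⟩
  obtain ⟨θ, hθ⟩ := Field.exists_primitive_element E S
  let P : S[X] := ∏ σ : {σ : S ≃ₐ[E] S // σ ≠ 1}, ((X + C (σ.1 θ)) ^ m - (X + C θ) ^ m)
  have hP : P ≠ 0 := by
    refine Finset.prod_ne_zero_iff.2 fun σ _ h => σ.2 ?_
    have h1 := congrArg (eval (-θ)) h
    simp only [eval_sub, eval_pow, eval_add, eval_X, eval_C, neg_add_cancel, zero_pow hm,
      sub_zero, eval_zero] at h1
    have h2 : σ.1 θ = θ := by
      have := pow_eq_zero_iff hm |>.1 h1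
      linear_combination this
    have h3 : E⟮θ⟯ ≤ fixedField (Subgroup.zpowers σ.1) := by
      rw [adjoin_simple_le_iff, mem_fixedField_iff]
      intro f hf
      have h4 : Subgroup.zpowers σ.1 ≤ MulAction.stabilizer (S ≃ₐ[E] S) θ := by
        rw [Subgroup.zpowers_le]; exact h2
      exact h4 hf
    ext x
    rw [hθ] at h3
    exact (mem_fixedField_iff _ _).1 (h3 (mem_top (x := x))) σ.1 (Subgroup.mem_zpowers _)
  obtain ⟨f, hf⟩ : ∃ f : E, P.eval (algebraMap E S f) ≠ 0 := by
    by_contra! hcon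
    refine hP (eq_zero_of_infinite_isRoot P ?_)
    exact (Set.infinite_range_of_injective (algebraMap E S).injective).mono
      (by rintro _ ⟨f, rfl⟩; exact hcon f)
  refine ⟨algebraMap E S f + θ, ?_⟩
  have hbot : fixingSubgroup E⟮(algebraMap E S f + θ) ^ m⟯ = ⊥ := by
    rw [eq_bot_iff]
    intro σ hσ
    by_contra hne
    have hne' : σ ≠ 1 := hne
    rw [IntermediateField.mem_fixingSubgroup_iff] at hσ
    have h1 := hσ _ (mem_adjoin_simple_self E _)
    simp only [P, eval_prod, Finset.prod_ne_zero_iff] at hf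
    refine hf ⟨σ, hne'⟩ (Finset.mem_univ _) ?_
    simp only [map_pow, map_add, AlgEquiv.commutes] at h1
    simp [h1]
  rw [← IsGalois.fixedField_fixingSubgroup E⟮(algebraMap E S f + θ) ^ m⟯, hbot, fixedField_bot]

/-- The sums of distinct elements of `{1, p, …, p ^ (j - 1)}`. -/
def powSums (p : ℕ) : ℕ → Set ℕ
  | 0 => {0}
  | j + 1 => powSums p j ∪ (· + p ^ j) '' powSums p j

theorem zero_mem_powSums (p j : ℕ) : 0 ∈ powSums p j := by
  induction j with
  | zero => rfl
  | succ j ih => exact Or.inl ih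

theorem exists_span_powSums_eq_top (p : ℕ) [ExpChar E p] {c : S} (hc : E⟮c⟯ = ⊤) :
    ∃ k, Submodule.span E ((c ^ ·) '' powSums p (k + 1)) = ⊤ := by
  let V : ℕ → Submodule E S := fun j => Submodule.span E ((c ^ ·) '' powSums p j)
  have hmono : Monotone V := monotone_nat_of_le_succ fun j =>
    Submodule.span_mono (Set.image_mono Set.subset_union_left)
  obtain ⟨k, hk⟩ := WellFoundedGT.monotone_chain_condition ⟨V, hmono⟩
  have hk : V k = V (k + 1) := hk (k + 1) (Nat.le_succ k)
  refine ⟨k, ?_⟩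
  change V (k + 1) = ⊤
  rw [← hk]
  have hmul : ∀ y ∈ V k, c ^ p ^ k * y ∈ V k := by
    intro y hy
    have h1 : V k ≤ (V k).comap (LinearMap.mulLeft E (c ^ p ^ k)) := by
      refine Submodule.span_le.2 ?_
      rintro _ ⟨n, hn, rfl⟩
      change c ^ p ^ k * c ^ n ∈ V k
      rw [hk]
      refine Submodule.subset_span ⟨n + p ^ k, Or.inr ⟨n, hn, rfl⟩, ?_⟩
      change c ^ (n + p ^ k) = _
      rw [pow_add, mul_comm]
    exact h1 hy
  have h1 : (1 : S) ∈ V k := Submodule.subset_span ⟨0, zero_mem_powSums p k, pow_zero c⟩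
  have hpow : ∀ n : ℕ, (c ^ p ^ k) ^ n ∈ V k := by
    intro n
    induction n with
    | zero => simpa using h1
    | succ n ih => rw [pow_succ']; exact hmul _ ih
  have hadj : E⟮c ^ p ^ k⟯ = ⊤ := by
    rw [← adjoin_simple_eq_adjoin_pow_expChar_pow_of_isSeparable' E S c p k, hc]
  have halg : Algebra.adjoin E {c ^ p ^ k} = ⊤ := by
    rw [← adjoin_simple_toSubalgebra_of_isAlgebraic (Algebra.IsAlgebraic.isAlgebraic _), hadj]
    rfl
  rw [eq_top_iff]
  intro y _
  have hy : y ∈ Algebra.adjoin E {c ^ p ^ k} := by rw [halg]; trivial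
  rw [Algebra.adjoin_singleton_eq_range_aeval] at hy
  obtain ⟨f, rfl⟩ := hy
  change aeval (c ^ p ^ k) f ∈ V k
  rw [aeval_eq_sum_range]
  exact Submodule.sum_mem _ fun i _ => Submodule.smul_mem _ _ (hpow i)

/-- The additive Artin-Schreier map `x ↦ x ^ p - x`. -/
def artinSchreier (R : Type*) [CommRing R] (p : ℕ) [Fact p.Prime] [CharP R p] : R →+ R :=
  (frobenius R p).toAddMonoidHom - AddMonoidHom.id R

theorem artinSchreier_apply {R : Type*} [CommRing R] {p : ℕ} [Fact p.Prime] [CharP R p] (x : R) :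
    artinSchreier R p x = x ^ p - x := rfl

theorem exists_artinSchreier_add_mul_mem_range (p : ℕ) [Fact p.Prime] [CharP E p] [CharP S p]
    [Infinite E] {b : E} (hb : b ≠ 0) (a : S) :
    ∃ (v s t : S) (e : E),
      (a + (v ^ p - v)) + algebraMap E S b * t ^ p * (a + (s ^ p - s)) = algebraMap E S e := by
  have hp : p.Prime := Fact.out
  have hp1 : p - 1 ≠ 0 := by have := hp.two_le; omega
  obtain ⟨r, hr0, hr⟩ := exists_adjoin_pow_eq_top (E := E) (S := S) hp1
  obtain ⟨k, hk⟩ := exists_span_powSums_eq_top p hr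
  set c := r ^ (p - 1) with hc
  set t := r ^ p ^ k with ht
  have ht0 : t ≠ 0 := pow_ne_zero _ hr0
  have htc : t ^ (p - 1) = c ^ p ^ k := by rw [ht, hc, ← pow_mul, ← pow_mul, mul_comm]
  let W : AddSubgroup S := (algebraMap E S).toAddMonoidHom.range ⊔ (artinSchreier S p).range ⊔
    ((AddMonoidHom.mulLeft (algebraMap E S b * t ^ p)).comp (artinSchreier S p)).range
  have hE : ∀ e : E, algebraMap E S e ∈ W := fun e =>
    le_sup_left (α := AddSubgroup S) (le_sup_left (α := AddSubgroup S) ⟨e, rfl⟩)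
  have hA : ∀ x : S, x ^ p - x ∈ W := fun x =>
    le_sup_left (α := AddSubgroup S) (le_sup_right (α := AddSubgroup S) ⟨x, rfl⟩)
  have hB : ∀ x : S, algebraMap E S b * t ^ p * (x ^ p - x) ∈ W := fun x =>
    le_sup_right (α := AddSubgroup S) ⟨x, rfl⟩
  have hcp : ∀ n i : ℕ, (c ^ (n * p ^ i)) ^ p = c ^ (n * p ^ (i + 1)) := fun n i => by
    rw [← pow_mul c, pow_succ, mul_assoc]
  clear_value c t
  have key : ∀ j ≤ k + 1, ∀ n ∈ powSums p j, ∀ f : E,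
      algebraMap E S f * c ^ (n * p ^ (k + 1 - j)) ∈ W := by
    intro j
    induction j with
    | zero =>
      rintro - n rfl f
      simpa using hE f
    | succ j ih =>
      intro hj n hn f
      have hexp : k + 1 - j = (k + 1 - (j + 1)) + 1 := by omega
      have ih := ih (by omega)
      set i := k + 1 - (j + 1) with hi
      rw [hexp] at ih
      rcases hn with hn | ⟨n, hn, rfl⟩
      · have h1 := ih n hn (f ^ p)
        have h2 := hA (algebraMap E S f * c ^ (n * p ^ i))
        have h3 : algebraMap E S (f ^ p) * c ^ (n * p ^ (i + 1)) =
            (algebraMap E S f * c ^ (n * p ^ i)) ^ p := by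
          rw [mul_pow, map_pow, hcp]
        rw [h3] at h1
        simpa using W.sub_mem h1 h2
      · have h1 := ih n hn (b * (f / b) ^ p)
        have h2 := hB (algebraMap E S (f / b) * c ^ (n * p ^ i) / t)
        have h3 : algebraMap E S (b * (f / b) ^ p) * c ^ (n * p ^ (i + 1)) =
            algebraMap E S b * t ^ p * (algebraMap E S (f / b) * c ^ (n * p ^ i) / t) ^ p := by
          rw [div_pow _ t, mul_pow, map_mul, map_pow, hcp]
          field_simp
        have h4 : algebraMap E S b * t ^ p * (algebraMap E S (f / b) * c ^ (n * p ^ i) / t) =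
            algebraMap E S f * c ^ ((n + p ^ j) * p ^ i) := by
          have h5 : t ^ p = t ^ (p - 1) * t := by rw [← pow_succ]; congr 1; omega
          have h6 : p ^ j * p ^ i = p ^ k := by rw [← pow_add]; congr 1; omega
          have hb' : algebraMap E S b ≠ 0 := by simpa using hb
          rw [h5, htc, add_mul, pow_add, h6, map_div₀]
          field_simp
        rw [h3] at h1
        have h7 := W.sub_mem h1 h2
        rw [mul_sub, sub_sub_cancel, h4] at h7
        exact h7
  have hW : ∀ x : S, x ∈ W := by
    intro x
    have hx : x ∈ Submodule.span E ((c ^ ·) '' powSums p (k + 1)) := by rw [hk]; trivial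
    induction hx using Submodule.closure_induction with
    | zero => exact W.zero_mem
    | add x y _ _ hx hy => exact W.add_mem hx hy
    | smul_mem f x hx =>
      obtain ⟨n, hn, rfl⟩ := hx
      have := key (k + 1) le_rfl n hn f
      simpa [Algebra.smul_def] using this
  obtain ⟨y, hy, _, ⟨s, rfl⟩, h⟩ :=
    AddSubgroup.mem_sup.1 (hW (a + algebraMap E S b * t ^ p * a))
  obtain ⟨_, ⟨e, rfl⟩, _, ⟨v, rfl⟩, rfl⟩ := AddSubgroup.mem_sup.1 hy
  refine ⟨-v, -s, t, e, ?_⟩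
  rw [← artinSchreier_apply, ← artinSchreier_apply, map_neg, map_neg]
  change algebraMap E S e + artinSchreier S p v + algebraMap E S b * t ^ p * artinSchreier S p s = _
    at h
  linear_combination h.symm

end ArtinSchreierDescent

section MaximalSubfields

open Module

theorem isSubfield_range {L : Type*} {D : Type u} [Field L] [DivisionRing D] (j : L →+* D) :
    IsSubfield j.range := by
  refine ⟨?_, ?_⟩
  · rintro _ ⟨a, rfl⟩ _ ⟨b, rfl⟩
    rw [← map_mul, mul_comm, map_mul]
  · rintro _ ⟨a, rfl⟩
    exact ⟨a⁻¹, map_inv₀ j a⟩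

theorem IsMaximalSubfield.mem_of_forall_commute {D : Type u} [DivisionRing D] {K : Subring D}
    (hK : IsMaximalSubfield K) {d : D} (hd : ∀ a ∈ K, Commute d a) : d ∈ K := by
  have hcomm : ∀ a ∈ insert d (K : Set D), ∀ b ∈ insert d (K : Set D), a * b = b * a := by
    rintro a (rfl | ha) b (rfl | hb)
    · rfl
    · exact hd b hb
    · exact (hd a ha).symm
    · exact hK.1.1 a ha b hb
  have hsub : insert d (K : Set D) ⊆
      Set.centralizer (Set.centralizer (insert d (K : Set D))) :=
    Set.subset_centralizer_centralizer
  have hle : Set.centralizer (Set.centralizer (insert d (K : Set D))) ⊆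
      Set.centralizer (insert d (K : Set D)) :=
    Set.centralizer_subset fun a ha b hb => hcomm b hb a ha
  have hK' : IsSubfield (Subring.centralizer (Set.centralizer (insert d (K : Set D)))) := by
    refine ⟨fun a ha b hb => (hb a (hle ha)), fun a ha => ?_⟩
    exact Set.inv_mem_centralizer₀ ha
  have := hK.2 _ hK' fun a ha => hsub (Set.mem_insert_of_mem _ ha)
  rw [← this]
  exact hsub (Set.mem_insert _ _)

variable {k : Type*} {D : Type u} [Field k] [DivisionRing D] [Algebra k D]

/-- The range of a ring homomorphism into a `k`-algebra, as a subalgebra. -/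
def rangeSubalgebra {L : Type*} [Field L] (j : L →+* D)
    (hj : ∀ c : k, algebraMap k D c ∈ j.range) : Subalgebra k D :=
  { j.range with algebraMap_mem' := hj }

theorem mem_rangeSubalgebra {L : Type*} [Field L] (j : L →+* D)
    (hj : ∀ c : k, algebraMap k D c ∈ j.range) {d : D} :
    d ∈ rangeSubalgebra j hj ↔ d ∈ j.range := Iff.rfl

theorem algebraMap_mem_range_of_comp {S L : Type*} [Field S] [Field L] {j : L →+* D} {i : S →+* D}
    {f : S →+* L} (h : j.comp f = i) (hi : ∀ c : k, algebraMap k D c ∈ i.range) (c : k) :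
    algebraMap k D c ∈ j.range := by
  obtain ⟨s, hs⟩ := hi c
  exact ⟨f s, by rw [← hs, ← h]; rfl⟩

theorem finrank_rangeSubalgebra {S L : Type*} [Field S] [Field L] [Algebra S L] {j : L →+* D}
    {i : S →+* D} (h : j.comp (algebraMap S L) = i) (hi : ∀ c : k, algebraMap k D c ∈ i.range) :
    finrank k (rangeSubalgebra j (algebraMap_mem_range_of_comp h hi)) =
      finrank k (rangeSubalgebra i hi) * finrank S L := by
  let eS : S ≃+* rangeSubalgebra i hi := RingEquiv.ofBijective
    (i.codRestrict (rangeSubalgebra i hi) fun s => ⟨s, rfl⟩)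
    ⟨fun a b hab => i.injective (congrArg Subtype.val hab), fun ⟨d, s, hs⟩ => ⟨s, Subtype.ext hs⟩⟩
  have heS : ∀ s, (eS s : D) = i s := fun _ => rfl
  let σ : k →+* S := eS.symm.toRingHom.comp (algebraMap k (rangeSubalgebra i hi))
  have hσ : ∀ c, i (σ c) = algebraMap k D c := fun c => by
    rw [← heS]
    change ((eS (eS.symm (algebraMap k (rangeSubalgebra i hi) c)) : rangeSubalgebra i hi) : D) = _
    rw [RingEquiv.apply_symm_apply]; rfl
  let _ : Algebra k S := σ.toAlgebra
  let _ : Algebra k L := ((algebraMap S L).comp σ).toAlgebra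
  have : IsScalarTower k S L := IsScalarTower.of_algebraMap_eq fun _ => rfl
  let fS : S →ₐ[k] D := { i with commutes' := hσ }
  let fL : L →ₐ[k] D := { j with commutes' := fun c => by rw [← hσ c, ← h]; rfl }
  have h1 : finrank k S = finrank k (rangeSubalgebra i hi) :=
    (AlgEquiv.ofInjective fS i.injective).toLinearEquiv.finrank_eq
  have h2 : finrank k L = finrank k (rangeSubalgebra j (algebraMap_mem_range_of_comp h hi)) :=
    (AlgEquiv.ofInjective fL j.injective).toLinearEquiv.finrank_eq
  rw [← h1, ← h2, finrank_mul_finrank]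

variable [FiniteDimensional k D]

theorem mem_range_of_forall_commute (hc : Algebra.IsCentral k D) {S : Type*} [Field S]
    {i : S →+* D} (hi : ∀ c : k, algebraMap k D c ∈ i.range) {d : D}
    (hd : ∀ w, (∀ s, Commute (i s) w) → Commute d w) : d ∈ i.range := by
  rw [← mem_rangeSubalgebra i hi, ← centralizer_centralizer_eq hc (rangeSubalgebra i hi),
    Subalgebra.mem_centralizer_iff]
  intro w hw
  exact (hd w fun s => Subalgebra.mem_centralizer_iff k |>.1 hw (i s) ⟨s, rfl⟩).symm

theorem isMaximalSubfield_range_iff (hc : Algebra.IsCentral k D) {L : Type*} [Field L]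
    {j : L →+* D} (hj : ∀ c : k, algebraMap k D c ∈ j.range) :
    IsMaximalSubfield j.range ↔
      finrank k (rangeSubalgebra j hj) * finrank k (rangeSubalgebra j hj) = finrank k D := by
  set K := rangeSubalgebra j hj with hKdef
  have hle : K ≤ Subalgebra.centralizer k (K : Set D) := by
    intro a ha
    rw [Subalgebra.mem_centralizer_iff]
    exact fun b hb => (isSubfield_range j).1 b hb a ha
  have hmul := finrank_mul_finrank_centralizer hc K
  constructor
  · intro hmax
    have : Subalgebra.centralizer k (K : Set D) = K := by
      refine le_antisymm (fun a ha => ?_) hle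
      exact hmax.mem_of_forall_commute fun b hb =>
        ((Subalgebra.mem_centralizer_iff k).1 ha b hb).symm
    rwa [this] at hmul
  · intro hfr
    have hpos : 0 < finrank k K := finrank_pos
    have heq : Subalgebra.centralizer k (K : Set D) = K := by
      refine (Subalgebra.eq_of_le_of_finrank_eq hle ?_).symm
      exact Nat.eq_of_mul_eq_mul_left hpos (hfr.trans hmul.symm)
    refine ⟨isSubfield_range j, fun K' hK' hle' => le_antisymm (fun a ha => ?_) hle'⟩
    rw [← mem_rangeSubalgebra j hj, ← hKdef, ← heq, Subalgebra.mem_centralizer_iff]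
    exact fun b hb => hK'.1 b (hle' hb) a ha

/-- Maximality of a subfield only depends on its degree over a common subfield. -/
theorem IsMaximalSubfield.of_finrank_eq (hc : Algebra.IsCentral k D) {S L L' : Type*} [Field S]
    [Field L] [Field L'] [Algebra S L] [Algebra S L'] {j : L →+* D} {j' : L' →+* D} {i : S →+* D}
    (h : j.comp (algebraMap S L) = i) (h' : j'.comp (algebraMap S L') = i)
    (hi : ∀ c : k, algebraMap k D c ∈ i.range) (hfr : finrank S L' = finrank S L)
    (hj : IsMaximalSubfield j.range) : IsMaximalSubfield j'.range := by
  rw [isMaximalSubfield_range_iff hc (algebraMap_mem_range_of_comp h hi),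
    finrank_rangeSubalgebra h hi] at hj
  rwa [isMaximalSubfield_range_iff hc (algebraMap_mem_range_of_comp h' hi),
    finrank_rangeSubalgebra h' hi, hfr]

end MaximalSubfields

section CommutatorIdentity

open LinearMap

theorem exists_mul_eq_mul_sub_one (p : ℕ) [Fact p.Prime] {D : Type*} [DivisionRing D] [CharP D p]
    {Z : Set D} {x w : D} (hx : x ∈ Subring.centralizer Z) (hw : w ∈ Subring.centralizer Z)
    (hxp : Commute (x ^ p) w) (hxw : ¬ Commute x w) :
    ∃ y ∈ Subring.centralizer Z, y * x = x * (y - 1) := by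
  let _ : Algebra (ZMod p) D := ZMod.algebra D p
  have hexp : ExpChar (Module.End (ZMod p) D) p :=
    expChar_of_injective_algebraMap (algebraMap (ZMod p) (Module.End (ZMod p) D)).injective p
  let f : Module.End (ZMod p) D := mulLeft (ZMod p) x - mulRight (ZMod p) x
  have hf : ∀ z, f z = x * z - z * x := fun z => rfl
  have hfp : (f ^ p) w = 0 := by
    have h1 := sub_pow_expChar_pow_of_commute p 1 (commute_mulLeft_right (R := ZMod p) x x)
    rw [pow_one, pow_mulLeft, pow_mulRight] at h1
    rw [show f ^ p = _ from h1, LinearMap.sub_apply, mulLeft_apply, mulRight_apply, hxp.eq,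
      sub_self]
  have hmem : ∀ n, (f ^ n) w ∈ Subring.centralizer Z := by
    intro n
    induction n with
    | zero => exact hw
    | succ n ih =>
      rw [pow_succ', Module.End.mul_apply, hf]
      exact sub_mem (mul_mem hx ih) (mul_mem ih hx)
  have hex : ∃ n, (f ^ (n + 1)) w = 0 :=
    ⟨p - 1, by rw [Nat.sub_add_cancel (Fact.out : p.Prime).one_le]; exact hfp⟩
  classical
  obtain ⟨n, hn, hn'⟩ : ∃ n, (f ^ (n + 1)) w ≠ 0 ∧ (f ^ (n + 2)) w = 0 := by
    have hpos : Nat.find hex ≠ 0 := by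
      intro h0
      have := Nat.find_spec hex
      rw [h0, zero_add, pow_one, hf, sub_eq_zero] at this
      exact hxw this
    obtain ⟨n, hn⟩ := Nat.exists_eq_succ_of_ne_zero hpos
    refine ⟨n, Nat.find_min hex (by omega), ?_⟩
    have := Nat.find_spec hex
    rwa [hn] at this
  set w' := (f ^ n) w with hw'
  set g := x * w' - w' * x with hg
  have hgw : (f ^ (n + 1)) w = g := by rw [pow_succ', Module.End.mul_apply, hf]
  have hg0 : g ≠ 0 := hgw ▸ hn
  have hgx : x * g = g * x := by
    rw [pow_succ', Module.End.mul_apply, hgw, hf, sub_eq_zero] at hn'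
    exact hn'
  have hginv : g⁻¹ * x = x * g⁻¹ := (Commute.inv_left₀ (show Commute g x from hgx.symm)).eq
  have hgmem : g ∈ Subring.centralizer Z := hgw ▸ hmem (n + 1)
  refine ⟨w' * g⁻¹ * x, mul_mem (mul_mem (hmem n) (Set.inv_mem_centralizer₀ hgmem)) hx, ?_⟩
  have h1 : w' * x = x * w' - g := by rw [hg]; abel
  calc w' * g⁻¹ * x * x = w' * x * g⁻¹ * x := by rw [mul_assoc w', hginv, ← mul_assoc]
    _ = x * (w' * g⁻¹ * x) - g * g⁻¹ * x := by rw [h1]; noncomm_ring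
    _ = x * (w' * g⁻¹ * x - 1) := by rw [mul_inv_cancel₀ hg0]; noncomm_ring

end CommutatorIdentity

section InseparableGenerator

open Module IntermediateField

/-- The embedding `f` of a field into `D` extends to a finite Galois extension whose image is a
maximal subfield. -/
def ExtendsToGaloisMaximal {E : Type v} {D : Type u} [Field E] [DivisionRing D]
    (f : E →+* D) : Prop :=
  ∃ (L : Type u) (_ : Field L) (_ : Algebra E L) (j : L →+* D), FiniteDimensional E L ∧
    IsGalois E L ∧ j.comp (algebraMap E L) = f ∧ IsMaximalSubfield j.range

variable {k : Type*} {D : Type u} [Field k] [DivisionRing D] [Algebra k D] [FiniteDimensional k D]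

/-- The key replacement step: a maximal subfield `L` having degree `p` over a Galois extension `S`
of `E` and containing a `p`-th root of an element of `E` outside `S` can be replaced by a maximal
subfield which is Galois over `E`. -/
theorem exists_isGalois_of_pow_eq_algebraMap (hc : Algebra.IsCentral k D) (p : ℕ) [Fact p.Prime]
    {E : Type v} [Field E] [CharP E p] {L : Type u} [Field L] [Algebra E L]
    [FiniteDimensional E L] (S : IntermediateField E L) [IsGalois E S] (hSL : finrank S L = p)
    {X : L} {b : E} (hXS : X ∉ S) (hXb : X ^ p = algebraMap E L b) (j : L →+* D)
    (hmax : IsMaximalSubfield j.range) (hk : ∀ c : k, ∃ s ∈ S, j s = algebraMap k D c) :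
    ExtendsToGaloisMaximal (j.comp (algebraMap E L)) := by
  have hpr : p.Prime := Fact.out
  have hcharL : CharP L p := charP_of_injective_algebraMap (algebraMap E L).injective p
  have hcharS : CharP S p := charP_of_injective_algebraMap (algebraMap E S).injective p
  have hcharD : CharP D p := charP_of_injective_ringHom j.injective p
  have hinf : Infinite E := by
    by_contra hfin
    rw [not_infinite_iff_finite] at hfin
    obtain ⟨β, hβ⟩ := surjective_frobenius E p b
    rw [frobenius_def] at hβ
    refine hXS ?_
    rw [← hβ, map_pow] at hXb
    rw [frobenius_inj L p hXb]
    exact S.algebraMap_mem β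
  have hb : b ≠ 0 := by
    rintro rfl
    rw [map_zero] at hXb
    rw [pow_eq_zero_iff hpr.ne_zero] at hXb
    exact hXS (hXb ▸ S.zero_mem)
  let i : S →+* D := j.comp (algebraMap S L)
  have hi : ∀ c : k, algebraMap k D c ∈ i.range := fun c => by
    obtain ⟨s, hs, hsc⟩ := hk c
    exact ⟨⟨s, hs⟩, hsc⟩
  set x := j X with hx
  have hix : ∀ s, Commute (i s) x := fun s => by
    change j s * j X = j X * j s
    rw [← map_mul, mul_comm, map_mul]
  have hxi : x ∉ i.range := by
    rintro ⟨s, hs⟩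
    exact hXS (j.injective (a₁ := (s : L)) (a₂ := X) hs ▸ s.2)
  have hxpow : x ^ p = i (algebraMap E S b) := by
    rw [hx, ← map_pow, hXb]; rfl
  obtain ⟨w, hwi, hwx⟩ : ∃ w, (∀ s, Commute (i s) w) ∧ ¬ Commute x w := by
    by_contra! h
    exact hxi (mem_range_of_forall_commute hc hi h)
  obtain ⟨y, hyi, hyx⟩ := exists_mul_eq_mul_sub_one p (Z := Set.range i) (x := x) (w := w)
    (by rintro _ ⟨s, rfl⟩; exact hix s) (by rintro _ ⟨s, rfl⟩; exact hwi s)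
    (hxpow ▸ hwi _) hwx
  have hiy : ∀ s, Commute (i s) y := fun s => hyi (i s) ⟨s, rfl⟩
  have hxy : ¬ Commute x y := by
    intro h
    rw [← h.eq, mul_sub, mul_one, eq_comm, sub_eq_self] at hyx
    exact hxi (hyx ▸ zero_mem _)
  have hsimple : IsSimpleOrder (IntermediateField S L) :=
    isSimpleOrder_of_finrank_prime S L (hSL ▸ hpr)
  let cent : (z : D) → (∀ s, Commute (i s) z) → IntermediateField S L := fun z hz =>
    { (Subring.centralizer {z}).comap j with
      algebraMap_mem' := fun s => by
        rintro _ rfl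
        exact (hz s).symm
      inv_mem' := fun l hl => by
        rintro _ rfl
        change _ * j l⁻¹ = j l⁻¹ * _
        rw [map_inv₀]
        exact (Commute.inv_right₀ (hl _ rfl)) }
  have hcent : ∀ z hz l, l ∈ cent z hz ↔ Commute z (j l) := fun z hz l =>
    ⟨fun h => h z rfl, by rintro h _ rfl; exact h⟩
  -- `y ^ p - y` lies in `S`.
  set a := y ^ p - y with ha
  have hax : Commute x a := by
    have h1 : SemiconjBy x (y - 1) y := hyx.symm
    have h2 := h1.pow_right p
    rw [sub_pow_char_of_commute p (Commute.one_right y), one_pow] at h2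
    have h3 := h2.sub_right h1
    rwa [show y ^ p - 1 - (y - 1) = a by rw [ha]; abel] at h3
  have hia : ∀ s, Commute (i s) a := fun s => ((hiy s).pow_right p).sub_right (hiy s)
  have haL : a ∈ j.range := by
    refine hmax.mem_of_forall_commute ?_
    rintro _ ⟨l, rfl⟩
    rw [← hcent a hia]
    have : cent a hia = ⊤ := by
      refine (eq_bot_or_eq_top _).resolve_left fun hbot => hXS ?_
      have hXm : X ∈ cent a hia := (hcent a hia X).2 hax.symm
      rw [hbot, mem_bot] at hXm
      obtain ⟨s, hs⟩ := hXm
      exact hs ▸ s.2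
    rw [this]
    exact mem_top
  obtain ⟨A', hA'⟩ := haL
  obtain ⟨A, hA⟩ : ∃ A : S, i A = a := by
    have hAm : A' ∈ cent y hiy := (hcent y hiy A').2 (by
      rw [hA', ha]
      exact ((Commute.refl y).pow_right p).sub_right (Commute.refl y))
    have : cent y hiy = ⊥ := by
      refine (eq_bot_or_eq_top _).resolve_right fun htop => hxy ?_
      exact ((hcent y hiy X).1 (htop ▸ mem_top)).symm
    rw [this, mem_bot] at hAm
    obtain ⟨s, hs⟩ := hAm
    exact ⟨s, by rw [← hA', ← hs]; rfl⟩
  obtain ⟨v, s, t, e, he⟩ := exists_artinSchreier_add_mul_mem_range p hb A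
  let q : D := (y + i v) + i t * (x * (y + i s))
  have hii : ∀ s t, Commute (i s) (i t) := fun s t => by
    change i s * i t = i t * i s
    rw [← map_mul, mul_comm, map_mul]
  have hiq : ∀ s, Commute (i s) q := fun r =>
    ((hiy r).add_right (hii r v)).add_right
      ((hii r t).mul_right ((hix r).mul_right ((hiy r).add_right (hii r s))))
  have hadd : ∀ r, (y + i r) ^ p - (y + i r) = i (A + (r ^ p - r)) := fun r => by
    rw [add_pow_char_of_commute p (hiy r).symm, map_add, hA, ha, map_sub, map_pow]
    abel
  have hqe : q ^ p - q = i (algebraMap E S e) := by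
    let _ : Algebra (ZMod p) D := ZMod.algebra D p
    rw [artinSchreier_of_mul_eq p hyx (hix v) (hix s) (hix t) (hiy v) (hiy s) (hiy t) (hii v s)
      (hii v t) (hii t s), hadd, hadd, hxpow, ← he, ← map_pow, ← map_mul, ← map_mul, ← map_add]
    congr 1
    ring
  have hqi : q ∉ i.range := by
    rintro ⟨r, hr⟩
    have h1 : q * x = x * q := by rw [← hr]; exact hix r
    have h2 : q * x = x * q - (1 + i t * x) * x := by
      have e1 : (y + i v) * x = x * (y + i v) - x := by
        rw [add_mul, hyx, (hix v).eq]; noncomm_ring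
      have e2 : (y + i s) * x = x * (y + i s) - x := by
        rw [add_mul, hyx, (hix s).eq]; noncomm_ring
      change ((y + i v) + i t * (x * (y + i s))) * x = x * ((y + i v) + i t * (x * (y + i s))) - _
      have e3 : x * (i t * (x * (y + i s))) = i t * (x * (x * (y + i s))) := by
        rw [← mul_assoc, ← (hix t).eq, mul_assoc]
      rw [add_mul, e1, mul_assoc (i t), mul_assoc x, e2, mul_add x (y + i v), e3]
      noncomm_ring
    rw [h1, eq_comm, sub_eq_self, mul_eq_zero] at h2
    rcases h2 with h2 | h2
    · have ht : t ≠ 0 := by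
        rintro rfl
        rw [map_zero, zero_mul, add_zero] at h2
        exact one_ne_zero h2
      have hit : i t ≠ 0 := by rwa [Ne, map_eq_zero]
      refine hxi ⟨-t⁻¹, ?_⟩
      rw [map_neg, map_inv₀]
      have : i t * x = -1 := by rw [eq_neg_iff_add_eq_zero, add_comm]; exact h2
      rw [← inv_mul_cancel_left₀ hit x, this, mul_neg_one]
    · exact hxi (h2 ▸ zero_mem _)
  obtain ⟨L', fL', aEL', aSL', tower, j', hgal, hrank, hcomp, -⟩ :=
    exists_isGalois_of_artinSchreier p i hiq hqi hqe
  have hfinSL' : FiniteDimensional S L' := .of_finrank_pos (hrank ▸ hpr.pos)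
  refine ⟨L', fL', aEL', j', .trans E S L', hgal, ?_, ?_⟩
  · rw [IsScalarTower.algebraMap_eq E S L', ← RingHom.comp_assoc, hcomp]
    rfl
  · exact IsMaximalSubfield.of_finrank_eq hc (j := j) (i := i) rfl hcomp hi
      (hrank.trans hSL.symm) hmax

end InseparableGenerator

section InseparableNormal

open Module IntermediateField Polynomial

theorem isGalois_separableClosure_of_isPurelyInseparable (E E' L : Type*) [Field E] [Field E']
    [Field L] [Algebra E E'] [Algebra E L] [Algebra E' L] [IsScalarTower E E' L]
    [IsPurelyInseparable E E'] [Normal E' L] : IsGalois E (separableClosure E L) := by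
  have hsepS := separableClosure.isSeparable E L
  have : Normal E (separableClosure E L) := by
    refine normal_iff.2 fun s => ⟨Algebra.IsIntegral.isIntegral s, ?_⟩
    have hs : IsSeparable E (s : L) := mem_separableClosure_iff.1 s.2
    have hmin : minpoly E s = minpoly E (s : L) :=
      (minpoly.algHom_eq (separableClosure E L).val Subtype.val_injective s).symm
    rw [hmin]
    refine IntermediateField.splits_of_splits ?_ fun l hl => ?_
    · rw [IsScalarTower.algebraMap_eq E E' L, ← Polynomial.map_map,
        minpoly.map_eq_of_isSeparable_of_isPurelyInseparable E' (s : L) hs]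
      exact Normal.splits inferInstance (s : L)
    · rw [mem_separableClosure_iff]
      exact Polynomial.Separable.of_dvd hs (minpoly.dvd E l (mem_rootSet.1 hl).2)
  exact { }

theorem finrank_separableClosure_of_isPurelyInseparable (E E' L : Type*) [Field E] [Field E']
    [Field L] [Algebra E E'] [Algebra E L] [Algebra E' L] [IsScalarTower E E' L]
    [IsPurelyInseparable E E'] [Algebra.IsSeparable E' L] :
    finrank (separableClosure E L) L = finrank E E' := by
  have := Field.finInsepDegree_mul_finInsepDegree_of_isAlgebraic E E' L
  rw [Algebra.IsSeparable.finInsepDegree_eq E' L, mul_one,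
    IsPurelyInseparable.finInsepDegree_eq] at this
  exact this.symm

theorem exists_pow_mem_range_of_not_isSeparable (p : ℕ) [Fact p.Prime] {E L : Type*} [Field E]
    [Field L] [Algebra E L] [CharP E p] [FiniteDimensional E L] [Normal E L]
    (h : ¬ Algebra.IsSeparable E L) :
    ∃ x : L, x ∉ (algebraMap E L).range ∧ x ^ p ∈ (algebraMap E L).range := by
  classical
  have hne : fixedField (⊤ : Subgroup Gal(L/E)) ≠ ⊥ := fun hbot =>
    h (IsGalois.of_fixedField_eq_bot E L hbot).to_isSeparable
  obtain ⟨z, hz, hzb⟩ : ∃ z ∈ fixedField (⊤ : Subgroup Gal(L/E)), z ∉ (algebraMap E L).range := by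
    by_contra! hall
    exact hne (eq_bot_iff.2 fun z hz => mem_bot.2 (hall z hz))
  have hroot : ((minpoly E z).aroots L).toFinset = {z} := by
    ext y
    rw [Multiset.mem_toFinset, mem_aroots, Finset.mem_singleton]
    constructor
    · rintro ⟨-, hy⟩
      obtain ⟨σ, rfl⟩ := minpoly.exists_algEquiv_of_root' (Algebra.IsAlgebraic.isAlgebraic z) hy
      exact hz ⟨σ, Subgroup.mem_top σ⟩
    · rintro rfl
      exact ⟨minpoly.ne_zero (Algebra.IsIntegral.isIntegral y), minpoly.aeval E y⟩
  have hdeg : (minpoly E z).natSepDegree = 1 := by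
    rw [natSepDegree_eq_of_splits (E := L) _ (Normal.splits inferInstance z), hroot,
      Finset.card_singleton]
  have hex : ∃ n : ℕ, z ^ p ^ n ∈ (algebraMap E L).range :=
    (mem_perfectClosure_iff_pow_mem p).1 (mem_perfectClosure_iff_natSepDegree_eq_one.2 hdeg)
  obtain ⟨n, hn⟩ := Nat.exists_eq_succ_of_ne_zero (n := Nat.find hex) fun h0 => by
    have := Nat.find_spec hex
    rw [h0, pow_zero, pow_one] at this
    exact hzb this
  refine ⟨z ^ p ^ n, Nat.find_min hex (by omega), ?_⟩
  have := Nat.find_spec hex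
  rwa [hn, pow_succ, pow_mul] at this

end InseparableNormal

section Reduction

open Module IntermediateField Polynomial

variable {k : Type*} {D : Type u} [Field k] [DivisionRing D] [Algebra k D] [FiniteDimensional k D]

theorem extendsToGaloisMaximal_of_adjoin (hc : Algebra.IsCentral k D) {E : Type v} [Field E]
    {L : Type u} [Field L] [Algebra E L] [FiniteDimensional E L] [Normal E L] (ι : L →+* D)
    (hmax : IsMaximalSubfield ι.range)
    (hsep : ∀ (c : k) (l : L), ι l = algebraMap k D c → IsSeparable E l)
    (ih : ∀ x : L, x ∉ (algebraMap E L).range →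
      ExtendsToGaloisMaximal (ι.comp (algebraMap E⟮x⟯ L))) :
    ExtendsToGaloisMaximal (ι.comp (algebraMap E L)) := by
  by_cases hL : Algebra.IsSeparable E L
  · exact ⟨L, _, _, ι, inferInstance, { }, rfl, hmax⟩
  obtain ⟨p, hp⟩ := CharP.exists E
  rcases CharP.char_is_prime_or_zero E p with hpr | rfl
  swap
  · have := CharP.charP_to_charZero E
    exact absurd (inferInstance : Algebra.IsSeparable E L) hL
  have : Fact p.Prime := ⟨hpr⟩
  have hcharL : CharP L p := charP_of_injective_algebraMap (algebraMap E L).injective p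
  obtain ⟨x, hx, b, hxb⟩ := exists_pow_mem_range_of_not_isSeparable p hL
  obtain ⟨L₁, _, _, j, hfin, hgal, hcomp, hjmax⟩ := ih x hx
  let _ : Algebra E L₁ := ((algebraMap E⟮x⟯ L₁).comp (algebraMap E E⟮x⟯)).toAlgebra
  have : IsScalarTower E E⟮x⟯ L₁ := IsScalarTower.of_algebraMap_eq fun _ => rfl
  have : FiniteDimensional E L₁ := .trans E E⟮x⟯ L₁
  have hcompE : j.comp (algebraMap E L₁) = ι.comp (algebraMap E L) := by
    rw [IsScalarTower.algebraMap_eq E E⟮x⟯ L₁, ← RingHom.comp_assoc, hcomp]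
    rfl
  have hpi : IsPurelyInseparable E E⟮x⟯ :=
    (isPurelyInseparable_adjoin_simple_iff_pow_mem E L p).2 ⟨1, b, by rw [pow_one, hxb]⟩
  have hrank : finrank E E⟮x⟯ = p := by
    have hirr : Irreducible (X ^ p - C b : E[X]) := by
      refine X_pow_sub_C_irreducible_of_prime hpr fun β hβ => hx ⟨β, ?_⟩
      rw [← hβ, map_pow] at hxb
      exact frobenius_inj L p hxb
    have hmin : X ^ p - C b = minpoly E x :=
      minpoly.eq_of_irreducible_of_monic hirr (by simp [hxb]) (monic_X_pow_sub_C b hpr.ne_zero)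
    rw [adjoin.finrank (Algebra.IsIntegral.isIntegral x), ← hmin, natDegree_X_pow_sub_C]
  have := isGalois_separableClosure_of_isPurelyInseparable E E⟮x⟯ L₁
  rw [← hcompE]
  refine exists_isGalois_of_pow_eq_algebraMap hc p (separableClosure E L₁)
    ((finrank_separableClosure_of_isPurelyInseparable E E⟮x⟯ L₁).trans hrank)
    (X := algebraMap E⟮x⟯ L₁ (AdjoinSimple.gen E x)) (b := b) (fun hX => hx ?_) ?_ j hjmax
    fun c => ?_
  · rw [mem_separableClosure_iff, IsSeparable, minpoly.algebraMap_eq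
      (algebraMap E⟮x⟯ L₁).injective] at hX
    obtain ⟨β, hβ⟩ := IsPurelyInseparable.inseparable E _ hX
    exact ⟨β, by rw [IsScalarTower.algebraMap_apply E E⟮x⟯ L, hβ]; rfl⟩
  · rw [← map_pow, IsScalarTower.algebraMap_apply E E⟮x⟯ L₁]
    congr 1
    exact Subtype.ext hxb.symm
  · obtain ⟨l₁, hl₁⟩ := hjmax.mem_of_forall_commute fun a _ => Algebra.commute_algebraMap_left c a
    obtain ⟨l, hl⟩ := hmax.mem_of_forall_commute fun a _ => Algebra.commute_algebraMap_left c a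
    refine ⟨l₁, mem_separableClosure_iff.2 ?_, hl₁⟩
    refine Polynomial.Separable.of_dvd (hsep c l hl) (minpoly.dvd E l₁ (j.injective ?_))
    rw [aeval_def, hom_eval₂, hcompE, hl₁, ← hl, ← hom_eval₂, ← aeval_def, minpoly.aeval, map_zero,
      map_zero]

theorem extendsToGaloisMaximal_of_normal_aux (hc : Algebra.IsCentral k D) (n : ℕ) :
    ∀ {E L : Type u} [Field E] [Field L] [Algebra E L] [FiniteDimensional E L] [Normal E L]
      (ι : L →+* D) (_ : IsMaximalSubfield ι.range)
      (_ : ∀ (c : k) (l : L), ι l = algebraMap k D c → IsSeparable E l) (_ : finrank E L = n),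
      ExtendsToGaloisMaximal (ι.comp (algebraMap E L)) := by
  induction n using Nat.strong_induction_on with
  | _ n ih =>
    intro E L _ _ _ _ _ ι hmax hsep hn
    refine extendsToGaloisMaximal_of_adjoin hc ι hmax hsep fun x hx => ?_
    have := Normal.tower_top_of_normal E E⟮x⟯ L
    refine ih _ ?_ ι hmax (fun c l hl => (hsep c l hl).tower_top E⟮x⟯) rfl
    rw [← hn, ← finrank_mul_finrank E E⟮x⟯ L]
    refine lt_mul_of_one_lt_left finrank_pos ?_
    refine lt_of_le_of_ne finrank_pos fun h1 => hx ?_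
    rw [eq_comm, finrank_adjoin_simple_eq_one_iff, mem_bot] at h1
    exact h1

theorem extendsToGaloisMaximal_of_normal (hc : Algebra.IsCentral k D) {E : Type v} {L : Type u}
    [Field E] [Field L] [Algebra E L] [FiniteDimensional E L] [Normal E L] (ι : L →+* D)
    (hmax : IsMaximalSubfield ι.range)
    (hsep : ∀ (c : k) (l : L), ι l = algebraMap k D c → IsSeparable E l) :
    ExtendsToGaloisMaximal (ι.comp (algebraMap E L)) := by
  refine extendsToGaloisMaximal_of_adjoin hc ι hmax hsep fun x _ => ?_
  have := Normal.tower_top_of_normal E E⟮x⟯ L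
  exact extendsToGaloisMaximal_of_normal_aux hc _ ι hmax
    (fun c l hl => (hsep c l hl).tower_top E⟮x⟯) rfl

end Reduction

/-- **Proposition 2.**  Let `D` be a division algebra, finite-dimensional over its center
`Z(D)`, and let `F ⊆ Z(D)` be a subfield with `Z(D)/F` finite and separable.  If `D`
contains a maximal subfield which is normal over `F`, then `D` contains a maximal
subfield which is Galois over `F`. -/
theorem statement_2 (F : Type v) (D : Type u) [Field F] [DivisionRing D] [Algebra F D]
    [FiniteDimensional (Subring.center D) D]
    (hfin : FiniteDimensional F (Subring.center D))
    (hsep : Algebra.IsSeparable F (Subring.center D))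
    (hnormal : HasMaximalNormalSubfield F D) :
    HasMaximalGaloisSubfield F D := by
  obtain ⟨N⟩ := hnormal
  have htower : IsScalarTower F (Subring.center D) D := IsScalarTower.of_algebraMap_eq fun _ => rfl
  have hcentral : Algebra.IsCentral (Subring.center D) D :=
    ⟨fun d hd => ⟨⟨d, Subring.mem_center_iff.2 fun g => (Subalgebra.mem_center_iff.1 hd g)⟩, rfl⟩⟩
  have hFD : FiniteDimensional F D := .trans F (Subring.center D) D
  have hFL : FiniteDimensional F N.L := .of_injective N.emb.toLinearMap N.inj
  have hnorm := N.normal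
  obtain ⟨L, _, _, j, -, hgal, hcomp, hmax⟩ :=
    extendsToGaloisMaximal_of_normal hcentral (E := F) N.emb.toRingHom N.maximal
      fun c l hl => by
        have hc : IsSeparable F c := Algebra.IsSeparable.isSeparable F c
        refine Polynomial.Separable.of_dvd hc (minpoly.dvd F l (N.inj ?_))
        rw [map_zero, ← Polynomial.aeval_algHom_apply,
          show N.emb l = algebraMap (Subring.center D) D c from hl,
          Polynomial.aeval_algebraMap_apply, minpoly.aeval, map_zero]
  exact ⟨{
    L := L
    emb := { j with commutes' := fun r => (RingHom.congr_fun hcomp r).trans (N.emb.commutes r) }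
    inj := j.injective
    maximal := hmax
    galois := hgal }⟩

end Paper
end
end

section
/- Let F̄ be a field, E a finite-dimensional division algebra over F̄ with Z(E)/F̄ abelian Galois, embedded in a central simple F̄-algebra A as the centralizer of Z(E). Let σ₁,…,σ_r be a minimal generating set of Gal(Z(E)/F̄) and choose z_i ∈ A* with z_i a z_i^{-1} = σ_i(a) for all a ∈ Z(E). Let E[x₁,…,x_r; z] be the twisted polynomial ring defined by the relations x_i a = (z_i a z_i^{-1}) x_i and x_i x_j = (z_i z_j z_i^{-1} z_j^{-1}) x_j x_i for a ∈ E, 1 ≤ i,j ≤ r, and let E(x₁,…,x_r; z) be its ring of central quotients. Then E(x₁,…,x_r; z) is an F-central lift of E, where F is isomorphic to the rational function field F̄(t₁,…,t_r). -/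
/- Formalization of notions from:
   T. Hanke, "Galois subfields of inertially split division algebras". -/

noncomputable section
open scoped TensorProduct
universe u v

namespace Paper
/-! ### Residue fields and residue division rings of valuations -/

/-- Residue field data for a valued field `(F, v)`: a field `k` together with a surjective
ring homomorphism from the valuation ring of `v` whose kernel is the maximal ideal
`{x | v x < 1}`.  This characterizes the residue field of `(F, v)` up to isomorphism. -/
structure ResidueFieldData {F : Type v} {Γ₀ : Type*} [Field F]
    [LinearOrderedCommGroupWithZero Γ₀] (v : Valuation F Γ₀) where
  /-- the residue field -/
  k : Type u
  [fieldk : Field k]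
  /-- reduction modulo the maximal ideal -/
  π : v.integer →+* k
  surjective : Function.Surjective π
  ker_iff : ∀ x : v.integer, π x = 0 ↔ v (x : F) < 1

attribute [instance] ResidueFieldData.fieldk

/-- Residue data for a valuation (in the sense of Schilling) on a division ring `D`:
a division ring `R` together with a surjective ring homomorphism from the valuation ring
of `w` whose kernel is `{x | w x < 1}`.  This characterizes the residue division ring of
`(D, w)` up to isomorphism. -/
structure ResidueDivData {D : Type u} {Γ₀ : Type*} [DivisionRing D]
    [LinearOrderedCommGroupWithZero Γ₀] (w : Valuation D Γ₀) where
  /-- the residue division ring -/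
  R : Type u
  [divisionRing : DivisionRing R]
  /-- reduction modulo the maximal ideal -/
  π : w.integer →+* R
  surjective : Function.Surjective π
  ker_iff : ∀ x : w.integer, π x = 0 ↔ w (x : D) < 1

attribute [instance] ResidueDivData.divisionRing

/-- Compatibility of an embedding `ι` of the residue field of `(F, v)` into the residue
division ring of `(D, w)` with the reduction maps, where `w` extends `v` along
`algebraMap F D`. -/
def ResidueCompat {F : Type v} {D : Type u} {Γ₀ : Type*} [Field F] [DivisionRing D]
    [Algebra F D] [LinearOrderedCommGroupWithZero Γ₀] {v : Valuation F Γ₀}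
    {w : Valuation D Γ₀} (hext : ∀ x : F, w (algebraMap F D x) = v x)
    (RF : ResidueFieldData v) (RD : ResidueDivData w) (ι : RF.k →+* RD.R) : Prop :=
  ∀ (x : F) (hx : v x ≤ 1),
    ι (RF.π ⟨x, (Valuation.mem_integer_iff v x).mpr hx⟩) =
      RD.π ⟨algebraMap F D x, by
        rw [Valuation.mem_integer_iff, hext]; exact hx⟩

/-- Compatibility of an embedding of residue fields with the reduction maps, for an
extension of valued fields `(L, u) / (F, v)`. -/
def ResidueCompatFields {F : Type v} {L : Type v} {Γ₀ : Type*} [Field F] [Field L]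
    [Algebra F L] [LinearOrderedCommGroupWithZero Γ₀] {v : Valuation F Γ₀}
    {u : Valuation L Γ₀} (hext : ∀ x : F, u (algebraMap F L x) = v x)
    (RF : ResidueFieldData v) (RL : ResidueFieldData u) (ι : RF.k →+* RL.k) : Prop :=
  ∀ (x : F) (hx : v x ≤ 1),
    ι (RF.π ⟨x, (Valuation.mem_integer_iff v x).mpr hx⟩) =
      RL.π ⟨algebraMap F L x, by
        rw [Valuation.mem_integer_iff, hext]; exact hx⟩

/-- The extension of fields determined by a ring homomorphism `ι` is separable. -/
def SeparableVia (k : Type u) (K : Type v) [Field k] [Field K] (ι : k →+* K) : Prop :=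
  letI := ι.toAlgebra
  Algebra.IsSeparable k K

/-- The extension of fields determined by a ring homomorphism `ι` is Galois. -/
def GaloisVia (k : Type u) (K : Type v) [Field k] [Field K] (ι : k →+* K) : Prop :=
  letI := ι.toAlgebra
  IsGalois k K

/-- `D` contains a maximal subfield Galois over `k`, where `k` is mapped into `D`
by the (centrally valued) ring homomorphism `ι`. -/
def HasMaximalGaloisSubfieldVia {k : Type v} {D : Type u} [Field k] [DivisionRing D]
    (ι : k →+* D) (hc : ∀ a d, ι a * d = d * ι a) : Prop :=
  letI := ι.toAlgebra' hc
  HasMaximalGaloisSubfield k D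

/-- A valued field `(F, v)` is Henselian if its valuation ring is a Henselian local ring. -/
def IsHenselian {F : Type v} {Γ₀ : Type*} [Field F] [LinearOrderedCommGroupWithZero Γ₀]
    (v : Valuation F Γ₀) : Prop :=
  HenselianLocalRing v.valuationSubring
/-! ### Unramified splitting fields and inertially split division algebras -/

/-- Two algebras over `R` are similar (Brauer equivalent): they have isomorphic
matrix amplifications. -/
def BrauerSimilarOver (R : Type v) (A : Type u) (B : Type u) [CommSemiring R] [Ring A]
    [Ring B] [Algebra R A] [Algebra R B] : Prop :=
  ∃ n m : ℕ, 0 < n ∧ 0 < m ∧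
    Nonempty (Matrix (Fin n) (Fin n) A ≃ₐ[R] Matrix (Fin m) (Fin m) B)

/-- An unramified (field) extension `L` of the valued field `(F, v)` which splits the
`F`-division algebra `D`: the valuation `u` on `L` extends `v`, `L/F` is algebraic,
the value groups of `u` and `v` agree, the induced extension of residue fields is
separable, and `L ⊗[F] D` is a matrix algebra over `L`. -/
structure UnramifiedSplittingField (F : Type v) (D : Type u) {Γ₀ : Type*} [Field F]
    [DivisionRing D] [Algebra F D] [LinearOrderedCommGroupWithZero Γ₀]
    (v : Valuation F Γ₀) where
  /-- the unramified splitting field -/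
  L : Type v
  [fieldL : Field L]
  [algebraL : Algebra F L]
  /-- the valuation on `L` -/
  u : Valuation L Γ₀
  extends_v : ∀ x : F, u (algebraMap F L x) = v x
  algebraic : Algebra.IsAlgebraic F L
  value_group_eq : ∀ y : L, y ≠ 0 → ∃ x : F, x ≠ 0 ∧ u y = v x
  residue_separable :
    ∃ (RF : ResidueFieldData.{v} v) (RL : ResidueFieldData.{v} u) (ι : RF.k →+* RL.k),
      ResidueCompatFields extends_v RF RL ι ∧ SeparableVia RF.k RL.k ι
  splits : ∃ n : ℕ, 0 < n ∧ Nonempty ((L ⊗[F] D) ≃ₐ[L] Matrix (Fin n) (Fin n) L)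

attribute [instance] UnramifiedSplittingField.fieldL UnramifiedSplittingField.algebraL

/-- `(D, v)` is inertially split: there is an unramified field extension of `(F, v)`
splitting `D`. -/
def IsInertiallySplit (F : Type v) (D : Type u) {Γ₀ : Type*} [Field F] [DivisionRing D]
    [Algebra F D] [LinearOrderedCommGroupWithZero Γ₀] (v : Valuation F Γ₀) : Prop :=
  Nonempty (UnramifiedSplittingField F D v)

/-- A finite-dimensional central division algebra over `F` equipped with a valuation
extending `v` (i.e. a valued central division algebra over `(F, v)`). -/
structure ValuedCentralDivisionAlgebra (F : Type v) {Γ₀ : Type*} [Field F]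
    [LinearOrderedCommGroupWithZero Γ₀] (v : Valuation F Γ₀) where
  /-- the underlying division ring -/
  D : Type u
  [div : DivisionRing D]
  [alg : Algebra F D]
  [fin : FiniteDimensional F D]
  [central : Algebra.IsCentral F D]
  /-- the valuation on `D` -/
  w : Valuation D Γ₀
  extends_v : ∀ x : F, w (algebraMap F D x) = v x

attribute [instance] ValuedCentralDivisionAlgebra.div ValuedCentralDivisionAlgebra.alg
  ValuedCentralDivisionAlgebra.fin ValuedCentralDivisionAlgebra.central

/-! ### Tignol's generic abelian crossed product construction -/

/-- The defining relations of the twisted polynomial ring `E[x₁,…,x_r; z]`: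
the generators `Sum.inl a` (for `a ∈ E`) multiply as in `E`, and the generators
`x_i = Sum.inr i` satisfy `x_i a = (z_i a z_i⁻¹) x_i` and
`x_i x_j = (z_i z_j z_i⁻¹ z_j⁻¹) x_j x_i`, where conjugation by `z_i` is recorded by
the function `conj` and the commutators by `cmt`. -/
inductive TwistRel (k : Type u) [Field k] (E : Type u) [DivisionRing E] [Algebra k E]
    (r : ℕ) (conj : Fin r → E → E) (cmt : Fin r → Fin r → E) :
    FreeAlgebra k (E ⊕ Fin r) → FreeAlgebra k (E ⊕ Fin r) → Prop
  | add (a b : E) : TwistRel k E r conj cmt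
      (FreeAlgebra.ι k (Sum.inl (a + b)))
      (FreeAlgebra.ι k (Sum.inl a) + FreeAlgebra.ι k (Sum.inl b))
  | mul (a b : E) : TwistRel k E r conj cmt
      (FreeAlgebra.ι k (Sum.inl (a * b)))
      (FreeAlgebra.ι k (Sum.inl a) * FreeAlgebra.ι k (Sum.inl b))
  | one : TwistRel k E r conj cmt (FreeAlgebra.ι k (Sum.inl 1)) 1
  | smul (c : k) (a : E) : TwistRel k E r conj cmt
      (FreeAlgebra.ι k (Sum.inl (c • a))) (c • FreeAlgebra.ι k (Sum.inl a))
  | comm (i : Fin r) (a : E) : TwistRel k E r conj cmt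
      (FreeAlgebra.ι k (Sum.inr i) * FreeAlgebra.ι k (Sum.inl a))
      (FreeAlgebra.ι k (Sum.inl (conj i a)) * FreeAlgebra.ι k (Sum.inr i))
  | xcomm (i j : Fin r) : TwistRel k E r conj cmt
      (FreeAlgebra.ι k (Sum.inr i) * FreeAlgebra.ι k (Sum.inr j))
      (FreeAlgebra.ι k (Sum.inl (cmt i j)) * FreeAlgebra.ι k (Sum.inr j) *
        FreeAlgebra.ι k (Sum.inr i))

/-- The twisted polynomial ring `E[x₁,…,x_r; z]` presented by generators and
relations. -/
abbrev TwistedPolyRing (k : Type u) [Field k] (E : Type u) [DivisionRing E]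
    [Algebra k E] (r : ℕ) (conj : Fin r → E → E) (cmt : Fin r → Fin r → E) : Type u :=
  RingQuot (TwistRel k E r conj cmt)

/-- A witness that the division algebra `D` is an `F`-central lift of `E`, where
`F := Z(D)`: `D` carries a valuation `w` extending a valuation `v` of its center,
`(D, v)` is inertially split, and the residue division algebra of `(D, w)` is `E`,
compatibly with `k`. -/
structure CentralLiftWitness (k : Type u) (D : Type u) (E : Type u) [Field k]
    [DivisionRing D] [DivisionRing E] [Algebra k D] [Algebra k E] where
  /-- the value group (with zero) -/
  Γ₀ : Type u
  [ord : LinearOrderedCommGroupWithZero Γ₀]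
  /-- the valuation on the center `F = Z(D)` -/
  v : Valuation (Subring.center D) Γ₀
  /-- the valuation on `D` -/
  w : Valuation D Γ₀
  extends_v : ∀ x : Subring.center D, w ↑x = v x
  finite : FiniteDimensional (Subring.center D) D
  inertiallySplit : IsInertiallySplit (Subring.center D) D v
  /-- residue data for `(D, w)` -/
  RD : ResidueDivData w
  /-- identification of the residue division algebra with `E` -/
  resIso : RD.R ≃+* E
  res_compat : ∀ (c : k) (h : algebraMap k D c ∈ w.integer),
    resIso (RD.π ⟨algebraMap k D c, h⟩) = algebraMap k E c

attribute [instance] CentralLiftWitness.ord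

section

section TensorSimple

variable {F : Type*} {L : Type*} {D : Type*} [Field F] [Field L] [DivisionRing D]
  [Algebra F L] [Algebra F D]

open Classical in
/-- Coordinates of an element of `L ⊗[F] D` with respect to an `F`-basis of `L`. -/
def tensorCoord : L ⊗[F] D ≃ₗ[F] (Module.Basis.ofVectorSpaceIndex F L →₀ D) :=
  TensorProduct.equivFinsuppOfBasisLeft (Module.Basis.ofVectorSpace F L)

lemma tensorCoord_mul_right (x : L ⊗[F] D) (d : D) (i) :
    tensorCoord (x * (1 ⊗ₜ d)) i = tensorCoord x i * d := by
  induction x with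
  | zero => simp
  | tmul l d' => simp [tensorCoord]
  | add x y hx hy => simp [add_mul, hx, hy]

lemma tensorCoord_mul_left (x : L ⊗[F] D) (d : D) (i) :
    tensorCoord ((1 ⊗ₜ d) * x) i = d * tensorCoord x i := by
  induction x with
  | zero => simp
  | tmul l d' => simp [tensorCoord]
  | add x y hx hy => simp [mul_add, hx, hy]

lemma exists_algebraMap_of_commute [Algebra.IsCentral F D] (d : D) (h : ∀ d', d * d' = d' * d) :
    ∃ a : F, algebraMap F D a = d := by
  have : d ∈ Subalgebra.center F D := Subalgebra.mem_center_iff.mpr fun b => (h b).symm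
  rw [Algebra.IsCentral.center_eq_bot] at this
  exact this

lemma exists_tmul_one_of_commute [Algebra.IsCentral F D] (x : L ⊗[F] D)
    (h : ∀ d : D, x * (1 ⊗ₜ d) = (1 ⊗ₜ d) * x) : ∃ l : L, x = l ⊗ₜ 1 := by
  classical
  have h1 : ∀ i, ∃ a : F, algebraMap F D a = tensorCoord x i := fun i =>
    exists_algebraMap_of_commute _ fun d => by
      rw [← tensorCoord_mul_right, h, tensorCoord_mul_left]
  choose a ha using h1
  refine ⟨∑ i ∈ (tensorCoord x).support, a i • Module.Basis.ofVectorSpace F L i, ?_⟩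
  have h2 : x = tensorCoord.symm (tensorCoord x) := by simp
  conv_lhs => rw [h2]
  rw [tensorCoord, TensorProduct.equivFinsuppOfBasisLeft_symm_apply, Finsupp.sum,
    TensorProduct.sum_tmul]
  refine Finset.sum_congr rfl fun i _ => ?_
  change _ ⊗ₜ[F] (tensorCoord x i) = _
  rw [← ha, Algebra.algebraMap_eq_smul_one, TensorProduct.tmul_smul, TensorProduct.smul_tmul']

instance isSimpleRing_tensor [Algebra.IsCentral F D] : IsSimpleRing (L ⊗[F] D) := by
  refine isSimpleRing_iff_isTwoSided_imp.mpr ⟨inferInstance, fun I hI => ?_⟩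
  by_cases hbot : I = ⊥
  · exact Or.inl hbot
  right
  obtain ⟨y, hyI, hy0⟩ := Submodule.exists_mem_ne_zero_of_ne_bot hbot
  obtain ⟨x, ⟨hxI, hx0⟩, hmin⟩ := exists_minimalFor_of_wellFoundedLT
    (fun x : L ⊗[F] D => x ∈ I ∧ x ≠ 0) (fun x => (tensorCoord x).support.card) ⟨y, hyI, hy0⟩
  obtain ⟨i, hi⟩ : ∃ i, tensorCoord x i ≠ 0 := by
    by_contra! hc
    exact hx0 (tensorCoord.map_eq_zero_iff.mp (Finsupp.ext hc))
  set x' : L ⊗[F] D := x * (1 ⊗ₜ (tensorCoord x i)⁻¹) with hx'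
  have hx'I : x' ∈ I := I.mul_mem_right _ hxI
  have hi' : tensorCoord x' i = 1 := by rw [hx', tensorCoord_mul_right, mul_inv_cancel₀ hi]
  have hsupp : ∀ j, tensorCoord x j = 0 → tensorCoord x' j = 0 := fun j hj => by
    rw [hx', tensorCoord_mul_right, hj, zero_mul]
  have hcomm : ∀ d : D, x' * (1 ⊗ₜ d) = (1 ⊗ₜ d) * x' := by
    intro d
    by_contra hne
    have hmem : x' * (1 ⊗ₜ d) - (1 ⊗ₜ d) * x' ∈ I :=
      I.sub_mem (I.mul_mem_right _ hx'I) (I.mul_mem_left _ hx'I)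
    have hco : ∀ j, tensorCoord (x' * (1 ⊗ₜ d) - (1 ⊗ₜ d) * x') j =
        tensorCoord x' j * d - d * tensorCoord x' j := fun j => by
      rw [map_sub, Finsupp.sub_apply, tensorCoord_mul_right, tensorCoord_mul_left]
    refine not_lt_of_ge (hmin ⟨hmem, sub_ne_zero.mpr hne⟩ (Finset.card_le_card fun j hj => ?_))
      (Finset.card_lt_card (Finset.ssubset_iff_of_subset (fun j hj => ?_) |>.mpr
        ⟨i, by simpa using hi, ?_⟩))
    · rw [Finsupp.mem_support_iff, hco] at hj
      rw [Finsupp.mem_support_iff]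
      intro h0
      simp [hsupp j h0] at hj
    · rw [Finsupp.mem_support_iff, hco] at hj
      rw [Finsupp.mem_support_iff]
      intro h0
      simp [hsupp j h0] at hj
    · rw [Finsupp.mem_support_iff, hco, hi']
      simp
  obtain ⟨l, hl⟩ := exists_tmul_one_of_commute x' hcomm
  have hl0 : l ≠ 0 := by
    rintro rfl
    rw [hl, TensorProduct.zero_tmul, map_zero] at hi'
    simp at hi'
  refine (Ideal.eq_top_iff_one I).mpr ?_
  have : (l⁻¹ ⊗ₜ 1 : L ⊗[F] D) * x' = 1 := by
    rw [hl, Algebra.TensorProduct.tmul_mul_tmul, inv_mul_cancel₀ hl0, one_mul,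
      Algebra.TensorProduct.one_def]
  rw [← this]
  exact I.mul_mem_left _ hx'I

instance isCentral_tensor [Algebra.IsCentral F D] : Algebra.IsCentral L (L ⊗[F] D) where
  out := fun x hx => by
    obtain ⟨l, rfl⟩ := exists_tmul_one_of_commute x fun d =>
      (Subalgebra.mem_center_iff.mp hx _).symm
    exact ⟨l, rfl⟩

end TensorSimple

/-- Over a separably closed field, every finite-dimensional central simple algebra is a matrix
algebra. -/
lemma exists_algEquiv_matrix_of_isSepClosed (L : Type u) (B : Type v) [Field L] [IsSepClosed L]
    [Ring B] [Algebra L B] [IsSimpleRing B] [Algebra.IsCentral L B] [FiniteDimensional L B] :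
    ∃ (n : ℕ) (_ : NeZero n), Nonempty (B ≃ₐ[L] Matrix (Fin n) (Fin n) L) := by
  have := IsArtinianRing.of_finite L B
  obtain ⟨n, hn, Δ, _, _, _, ⟨e⟩⟩ := IsSimpleRing.exists_algEquiv_matrix_divisionRing_finite L B
  refine ⟨n, hn, ⟨e.trans <| .mapMatrix <| .symm <| .ofBijective (Algebra.ofId L Δ)
    ⟨(algebraMap L Δ).injective, ?_⟩⟩⟩
  have hc : Algebra.IsCentral L (Matrix (Fin n) (Fin n) Δ) := Algebra.IsCentral.of_algEquiv L _ _ e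
  have hΔ : Algebra.IsCentral L Δ := by
    refine ⟨fun x hx => ?_⟩
    have hm : Matrix.scalar (Fin n) x ∈ Subalgebra.center L (Matrix (Fin n) (Fin n) Δ) := by
      refine Subalgebra.mem_center_iff.mpr fun M => ?_
      exact (Matrix.scalar_commute x (fun y => ((Subalgebra.mem_center_iff.mp hx) y).symm) M).symm
    obtain ⟨l, hl⟩ := hc.out hm
    refine ⟨l, ?_⟩
    have := congrFun (congrFun hl 0) 0
    simpa [Algebra.ofId_apply, Matrix.algebraMap_matrix_apply] using this
  by_contra hsurj
  have hne : (⊥ : Subalgebra L Δ) ≠ ⊤ := by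
    intro h
    exact hsurj (Algebra.surjective_algebraMap_iff.mpr h.symm)
  obtain ⟨x, hx, hxs⟩ := JacobsonNoether.exists_separable_and_not_isCentral' (L := L) (D := Δ) hne
  obtain ⟨y, hy⟩ : ∃ y, algebraMap L Δ y = x := by
    have hirr := minpoly.irreducible (Algebra.IsIntegral.isIntegral (R := L) x)
    have hdeg := IsSepClosed.degree_eq_one_of_irreducible L hirr hxs
    have := minpoly.mem_range_of_degree_eq_one L x hdeg
    exact this
  exact hx ⟨y, hy⟩

end

section

/-- A central division algebra `D` over `F` is split by `L` as soon as some division algebra `X`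
mapping to `D` acts `L`-linearly on a space `W` which is small compared to the dimension of `X`. -/
lemma exists_splitting_of_action {F L D X W : Type*} [Field F] [Field L] [DivisionRing D]
    [DivisionRing X] [Algebra F L] [Algebra F D] [Algebra F X] [Algebra.IsCentral F D]
    [FiniteDimensional F X] [AddCommGroup W] [Module L W] [FiniteDimensional L W] [Nontrivial W]
    (i : X →ₐ[F] D) (ρ : X →+* Module.End L W)
    (hρ : ∀ (a : F) (w : W), ρ (algebraMap F X a) w = algebraMap F L a • w)
    {ι : Type*} [Fintype ι] (t : ι → D) (ht : ∀ d : D, ∃ c : ι → X, d = ∑ j, i (c j) * t j)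
    (hcard : Fintype.card ι * Module.finrank L W ^ 2 ≤ Module.finrank F X) :
    FiniteDimensional F D ∧
      ∃ n : ℕ, 0 < n ∧ Nonempty ((L ⊗[F] D) ≃ₐ[L] Matrix (Fin n) (Fin n) L) := by
  classical
  letI : Module X D := Module.compHom D i.toRingHom
  have hsmulD : ∀ (x : X) (d : D), x • d = i x * d := fun _ _ => rfl
  letI : Module X W := Module.compHom W ρ
  have hsmulW : ∀ (x : X) (w : W), x • w = ρ x w := fun _ _ => rfl
  haveI : SMulCommClass X L W := ⟨fun x l w => by rw [hsmulW, hsmulW, map_smul]⟩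
  haveI : IsScalarTower F X D := ⟨fun a x d => by
    rw [hsmulD, hsmulD, map_smul, smul_mul_assoc]⟩
  have hspan : Submodule.span X (Set.range t) = ⊤ := by
    refine eq_top_iff.mpr fun d _ => ?_
    obtain ⟨c, rfl⟩ := ht d
    exact Submodule.sum_mem _ fun j _ => Submodule.smul_mem _ (c j)
      (Submodule.subset_span ⟨j, rfl⟩)
  haveI : Module.Finite X D := ⟨⟨Finset.univ.image t, by simpa using hspan⟩⟩
  have hg : Module.finrank X D ≤ Fintype.card ι := by
    rw [← finrank_top X D, ← hspan]
    exact finrank_range_le_card t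
  have hg0 : 0 < Module.finrank X D := Module.finrank_pos
  haveI hfin : FiniteDimensional F D := Module.Finite.trans X D
  refine ⟨hfin, ?_⟩
  have htower := Module.finrank_mul_finrank F X D
  set g := Module.finrank X D with hgdef
  let bD : Module.Basis (Fin g) X D := Module.finBasis X D
  let eV : (Fin g → W) ≃ₗ[L] (D →ₗ[X] W) := bD.constr L
  haveI : Module.Finite L (D →ₗ[X] W) := Module.Finite.equiv eV
  have hV : Module.finrank L (D →ₗ[X] W) = g * Module.finrank L W := by
    rw [← eV.finrank_eq, Module.finrank_pi_fintype]
    simp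
  set n := Module.finrank L (D →ₗ[X] W) with hn
  have hn0 : 0 < n := by
    rw [hV]
    exact Nat.mul_pos hg0 Module.finrank_pos
  let R (d : D) : D →ₗ[X] D :=
    { toFun := fun y => y * d
      map_add' := fun x y => add_mul x y d
      map_smul' := fun x y => by simp only [hsmulD, mul_assoc, RingHom.id_apply] }
  let T : D →+* Module.End L (D →ₗ[X] W) :=
    { toFun := fun d =>
        { toFun := fun f => f ∘ₗ R d
          map_add' := fun _ _ => rfl
          map_smul' := fun _ _ => rfl }
      map_one' := by
        ext f y
        change f (y * 1) = f y
        rw [mul_one]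
      map_mul' := fun a b => by
        ext f y
        change f (y * (a * b)) = f (y * a * b)
        rw [mul_assoc]
      map_zero' := by
        ext f y
        change f (y * 0) = 0
        rw [mul_zero, map_zero]
      map_add' := fun a b => by
        ext f y
        change f (y * (a + b)) = f (y * a) + f (y * b)
        rw [mul_add, map_add] }
  have hT : ∀ a : F, T (algebraMap F D a) = algebraMap L _ (algebraMap F L a) := by
    intro a
    ext f y
    change f (y * algebraMap F D a) = algebraMap F L a • f y
    rw [← Algebra.commutes, ← i.commutes, ← hsmulD, map_smul, hsmulW, hρ]
  let bV : Module.Basis (Fin n) L (D →ₗ[X] W) := Module.finBasis L _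
  let eM : Module.End L (D →ₗ[X] W) ≃ₐ[L] Matrix (Fin n) (Fin n) L := LinearMap.toMatrixAlgEquiv bV
  let T' : D →ₐ[F] Matrix (Fin n) (Fin n) L :=
    { (eM : _ →+* Matrix (Fin n) (Fin n) L).comp T with
      commutes' := fun a => by
        change eM (T (algebraMap F D a)) = _
        rw [hT, AlgEquiv.commutes, ← IsScalarTower.algebraMap_apply] }
  haveI : NeZero n := ⟨hn0.ne'⟩
  let Φ : (L ⊗[F] D) →ₐ[L] Matrix (Fin n) (Fin n) L :=
    Algebra.TensorProduct.lift (Algebra.ofId L _) T' fun l d => by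
      exact Algebra.commutes l (T' d)
  have hinj : Function.Injective Φ := Φ.toRingHom.injective
  have hle : Module.finrank L (L ⊗[F] D) ≤ Module.finrank L (Matrix (Fin n) (Fin n) L) :=
    LinearMap.finrank_le_finrank_of_injective (f := Φ.toLinearMap) hinj
  have hge : Module.finrank L (Matrix (Fin n) (Fin n) L) ≤ Module.finrank L (L ⊗[F] D) := by
    rw [Module.finrank_baseChange, Module.finrank_matrix, ← htower, hV]
    simp only [Fintype.card_fin, Module.finrank_self, mul_one]
    calc g * Module.finrank L W * (g * Module.finrank L W)
        = (g * Module.finrank L W ^ 2) * g := by ring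
      _ ≤ (Fintype.card ι * Module.finrank L W ^ 2) * g := by gcongr
      _ ≤ Module.finrank F X * g := by gcongr
  have hsurj : Function.Surjective Φ :=
    (LinearMap.injective_iff_surjective_of_finrank_eq_finrank (f := Φ.toLinearMap)
      (le_antisymm hle hge)).mp hinj
  exact ⟨n, hn0, ⟨AlgEquiv.ofBijective Φ ⟨hinj, hsurj⟩⟩⟩

end

section

section HahnValuation

variable {Γ : Type*} [AddCommGroup Γ] [LinearOrder Γ] [IsOrderedAddMonoid Γ]
variable {R : Type*} [Ring R]

lemma hahn_order_eq_of_support_eq {R' : Type*} [Ring R'] {f : HahnSeries Γ R}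
    {g : HahnSeries Γ R'} (h : ∀ m, f.coeff m = 0 ↔ g.coeff m = 0) : f.order = g.order := by
  by_cases hf : f = 0
  · have hg : g = 0 := by
      ext m
      exact (h m).mp (by simp [hf])
    simp [hf, hg]
  · have hg : g ≠ 0 := by
      rintro rfl
      exact hf (by ext m; exact (h m).mpr (by simp))
    refine le_antisymm (HahnSeries.order_le_of_coeff_ne_zero ?_)
      (HahnSeries.order_le_of_coeff_ne_zero ?_)
    · rw [Ne, h]
      exact HahnSeries.coeff_order_eq_zero.not.mpr hg
    · rw [Ne, ← h]
      exact HahnSeries.coeff_order_eq_zero.not.mpr hf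

lemma hahn_order_nonneg_iff {f : HahnSeries Γ R} :
    0 ≤ f.order ↔ ∀ m < 0, f.coeff m = 0 := by
  refine ⟨fun h m hm => HahnSeries.coeff_eq_zero_of_lt_order (hm.trans_le h), fun h => ?_⟩
  by_cases hf : f = 0
  · simp [hf]
  by_contra! hlt
  exact HahnSeries.coeff_order_eq_zero.not.mpr hf (h _ hlt)

lemma hahn_coeff_zero_mul {f g : HahnSeries Γ R} (hf : ∀ m < 0, f.coeff m = 0)
    (hg : ∀ m < 0, g.coeff m = 0) : (f * g).coeff 0 = f.coeff 0 * g.coeff 0 := by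
  rw [HahnSeries.coeff_mul, Finset.sum_eq_single (0, 0)]
  · rintro ⟨a, b⟩ hab hne
    simp only [Finset.mem_antidiagonal, HahnSeries.mem_support] at hab
    obtain ⟨ha, hb, hs⟩ := hab
    have ha0 : 0 ≤ a := not_lt.mp fun h => ha (hf a h)
    have hb0 : 0 ≤ b := not_lt.mp fun h => hb (hg b h)
    obtain ⟨rfl, rfl⟩ := (add_eq_zero_iff_of_nonneg ha0 hb0).mp hs
    exact absurd rfl hne
  · intro h
    simp only [Finset.mem_antidiagonal, HahnSeries.mem_support, add_zero, and_true,
      not_and_or, not_not] at h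
    rcases h with h | h <;> simp [h]

variable [Nontrivial R] {B : Type*} [DivisionRing B] (j : B →+* HahnSeries Γ R)
  (hj : ∀ b ≠ 0, IsUnit (j b).leadingCoeff)

include hj in
lemma hahn_order_mul {a b : B} (ha : a ≠ 0) (hb : b ≠ 0) :
    (j (a * b)).order = (j a).order + (j b).order := by
  rw [map_mul]
  exact HahnSeries.order_mul_of_ne_zero ((hj a ha).mul (hj b hb)).ne_zero

open Classical in
/-- The valuation on a division ring of Hahn series given by minus the order. -/
def hahnVal : Valuation B (WithZero (Multiplicative Γ)) where
  toFun b := if b = 0 then 0 else WithZero.exp (-(j b).order)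
  map_zero' := by simp
  map_one' := by simp
  map_mul' a b := by
    by_cases ha : a = 0
    · simp [ha]
    by_cases hb : b = 0
    · simp [hb]
    rw [if_neg ha, if_neg hb, if_neg (mul_ne_zero ha hb), hahn_order_mul j hj ha hb, neg_add,
      WithZero.exp_add]
  map_add_le_max' a b := by
    by_cases ha : a = 0
    · simp [ha]
    by_cases hb : b = 0
    · simp [hb]
    by_cases hab : a + b = 0
    · simp [hab]
    rw [if_neg ha, if_neg hb, if_neg hab, le_max_iff, WithZero.exp_le_exp, WithZero.exp_le_exp,
      neg_le_neg_iff, neg_le_neg_iff, ← min_le_iff, map_add]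
    apply HahnSeries.min_order_le_order_add
    rw [← map_add, (map_ne_zero_iff j j.injective)]
    exact hab

lemma hahnVal_apply {b : B} (hb : b ≠ 0) : hahnVal j hj b = WithZero.exp (-(j b).order) :=
  if_neg hb

lemma hahnVal_le_one_iff (b : B) : hahnVal j hj b ≤ 1 ↔ ∀ m < 0, (j b).coeff m = 0 := by
  by_cases hb : b = 0
  · simp [hb]
  rw [hahnVal_apply j hj hb, ← hahn_order_nonneg_iff, ← WithZero.exp_zero, WithZero.exp_le_exp]
  simp

lemma hahnVal_lt_one_iff {b : B} (hb : hahnVal j hj b ≤ 1) :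
    hahnVal j hj b < 1 ↔ (j b).coeff 0 = 0 := by
  by_cases hb0 : b = 0
  · simp [hb0]
  rw [hahnVal_le_one_iff, ← hahn_order_nonneg_iff] at hb
  rw [hahnVal_apply j hj hb0, ← WithZero.exp_zero, WithZero.exp_lt_exp, Left.neg_neg_iff]
  refine ⟨fun h => HahnSeries.coeff_eq_zero_of_lt_order h, fun h => lt_of_le_of_ne hb fun h0 => ?_⟩
  rw [h0] at h
  have hjb : j b ≠ 0 := (map_ne_zero_iff j j.injective).mpr hb0
  exact HahnSeries.coeff_order_eq_zero.not.mpr hjb h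

lemma hahnVal_integer_coeff_mul (a b : (hahnVal j hj).integer) :
    (j (a * b : B)).coeff 0 = (j a).coeff 0 * (j b).coeff 0 := by
  rw [map_mul]
  exact hahn_coeff_zero_mul ((hahnVal_le_one_iff j hj _).mp a.2)
    ((hahnVal_le_one_iff j hj _).mp b.2)

/-- Reduction modulo the maximal ideal reads off the constant coefficient. -/
lemma hahnVal_exists_residue {K : Type*} [Ring K] (ι : K →+* R) (hι : Function.Injective ι)
    (hr : ∀ b, hahnVal j hj b ≤ 1 → (j b).coeff 0 ∈ Set.range ι)
    (hs : ∀ x : K, ∃ b, hahnVal j hj b ≤ 1 ∧ (j b).coeff 0 = ι x) :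
    ∃ π : (hahnVal j hj).integer →+* K, Function.Surjective π ∧
      (∀ x, π x = 0 ↔ hahnVal j hj x < 1) ∧ ∀ x, ι (π x) = (j x).coeff 0 := by
  choose p hp using fun x : (hahnVal j hj).integer => hr x.1 x.2
  refine ⟨⟨⟨⟨p, hι ?_⟩, fun a b => hι ?_⟩, hι ?_, fun a b => hι ?_⟩, fun x => ?_, fun x => ?_, hp⟩
  · rw [hp, map_one]; simp
  · change ι (p (a * b)) = ι (p a * p b)
    rw [map_mul, hp, hp, hp]
    exact hahnVal_integer_coeff_mul j hj a b
  · change ι (p 0) = ι 0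
    rw [hp, map_zero]; simp
  · change ι (p (a + b)) = ι (p a + p b)
    rw [map_add, hp, hp, hp]
    simp
  · obtain ⟨b, hb, hx⟩ := hs x
    exact ⟨⟨b, hb⟩, hι ((hp _).trans hx)⟩
  · change p x = 0 ↔ _
    rw [hahnVal_lt_one_iff j hj x.2, ← hp, map_eq_zero_iff ι hι]

end HahnValuation

end

section

/-- The algebra `E` embedded in `A` as the centralizer of its centre, units `z i` of `A` acting on
the centre of `E` by generators `σ i` of its Galois group, and a free abelian group with basis
indexed by the `σ i` acting on the centre accordingly. -/
structure TignolData (k E A Γ : Type u) [Field k] [DivisionRing E] [Algebra k E] [Ring A]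
    [Algebra k A] [AddCommGroup Γ] (r : ℕ) where
  /-- the embedding of `E` -/
  e : E →ₐ[k] A
  e_injective : Function.Injective e
  centralizer : e.range = Subalgebra.centralizer k (e '' (Subring.center E : Set E))
  /-- the generators of the Galois group -/
  σ : Fin r → (Subring.center E ≃ₐ[k] Subring.center E)
  closure_σ : Subgroup.closure (Set.range σ) = ⊤
  /-- units inducing the generators -/
  z : Fin r → Aˣ
  z_mul : ∀ (i : Fin r) (a : Subring.center E), (z i : A) * e a = e (σ i a) * z i
  /-- the exponents of the indeterminates -/
  b : Module.Basis (Fin r) ℤ Γ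
  /-- the action of the exponents on the centre -/
  s : Γ → (Subring.center E ≃ₐ[k] Subring.center E)
  s_add : ∀ m n, s (m + n) = s m * s n
  s_b : ∀ i, s (b i) = σ i

lemma finiteDimensional_center (k E : Type*) [Field k] [DivisionRing E] [Algebra k E]
    [FiniteDimensional k E] : FiniteDimensional k (Subring.center E) :=
  Module.Finite.of_injective
    ({ toFun := Subtype.val
       map_add' := fun _ _ => rfl
       map_smul' := fun c x => by
        rw [Algebra.smul_def, Algebra.smul_def]; rfl } : Subring.center E →ₗ[k] E)
    Subtype.val_injective

namespace TignolData

variable {k E A Γ : Type u} [Field k] [DivisionRing E] [Algebra k E] [Ring A]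
    [Algebra k A] [AddCommGroup Γ] {r : ℕ} (S : TignolData k E A Γ r)

lemma s_zero : S.s 0 = 1 := by
  have h := S.s_add 0 0
  rw [add_zero] at h
  exact left_eq_mul.mp h

lemma s_neg (m : Γ) : S.s (-m) = (S.s m)⁻¹ := by
  rw [eq_inv_iff_mul_eq_one, ← S.s_add, neg_add_cancel, S.s_zero]

lemma mem_of_b_mem (M : AddSubgroup Γ) (h : ∀ i, S.b i ∈ M) (m : Γ) : m ∈ M := by
  have h1 : Submodule.span ℤ (Set.range S.b) ≤ M.toIntSubmodule :=
    Submodule.span_le.mpr (by rintro _ ⟨i, rfl⟩; exact h i)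
  rw [S.b.span_eq] at h1
  exact h1 (Submodule.mem_top (x := m))

lemma s_surjective : Function.Surjective S.s := by
  let f : Multiplicative Γ →* (Subring.center E ≃ₐ[k] Subring.center E) :=
    ⟨⟨fun m => S.s m.toAdd, S.s_zero⟩, fun m n => S.s_add _ _⟩
  have h : f.range = ⊤ := by
    rw [eq_top_iff, ← S.closure_σ, Subgroup.closure_le]
    rintro _ ⟨i, rfl⟩
    exact ⟨Multiplicative.ofAdd (S.b i), S.s_b i⟩
  intro g
  obtain ⟨m, hm⟩ := MonoidHom.range_eq_top.mp h g
  exact ⟨m.toAdd, hm⟩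

/-- The elements of `A` acting on the centre of `E` by the automorphism `s m`. -/
def Homog (m : Γ) (a : A) : Prop :=
  ∀ c : Subring.center E, a * S.e c = S.e (S.s m c) * a

variable {S}

lemma Homog.zero (m : Γ) : S.Homog m 0 := fun c => by simp

lemma Homog.add {m : Γ} {a b : A} (ha : S.Homog m a) (hb : S.Homog m b) :
    S.Homog m (a + b) := fun c => by rw [add_mul, mul_add, ha, hb]

lemma Homog.neg {m : Γ} {a : A} (ha : S.Homog m a) : S.Homog m (-a) := fun c => by
  rw [neg_mul, mul_neg, ha]

lemma Homog.sum {ι : Type*} {m : Γ} (t : Finset ι) {f : ι → A} (h : ∀ i ∈ t, S.Homog m (f i)) :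
    S.Homog m (∑ i ∈ t, f i) := fun c => by
  rw [Finset.sum_mul, Finset.mul_sum]
  exact Finset.sum_congr rfl fun i hi => h i hi c

lemma Homog.mul {m n : Γ} {a b : A} (ha : S.Homog m a) (hb : S.Homog n b) :
    S.Homog (m + n) (a * b) := fun c => by
  rw [mul_assoc, hb, ← mul_assoc, ha, mul_assoc, S.s_add, AlgEquiv.mul_apply]

lemma Homog.inv {m : Γ} {a : Aˣ} (ha : S.Homog m (a : A)) : S.Homog (-m) ((a⁻¹ : Aˣ) : A) :=
  fun c => by
  rw [Units.inv_mul_eq_iff_eq_mul, ← mul_assoc, ha, mul_assoc, Units.mul_inv, mul_one,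
    S.s_neg, ← AlgEquiv.mul_apply, mul_inv_cancel, AlgEquiv.one_apply]

lemma homog_iff_mem_range {m : Γ} (hm : S.s m = 1) {a : A} :
    S.Homog m a ↔ a ∈ Set.range S.e := by
  have h : a ∈ Set.range S.e ↔ a ∈ S.e.range := by simp
  rw [h, S.centralizer, Subalgebra.mem_centralizer_iff]
  simp only [Homog, hm, AlgEquiv.one_apply]
  refine ⟨?_, fun h c => (h _ ⟨c, c.2, rfl⟩).symm⟩
  rintro h _ ⟨c, hc, rfl⟩
  exact (h ⟨c, hc⟩).symm

lemma homog_e (x : E) : S.Homog 0 (S.e x) := (homog_iff_mem_range S.s_zero).mpr ⟨x, rfl⟩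

lemma homog_z (i : Fin r) : S.Homog (S.b i) (S.z i : A) := fun c => by rw [S.z_mul, S.s_b]

lemma isUnit_e {x : E} (hx : x ≠ 0) : IsUnit (S.e x) := (IsUnit.mk0 x hx).map S.e

variable (S) in
lemma exists_unit (m : Γ) : ∃ u : Aˣ, S.Homog m (u : A) := by
  let M : AddSubgroup Γ :=
    { carrier := {m | ∃ u : Aˣ, S.Homog m (u : A)}
      zero_mem' := ⟨1, by simpa using homog_e (S := S) 1⟩
      add_mem' := by
        rintro m n ⟨u, hu⟩ ⟨v, hv⟩
        exact ⟨u * v, by simpa using hu.mul hv⟩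
      neg_mem' := by
        rintro m ⟨u, hu⟩
        exact ⟨u⁻¹, hu.inv⟩ }
  exact S.mem_of_b_mem M (fun i => ⟨S.z i, homog_z i⟩) m

lemma Homog.exists_e_mul {m : Γ} {a : A} (ha : S.Homog m a) {n : Γ} {u : Aˣ}
    (hu : S.Homog n (u : A)) (hmn : S.s m = S.s n) : ∃ x : E, a = S.e x * u := by
  have h : S.Homog (m + -n) (a * (u⁻¹ : Aˣ)) := ha.mul hu.inv
  obtain ⟨x, hx⟩ := (homog_iff_mem_range (by
    rw [S.s_add, S.s_neg, hmn, mul_inv_cancel])).mp h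
  exact ⟨x, by rw [hx, mul_assoc, Units.inv_mul, mul_one]⟩

lemma Homog.isUnit {m : Γ} {a : A} (ha : S.Homog m a) (h0 : a ≠ 0) : IsUnit a := by
  obtain ⟨u, hu⟩ := S.exists_unit m
  obtain ⟨x, rfl⟩ := ha.exists_e_mul hu rfl
  refine (isUnit_e ?_).mul u.isUnit
  rintro rfl
  simp at h0

lemma mem_base_of_fixed [FiniteDimensional k E] (hgal : IsGalois k (Subring.center E)) (x : Subring.center E)
    (hx : ∀ i, S.σ i x = x) : ∃ c : k, algebraMap k E c = x := by
  have := finiteDimensional_center k E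
  have h : ∀ g : (Subring.center E ≃ₐ[k] Subring.center E), g x = x := by
    intro g
    have : g ∈ MulAction.stabilizer (Subring.center E ≃ₐ[k] Subring.center E) x := by
      have h2 : Subgroup.closure (Set.range S.σ) ≤
          MulAction.stabilizer (Subring.center E ≃ₐ[k] Subring.center E) x := by
        rw [Subgroup.closure_le]
        rintro _ ⟨i, rfl⟩
        exact hx i
      rw [S.closure_σ] at h2
      exact h2 (Subgroup.mem_top g)
    exact this
  obtain ⟨c, hc⟩ := (IsGalois.mem_range_algebraMap_iff_fixed x).mpr h
  exact ⟨c, congrArg Subtype.val hc⟩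

variable (S) in
/-- The exponents acting trivially on the centre. -/
def N : AddSubgroup Γ where
  carrier := {m | S.s m = 1}
  zero_mem' := S.s_zero
  add_mem' {m n} hm hn := by
    change S.s (m + n) = 1
    rw [S.s_add, hm, hn, one_mul]
  neg_mem' {m} hm := by
    change S.s (-m) = 1
    rw [S.s_neg, hm, inv_one]

lemma mem_N {m : Γ} : m ∈ S.N ↔ S.s m = 1 := Iff.rfl

variable [LinearOrder Γ] [IsOrderedAddMonoid Γ]

variable (S) in
/-- Hahn series all of whose coefficients are homogeneous of the right degree. -/
def homogSubring : Subring (HahnSeries Γ A) where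
  carrier := {f | ∀ m, S.Homog m (f.coeff m)}
  zero_mem' m := Homog.zero m
  one_mem' m := by
    change S.Homog m ((HahnSeries.single 0 1).coeff m)
    by_cases h : m = 0
    · subst h
      simpa using homog_e (S := S) 1
    · rw [HahnSeries.coeff_single_of_ne h]
      exact Homog.zero m
  add_mem' hf hg m := (hf m).add (hg m)
  neg_mem' hf m := (hf m).neg
  mul_mem' {f g} hf hg m := by
    rw [HahnSeries.coeff_mul]
    refine Homog.sum _ fun ij hij => ?_
    rw [Finset.mem_antidiagonal] at hij
    rw [← hij.2.2]
    exact (hf _).mul (hg _)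

lemma single_mem_homogSubring {m : Γ} {a : A} (ha : S.Homog m a) :
    HahnSeries.single m a ∈ S.homogSubring := fun n => by
  by_cases h : n = m
  · subst h
    simpa using ha
  · rw [HahnSeries.coeff_single_of_ne h]
    exact Homog.zero n

lemma isUnit_leadingCoeff {f : HahnSeries Γ A} (hf : f ∈ S.homogSubring) (h0 : f ≠ 0) :
    IsUnit f.leadingCoeff := by
  refine Homog.isUnit (m := f.order) (S := S) ?_ (HahnSeries.leadingCoeff_ne_zero.mpr h0)
  rw [HahnSeries.leadingCoeff_eq]
  exact hf _

variable (S) in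
/-- The embedding of the commutative Hahn series with exponents in `N`. -/
def base {k' R : Type*} [Ring k'] [Ring R] (f : k' →+* R) :
    HahnSeries S.N k' →+* HahnSeries Γ R where
  toFun q := HahnSeries.embDomainRingHom S.N.subtype Subtype.val_injective (fun _ _ => Iff.rfl)
    (q.map f)
  map_one' := by
    rw [← map_one (HahnSeries.embDomainRingHom (R := R) S.N.subtype Subtype.val_injective
      (fun _ _ => Iff.rfl))]
    congr 1
    ext m
    by_cases h : m = 0 <;> simp [HahnSeries.coeff_one, h]
  map_zero' := by
    rw [← map_zero (HahnSeries.embDomainRingHom (R := R) S.N.subtype Subtype.val_injective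
      (fun _ _ => Iff.rfl))]
    congr 1
    ext m
    simp
  map_add' p q := by
    rw [← map_add (HahnSeries.embDomainRingHom (R := R) S.N.subtype Subtype.val_injective
      (fun _ _ => Iff.rfl))]
    congr 1
    ext m
    simp
  map_mul' p q := by
    rw [← map_mul (HahnSeries.embDomainRingHom (R := R) S.N.subtype Subtype.val_injective
      (fun _ _ => Iff.rfl))]
    congr 1
    exact HahnSeries.map_mul (f : k' →ₙ+* R)

lemma base_coeff {k' R : Type*} [Ring k'] [Ring R] (f : k' →+* R) (q : HahnSeries S.N k')
    (m : S.N) : (S.base f q).coeff m = f (q.coeff m) := by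
  change (HahnSeries.embDomain _ _).coeff _ = _
  exact HahnSeries.embDomain_coeff (a := m)

lemma base_coeff_of_notMem {k' R : Type*} [Ring k'] [Ring R] (f : k' →+* R)
    (q : HahnSeries S.N k') {m : Γ} (hm : m ∉ S.N) : (S.base f q).coeff m = 0 := by
  refine HahnSeries.embDomain_of_notMem_range ?_
  rintro ⟨n, rfl⟩
  exact hm n.2

lemma base_injective {k' R : Type*} [Ring k'] [Ring R] (f : k' →+* R)
    (hf : Function.Injective f) : Function.Injective (S.base f) := by
  intro p q h
  ext m
  have := congrArg (fun g => HahnSeries.coeff g (m : Γ)) h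
  simp only [base_coeff] at this
  exact hf this

lemma base_single {k' R : Type*} [Ring k'] [Ring R] (f : k' →+* R) (n : S.N) (x : k') :
    S.base f (HahnSeries.single n x) = HahnSeries.single (n : Γ) (f x) := by
  ext m
  by_cases hm : m ∈ S.N
  · have := base_coeff f (HahnSeries.single n x) ⟨m, hm⟩
    rw [this]
    by_cases h : m = n
    · subst h; simp
    · rw [HahnSeries.coeff_single_of_ne h, HahnSeries.coeff_single_of_ne
        (fun h' => h (congrArg Subtype.val h')), map_zero]
  · rw [base_coeff_of_notMem f _ hm, HahnSeries.coeff_single_of_ne]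
    rintro rfl
    exact hm n.2

lemma mem_range_base {k' R : Type*} [Ring k'] [Ring R] {f : k' →+* R}
    (hf : Function.Injective f) {g : HahnSeries Γ R}
    (h : ∀ m, g.coeff m ∈ Set.range f) (hN : ∀ m ∉ S.N, g.coeff m = 0) :
    g ∈ (S.base f).range := by
  choose p hp using h
  have hsupp : (Function.support fun n : S.N => p n) = {n : S.N | (n : Γ) ∈ g.support} := by
    ext n
    simp only [Function.mem_support, Set.mem_setOf_eq, HahnSeries.mem_support, ← hp]
    exact (map_ne_zero_iff f hf).symm
  refine ⟨⟨fun n => p n, ?_⟩, ?_⟩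
  · rw [hsupp]
    intro a
    exact g.isPWO_support fun n => ⟨(a n).1.1, (a n).2⟩
  · ext m
    by_cases hm : m ∈ S.N
    · exact (base_coeff f _ ⟨m, hm⟩).trans (hp m)
    · rw [base_coeff_of_notMem f _ hm, hN m hm]

/-- Homogeneous series commuting with `E` and the `x i` have coefficients in `k` and exponents in
`N`. -/
lemma mem_range_base_of_commute [FiniteDimensional k E] [FaithfulSMul k A] (hgal : IsGalois k (Subring.center E))
    {f : HahnSeries Γ A}
    (hf : f ∈ S.homogSubring) (h1 : ∀ a, f * HahnSeries.C (S.e a) = HahnSeries.C (S.e a) * f)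
    (h2 : ∀ i, f * HahnSeries.single (S.b i) (S.z i : A) =
      HahnSeries.single (S.b i) (S.z i : A) * f) :
    f ∈ (S.base (algebraMap k A)).range := by
  have hk : ∀ m, f.coeff m ∈ Set.range (algebraMap k A) := by
    intro m
    have hc : ∀ a, f.coeff m * S.e a = S.e a * f.coeff m := fun a => by
      have := congrArg (fun g => HahnSeries.coeff g m) (h1 a)
      simpa [HahnSeries.C_apply] using this
    obtain ⟨x, hx⟩ := (homog_iff_mem_range (S := S) S.s_zero (a := f.coeff m)).mp fun c => by
      rw [S.s_zero, AlgEquiv.one_apply, hc]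
    have hxc : x ∈ Subring.center E := Subring.mem_center_iff.mpr fun g => by
      apply S.e_injective
      rw [map_mul, map_mul, hx, hc]
    have hfix : ∀ i, S.σ i ⟨x, hxc⟩ = ⟨x, hxc⟩ := fun i => by
      have h := congrArg (fun g => HahnSeries.coeff g (m + S.b i)) (h2 i)
      simp only [HahnSeries.coeff_mul_single_add] at h
      rw [HahnSeries.coeff_single_mul_add, ← hx] at h
      have h3 := S.z_mul i ⟨x, hxc⟩
      rw [h3] at h
      have h4 := (S.z i).isUnit.mul_left_injective h
      exact Subtype.ext (S.e_injective h4).symm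
    obtain ⟨c, hc'⟩ := mem_base_of_fixed hgal _ hfix
    exact ⟨c, by rw [← hx, ← AlgHom.commutes S.e, hc']⟩
  refine mem_range_base (FaithfulSMul.algebraMap_injective k A) hk fun m hm => ?_
  by_contra h0
  obtain ⟨c, hc⟩ := hk m
  refine hm (mem_N.mpr (AlgEquiv.ext fun x => ?_))
  have h := hf m x
  rw [← hc, Algebra.commutes] at h
  have h4 := ((hf m).isUnit h0).mul_left_injective (a₁ := S.e x) (a₂ := S.e (S.s m x))
    (by rw [← hc]; exact h)
  exact Subtype.ext (S.e_injective h4).symm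

end TignolData

end

section

section NormalForm

variable {E T : Type*} [Ring E] [Ring T] {r : ℕ} (ε : E →+* T) (ξ : Fin r → T)
  {conj : Fin r → E → E} {cmt : Fin r → Fin r → E}
  (h1 : ∀ i a, ξ i * ε a = ε (conj i a) * ξ i)
  (h2 : ∀ i j, ξ i * ξ j = ε (cmt i j) * ξ j * ξ i)

include h1 h2

lemma twisted_perm {w w' : List (Fin r)} (h : w.Perm w') :
    ∃ a : E, (w.map ξ).prod = ε a * (w'.map ξ).prod := by
  induction h with
  | nil => exact ⟨1, by simp⟩
  | cons i _ ih =>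
    obtain ⟨a, ha⟩ := ih
    refine ⟨conj i a, ?_⟩
    rw [List.map_cons, List.prod_cons, ha, ← mul_assoc, h1, List.map_cons, List.prod_cons,
      mul_assoc]
  | swap i j w =>
    refine ⟨cmt j i, ?_⟩
    simp only [List.map_cons, List.prod_cons, ← mul_assoc]
    rw [h2 j i]
  | trans _ _ ih1 ih2 =>
    obtain ⟨a, ha⟩ := ih1
    obtain ⟨b, hb⟩ := ih2
    exact ⟨a * b, by rw [ha, hb, map_mul, mul_assoc]⟩

/-- Every element of a twisted polynomial ring is a left combination of ordered monomials. -/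
lemma twisted_normal_form {t : T} (ht : t ∈ Subring.closure (Set.range ε ∪ Set.range ξ)) :
    ∃ f : Multiset (Fin r) →₀ E, t = f.sum fun s a => ε a * (s.toList.map ξ).prod := by
  classical
  let X : Multiset (Fin r) → T := fun s => (s.toList.map ξ).prod
  let P : AddSubgroup T := AddMonoidHom.range
    (Finsupp.liftAddHom (fun s : Multiset (Fin r) =>
      (AddMonoidHom.mulRight (X s)).comp ε.toAddMonoidHom))
  have hX : ∀ a s, ε a * X s ∈ P := fun a s => ⟨Finsupp.single s a, by simp⟩
  have hPind : ∀ (Q : T → Prop), Q 0 → (∀ x y, Q x → Q y → Q (x + y)) →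
      (∀ a s, Q (ε a * X s)) → ∀ t ∈ P, Q t := by
    rintro Q h0 hadd hs _ ⟨f, rfl⟩
    induction f using Finsupp.induction_linear with
    | zero => simpa using h0
    | add f g hf hg => rw [map_add]; exact hadd _ _ hf hg
    | single s a => simpa using hs a s
  have hε : ∀ a, ∀ t ∈ P, ε a * t ∈ P := fun a => hPind _ (by simp [P.zero_mem])
    (fun x y hx hy => by rw [mul_add]; exact P.add_mem hx hy)
    (fun c s => by rw [← mul_assoc, ← map_mul]; exact hX _ s)
  have hξ : ∀ i, ∀ t ∈ P, ξ i * t ∈ P := fun i => hPind _ (by simp [P.zero_mem])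
    (fun x y hx hy => by rw [mul_add]; exact P.add_mem hx hy)
    (fun c s => by
      have hp : (i :: s.toList).Perm (i ::ₘ s).toList := by
        rw [← Multiset.coe_eq_coe, Multiset.coe_toList, ← Multiset.cons_coe, Multiset.coe_toList]
      obtain ⟨a, ha⟩ := twisted_perm ε ξ h1 h2 hp
      rw [List.map_cons, List.prod_cons] at ha
      rw [← mul_assoc, h1, mul_assoc, ha, ← mul_assoc, ← map_mul]
      exact hX _ _)
  have hall : ∀ t ∈ Subring.closure (Set.range ε ∪ Set.range ξ), ∀ p ∈ P, t * p ∈ P := by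
    intro t ht
    induction ht using Subring.closure_induction with
    | mem x hx =>
      rcases hx with ⟨a, rfl⟩ | ⟨i, rfl⟩
      · exact hε a
      · exact hξ i
    | zero => simp [P.zero_mem]
    | one => simp
    | add x y _ _ hx hy => intro p hp; rw [add_mul]; exact P.add_mem (hx p hp) (hy p hp)
    | neg x _ hx => intro p hp; rw [neg_mul]; exact P.neg_mem (hx p hp)
    | mul x y _ _ hx hy => intro p hp; rw [mul_assoc]; exact hx _ (hy p hp)
  have hone : (1 : T) ∈ P := by simpa [X] using hX 1 0
  obtain ⟨f, hf⟩ := hall t ht 1 hone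
  exact ⟨f, by rw [← mul_one t, ← hf]; rfl⟩

end NormalForm

section CentralQuotients

variable {T D H : Type*} [Ring T] [DivisionRing D] [Ring H]

/-- Extension of ring homomorphisms to the ring of central quotients. -/
lemma exists_extend_central_quotients (φ : T →+* D) (hφ : Function.Injective φ)
    (hquot : ∀ d : D, ∃ t c : T, c ∈ Subring.center T ∧ φ c ≠ 0 ∧ d = φ t * (φ c)⁻¹)
    (ψ : T →+* H) (hu : ∀ c ∈ Subring.center T, c ≠ 0 → IsUnit (ψ c)) :
    ∃ j : D →+* H, ∀ t, j (φ t) = ψ t := by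
  choose t c hc h0 hd using hquot
  have hdc : ∀ d, d * φ (c d) = φ (t d) := fun d => by
    rw [← eq_mul_inv_iff_mul_eq₀ (h0 d), ← hd d]
  have hcomm : ∀ d x, x * c d = c d * x := fun d x => Subring.mem_center_iff.mp (hc d) x
  have h0' : ∀ d, c d ≠ 0 := fun d h => h0 d (by rw [h, map_zero])
  choose w hw using fun d => hu (c d) (hc d) (h0' d)
  have hwcomm : ∀ d x, ψ x * (w d : H) = w d * ψ x := fun d x => by
    rw [hw, ← map_mul, ← map_mul, hcomm]
  let j : D → H := fun d => ψ (t d) * ((w d)⁻¹ : Hˣ)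
  have key : ∀ d x y, y ∈ Subring.center T → y ≠ 0 → d * φ y = φ x → j d * ψ y = ψ x := by
    intro d x y hy hy0 hxy
    have hy' := fun x => Subring.mem_center_iff.mp hy x
    have h : t d * y = x * c d := by
      apply hφ
      rw [map_mul, map_mul, ← hdc, ← hxy, mul_assoc, mul_assoc, ← map_mul, ← map_mul, hy']
    have h' : j d * ψ y * w d = ψ x * w d := by
      rw [mul_assoc, hwcomm, ← mul_assoc, Units.inv_mul_cancel_right, ← map_mul, h, map_mul, hw]
    exact (w d).isUnit.mul_left_injective h'
  have hchar : ∀ d x y h, y ∈ Subring.center T → y ≠ 0 → d * φ y = φ x → h * ψ y = ψ x →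
      j d = h := by
    intro d x y h hy hy0 hxy hh
    exact (hu y hy hy0).mul_left_injective ((key d x y hy hy0 hxy).trans hh.symm)
  have hjc : ∀ d, j d * ψ (c d) = ψ (t d) := fun d => key d _ _ (hc d) (h0' d) (hdc d)
  have hjφ : ∀ x, j (φ x) = ψ x := fun x =>
    hchar _ (x * c (φ x)) (c (φ x)) _ (hc _) (h0' _) (by rw [map_mul]) (by rw [map_mul])
  have hprod0 : ∀ a b, c a * c b ≠ 0 := fun a b h => by
    have := congrArg φ h
    rw [map_mul, map_zero] at this
    exact mul_ne_zero (h0 a) (h0 b) this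
  have hDc : ∀ d b, b * φ (c d) = φ (c d) * b := fun d b => by
    have h : Commute (φ (t b)) (φ (c d)) := by
      rw [Commute, SemiconjBy, ← map_mul, ← map_mul, hcomm]
    have h' : Commute (φ (c b)) (φ (c d)) := by
      rw [Commute, SemiconjBy, ← map_mul, ← map_mul, hcomm]
    rw [hd b]
    exact h.mul_left h'.inv_left₀
  have hjc' : ∀ d b, j b * ψ (c d) = ψ (c d) * j b := fun d b => by
    have h : Commute (ψ (t b)) (ψ (c d)) := by
      rw [Commute, SemiconjBy, ← map_mul, ← map_mul, hcomm]
    have h' : Commute (w b : H) (ψ (c d)) := by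
      rw [hw, Commute, SemiconjBy, ← map_mul, ← map_mul, hcomm]
    exact h.mul_left h'.units_inv_left
  clear_value j
  refine ⟨⟨⟨⟨j, ?_⟩, fun a b => ?_⟩, ?_, fun a b => ?_⟩, hjφ⟩
  · simpa using hjφ 1
  · refine hchar _ (t a * t b) (c a * c b) _ (mul_mem (hc a) (hc b)) (hprod0 a b) ?_ ?_
    · rw [map_mul, map_mul, ← hdc a, ← hdc b, mul_assoc a b, ← mul_assoc b, hDc a b, ← mul_assoc,
        ← mul_assoc, mul_assoc (a * _)]
    · rw [map_mul, map_mul]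
      change j a * j b * _ = _
      rw [← hjc a, ← hjc b]
      rw [mul_assoc, ← mul_assoc (j b), hjc', ← mul_assoc, ← mul_assoc, mul_assoc (j a * _)]
  · simpa using hjφ 0
  · refine hchar _ (t a * c b + t b * c a) (c a * c b) _ (mul_mem (hc a) (hc b)) (hprod0 a b) ?_ ?_
    · rw [map_add, map_mul, map_mul, map_mul, ← hdc a, ← hdc b, add_mul, mul_assoc, mul_assoc,
        hDc a (φ (c b))]
    · rw [map_add, map_mul, map_mul, map_mul]
      change (j a + j b) * _ = _
      have h : ψ (c b) * ψ (c a) = ψ (c a) * ψ (c b) := by rw [← map_mul, ← map_mul, hcomm]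
      rw [← hjc a, ← hjc b, add_mul, mul_assoc, mul_assoc, h]

end CentralQuotients

end

section

namespace TignolData

variable {k E A Γ : Type u} [Field k] [DivisionRing E] [Algebra k E] [Ring A]
    [Algebra k A] [AddCommGroup Γ] {r : ℕ} (S : TignolData k E A Γ r)

/-- The exponent of a monomial. -/
def deg (s : Multiset (Fin r)) : Γ := (s.map S.b).sum

lemma deg_injective : Function.Injective S.deg := by
  classical
  intro s t h
  ext i
  have key : ∀ s : Multiset (Fin r), S.b.repr (S.deg s) i = (s.count i : ℤ) := by
    intro s
    induction s using Multiset.induction_on with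
    | empty => simp [deg]
    | cons a s ih =>
      have : S.deg (a ::ₘ s) = S.b a + S.deg s := by simp [deg]
      rw [this, map_add, Finsupp.add_apply, ih, Multiset.count_cons, S.b.repr_self,
        Finsupp.single_apply]
      by_cases hai : a = i
      · subst hai; simp [add_comm]
      · have : i ≠ a := fun h => hai h.symm
        simp [hai, this]
  have := key s
  rw [h, key t] at this
  exact_mod_cast this.symm

variable [LinearOrder Γ] [IsOrderedAddMonoid Γ]

lemma prod_single (w : List (Fin r)) :
    (w.map fun i => HahnSeries.single (S.b i) (S.z i : A)).prod =
      HahnSeries.single (S.deg w) (((w.map S.z).prod : Aˣ) : A) := by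
  induction w with
  | nil => rfl
  | cons i w ih =>
    rw [List.map_cons, List.prod_cons, ih, HahnSeries.single_mul_single, ← Multiset.cons_coe,
      deg, deg, Multiset.map_cons, Multiset.sum_cons, List.map_cons, List.prod_cons,
      Units.val_mul]

/-- Distinct monomials remain linearly independent in the ring of Hahn series. -/
lemma finsupp_sum_single_eq_zero (f : Multiset (Fin r) →₀ E)
    (hf : (f.sum fun s a => (HahnSeries.C (S.e a) : HahnSeries Γ A) *
      (s.toList.map fun i => HahnSeries.single (S.b i) (S.z i : A)).prod) = 0) : f = 0 := by
  classical
  ext s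
  have h := congrArg (fun g => HahnSeries.coeff g (S.deg s)) hf
  simp only [Finsupp.sum, prod_single, HahnSeries.coeff_sum, HahnSeries.C_apply,
    HahnSeries.single_mul_single, zero_add, Multiset.coe_toList, HahnSeries.coeff_zero] at h
  rw [Finset.sum_eq_single s] at h
  · rw [HahnSeries.coeff_single_same] at h
    have h2 := (Units.mul_left_eq_zero _).mp h
    exact S.e_injective (by simpa using h2)
  · intro t _ hts
    rw [HahnSeries.coeff_single_of_ne]
    exact fun h => hts (S.deg_injective h).symm
  · intro hs
    rw [Finsupp.notMem_support_iff.mp hs]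
    simp

/-- A division ring of central quotients of a twisted polynomial ring, embedded in the ring of
Hahn series over `A`. -/
structure Lift (D : Type u) [DivisionRing D] where
  /-- the embedding -/
  j : D →+* HahnSeries Γ A
  /-- the constants -/
  ε : E →+* D
  /-- the indeterminates -/
  ξ : Fin r → D
  j_ε : ∀ a, j (ε a) = HahnSeries.C (S.e a)
  j_ξ : ∀ i, j (ξ i) = HahnSeries.single (S.b i) (S.z i : A)
  quot : ∀ d : D, ∃ t ∈ Subring.closure (Set.range ε ∪ Set.range ξ),
    ∃ c ∈ Subring.closure (Set.range ε ∪ Set.range ξ),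
      c ∈ Subring.center D ∧ c ≠ 0 ∧ d = t * c⁻¹

end TignolData

section TwistedPolyRing

variable {k E : Type u} [Field k] [DivisionRing E] [Algebra k E] {r : ℕ}
  {conj : Fin r → E → E} {cmt : Fin r → Fin r → E}

/-- The constants of the twisted polynomial ring. -/
def twistedC (conj : Fin r → E → E) (cmt : Fin r → Fin r → E) :
    E →ₐ[k] TwistedPolyRing k E r conj cmt :=
  AlgHom.ofLinearMap
    { toFun := fun a => RingQuot.mkAlgHom k _ (FreeAlgebra.ι k (Sum.inl a))
      map_add' := fun a b => by
        rw [← map_add]; exact RingQuot.mkAlgHom_rel k (TwistRel.add a b)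
      map_smul' := fun c a => by
        rw [RingHom.id_apply, ← map_smul]; exact RingQuot.mkAlgHom_rel k (TwistRel.smul c a) }
    (by rw [← map_one (RingQuot.mkAlgHom k (TwistRel k E r conj cmt))]
        exact RingQuot.mkAlgHom_rel k TwistRel.one)
    (fun a b => by
      change RingQuot.mkAlgHom k _ _ = RingQuot.mkAlgHom k _ _ * RingQuot.mkAlgHom k _ _
      rw [← map_mul]; exact RingQuot.mkAlgHom_rel k (TwistRel.mul a b))

/-- The indeterminates of the twisted polynomial ring. -/
def twistedX (conj : Fin r → E → E) (cmt : Fin r → Fin r → E) (i : Fin r) :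
    TwistedPolyRing k E r conj cmt :=
  RingQuot.mkAlgHom k _ (FreeAlgebra.ι k (Sum.inr i))

lemma twistedX_mul_C (i : Fin r) (a : E) :
    twistedX (k := k) conj cmt i * twistedC conj cmt a =
      twistedC conj cmt (conj i a) * twistedX conj cmt i := by
  change RingQuot.mkAlgHom k _ _ * RingQuot.mkAlgHom k _ _ =
    RingQuot.mkAlgHom k _ _ * RingQuot.mkAlgHom k _ _
  rw [← map_mul, ← map_mul]
  exact RingQuot.mkAlgHom_rel k (TwistRel.comm i a)

lemma twistedX_mul_X (i l : Fin r) :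
    twistedX (k := k) conj cmt i * twistedX conj cmt l =
      twistedC conj cmt (cmt i l) * twistedX conj cmt l * twistedX conj cmt i := by
  change RingQuot.mkAlgHom k _ _ * RingQuot.mkAlgHom k _ _ =
    RingQuot.mkAlgHom k _ _ * RingQuot.mkAlgHom k _ _ * RingQuot.mkAlgHom k _ _
  rw [← map_mul, ← map_mul, ← map_mul]
  exact RingQuot.mkAlgHom_rel k (TwistRel.xcomm i l)

lemma mem_closure_twisted (t : TwistedPolyRing k E r conj cmt) :
    t ∈ Subring.closure (Set.range (twistedC (k := k) conj cmt) ∪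
      Set.range (twistedX conj cmt)) := by
  obtain ⟨x, rfl⟩ := RingQuot.mkAlgHom_surjective k _ t
  induction x using FreeAlgebra.induction with
  | grade0 c =>
    refine Subring.subset_closure (Or.inl ⟨algebraMap k E c, ?_⟩)
    rw [AlgHom.commutes, AlgHom.commutes]
  | grade1 x =>
    rcases x with a | i
    · exact Subring.subset_closure (Or.inl ⟨a, rfl⟩)
    · exact Subring.subset_closure (Or.inr ⟨i, rfl⟩)
  | mul a b ha hb => rw [map_mul]; exact mul_mem ha hb
  | add a b ha hb => rw [map_add]; exact add_mem ha hb

lemma twistedPolyRing_normal_form (t : TwistedPolyRing k E r conj cmt) :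
    ∃ f : Multiset (Fin r) →₀ E, t = f.sum fun s a =>
      twistedC (k := k) conj cmt a * (s.toList.map (twistedX conj cmt)).prod := by
  let ε : E →+* TwistedPolyRing k E r conj cmt := RingHomClass.toRingHom (twistedC (k := k) conj cmt)
  have h1 : ∀ i a, twistedX conj cmt i * ε a = ε (conj i a) * twistedX conj cmt i :=
    twistedX_mul_C
  have h2 : ∀ i l, twistedX conj cmt i * twistedX conj cmt l =
      ε (cmt i l) * twistedX conj cmt l * twistedX conj cmt i := twistedX_mul_X
  exact twisted_normal_form ε (twistedX conj cmt) h1 h2 (mem_closure_twisted t)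

lemma exists_twisted_lift {B : Type*} [Ring B] [Algebra k B] (f : E →ₐ[k] B) (x : Fin r → B)
    (h1 : ∀ i a, x i * f a = f (conj i a) * x i)
    (h2 : ∀ i l, x i * x l = f (cmt i l) * x l * x i) :
    ∃ ψ : TwistedPolyRing k E r conj cmt →ₐ[k] B,
      (∀ a, ψ (twistedC conj cmt a) = f a) ∧ ∀ i, ψ (twistedX conj cmt i) = x i := by
  refine ⟨RingQuot.liftAlgHom k ⟨FreeAlgebra.lift k (Sum.elim f x), ?_⟩, fun a => ?_, fun i => ?_⟩
  · intro a b h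
    induction h <;> simp [h1, h2]
  · change RingQuot.liftAlgHom k _ (RingQuot.mkAlgHom k _ _) = _
    rw [RingQuot.liftAlgHom_mkAlgHom_apply]
    simp
  · change RingQuot.liftAlgHom k _ (RingQuot.mkAlgHom k _ _) = _
    rw [RingQuot.liftAlgHom_mkAlgHom_apply]
    simp

end TwistedPolyRing

namespace TignolData

variable {k E A Γ : Type u} [Field k] [DivisionRing E] [Algebra k E] [Ring A]
    [Algebra k A] [AddCommGroup Γ] {r : ℕ} (S : TignolData k E A Γ r)
    [LinearOrder Γ] [IsOrderedAddMonoid Γ] [FiniteDimensional k E] [FaithfulSMul k A]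

lemma exists_lift (hgal : IsGalois k (Subring.center E)) (conj : Fin r → E → E)
    (hconj : ∀ (i : Fin r) (a : E), S.e (conj i a) = (S.z i : A) * S.e a * ((S.z i)⁻¹ : Aˣ))
    (cmt : Fin r → Fin r → E)
    (hcmt : ∀ i j : Fin r,
      S.e (cmt i j) = (S.z i : A) * (S.z j : A) * ((S.z i)⁻¹ : Aˣ) * ((S.z j)⁻¹ : Aˣ))
    (D : Type u) [DivisionRing D] [Algebra k D]
    (φ : TwistedPolyRing k E r conj cmt →ₐ[k] D)
    (hφinj : Function.Injective φ)
    (hquot : ∀ d : D, ∃ t c : TwistedPolyRing k E r conj cmt,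
      c ∈ Subring.center (TwistedPolyRing k E r conj cmt) ∧ φ c ≠ 0 ∧
        d = φ t * (φ c)⁻¹) :
    ∃ Λ : S.Lift D, ∀ c : k, Λ.ε (algebraMap k E c) = algebraMap k D c := by
  let f : E →ₐ[k] HahnSeries Γ A :=
    { (HahnSeries.C (Γ := Γ)).comp S.e.toRingHom with
      commutes' := fun c => by
        change HahnSeries.C (S.e (algebraMap k E c)) = _
        rw [AlgHom.commutes]; rfl }
  have hf : ∀ a, f a = HahnSeries.C (S.e a) := fun a => rfl
  let x : Fin r → HahnSeries Γ A := fun i => HahnSeries.single (S.b i) (S.z i : A)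
  obtain ⟨ψ, hψC, hψX⟩ := exists_twisted_lift (conj := conj) (cmt := cmt) f x
    (fun i a => by
      simp only [hf, x, HahnSeries.C_apply, HahnSeries.single_mul_single, add_zero, zero_add,
        hconj, Units.inv_mul_cancel_right])
    (fun i l => by
      simp only [hf, x, HahnSeries.C_apply, HahnSeries.single_mul_single, zero_add,
        hcmt, Units.inv_mul_cancel_right, add_comm (S.b l)])
  have hψinj : ∀ t, ψ t = 0 → t = 0 := by
    intro t ht
    obtain ⟨g, rfl⟩ := twistedPolyRing_normal_form t
    have : g = 0 := by
      apply S.finsupp_sum_single_eq_zero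
      rw [← ht, map_finsuppSum]
      refine Finsupp.sum_congr fun s _ => ?_
      rw [map_mul, map_list_prod, List.map_map]
      congr 1
      · exact (hψC _).symm
      · congr 1
        exact List.map_congr_left fun i _ => (hψX i).symm
    simp [this]
  have hmem : ∀ t, ψ t ∈ S.homogSubring := by
    intro t
    have h : Subring.closure (Set.range (twistedC (k := k) conj cmt) ∪
        Set.range (twistedX conj cmt)) ≤ S.homogSubring.comap ψ.toRingHom := by
      rw [Subring.closure_le]
      rintro _ (⟨a, rfl⟩ | ⟨i, rfl⟩)
      · rw [SetLike.mem_coe, Subring.mem_comap]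
        change ψ (twistedC conj cmt a) ∈ S.homogSubring
        rw [hψC, hf]
        exact single_mem_homogSubring (homog_e a)
      · rw [SetLike.mem_coe, Subring.mem_comap]
        change ψ (twistedX conj cmt i) ∈ S.homogSubring
        rw [hψX]
        exact single_mem_homogSubring (homog_z i)
    exact h (mem_closure_twisted t)
  have hu : ∀ c ∈ Subring.center (TwistedPolyRing k E r conj cmt), c ≠ 0 →
      IsUnit (ψ.toRingHom c) := by
    intro c hc h0
    rw [Subring.mem_center_iff] at hc
    obtain ⟨q, hq⟩ := mem_range_base_of_commute hgal (hmem c)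
      (fun a => by rw [← hf, ← hψC, ← map_mul, ← map_mul, hc])
      (fun i => by
        change _ * x i = x i * _
        rw [← hψX, ← map_mul, ← map_mul, hc])
    change IsUnit (ψ c)
    rw [← hq]
    refine IsUnit.map _ (IsUnit.mk0 q ?_)
    rintro rfl
    exact h0 (hψinj c (by rw [← hq, map_zero]))
  obtain ⟨j, hj⟩ := exists_extend_central_quotients φ.toRingHom hφinj hquot ψ.toRingHom hu
  have hj' : ∀ t, j (φ t) = ψ t := hj
  have hmemD : ∀ t, φ t ∈ Subring.closure (Set.range (φ.comp (twistedC (k := k) conj cmt) :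
      E →+* D) ∪ Set.range (fun i => φ (twistedX conj cmt i))) := by
    intro t
    have h : Subring.closure (Set.range (twistedC (k := k) conj cmt) ∪
        Set.range (twistedX conj cmt)) ≤ (Subring.closure (Set.range
          (φ.comp (twistedC (k := k) conj cmt) :
            E →+* D) ∪ Set.range (fun i => φ (twistedX conj cmt i)))).comap φ.toRingHom := by
      rw [Subring.closure_le]
      rintro _ (⟨a, rfl⟩ | ⟨i, rfl⟩)
      · exact Subring.subset_closure (Or.inl ⟨a, rfl⟩)
      · exact Subring.subset_closure (Or.inr ⟨i, rfl⟩)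
    exact h (mem_closure_twisted t)
  refine ⟨⟨j, (φ.comp (twistedC conj cmt) : E →+* D), fun i => φ (twistedX conj cmt i),
    fun a => (hj' _).trans (hψC a), fun i => (hj' _).trans (hψX i), fun d => ?_⟩, fun c => ?_⟩
  · obtain ⟨t, c, hc, h0, hd⟩ := hquot d
    refine ⟨φ t, hmemD t, φ c, hmemD c, ?_, h0, hd⟩
    rw [Subring.mem_center_iff] at hc ⊢
    have hcm : ∀ t, Commute (φ t) (φ c) := fun t => by
      rw [Commute, SemiconjBy, ← map_mul, ← map_mul, hc]
    intro d'
    obtain ⟨t', c', -, -, rfl⟩ := hquot d'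
    exact (hcm t').mul_left (hcm c').inv_left₀
  · change φ (twistedC conj cmt (algebraMap k E c)) = _
    rw [AlgHom.commutes, AlgHom.commutes]

end TignolData

end

section

namespace TignolData.Lift

variable {k E A Γ : Type u} [Field k] [DivisionRing E] [Algebra k E] [Ring A]
    [Algebra k A] [AddCommGroup Γ] {r : ℕ} {S : TignolData k E A Γ r}
    [LinearOrder Γ] [IsOrderedAddMonoid Γ] [Nontrivial A]
    {D : Type u} [DivisionRing D] (Λ : S.Lift D)

lemma exists_homog (m : Γ) : ∃ (d : D) (u : Aˣ), S.Homog m (u : A) ∧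
    Λ.j d = HahnSeries.single m (u : A) := by
  let M : AddSubgroup Γ :=
    { carrier := {m | ∃ (d : D) (u : Aˣ), S.Homog m (u : A) ∧
        Λ.j d = HahnSeries.single m (u : A)}
      zero_mem' := ⟨1, 1, by simpa using homog_e (S := S) 1, map_one _⟩
      add_mem' := by
        rintro m n ⟨d, u, hu, hd⟩ ⟨d', v, hv, hd'⟩
        exact ⟨d * d', u * v, by simpa using hu.mul hv, by
          rw [map_mul, hd, hd', HahnSeries.single_mul_single, Units.val_mul]⟩
      neg_mem' := by
        rintro m ⟨d, u, hu, hd⟩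
        refine ⟨d⁻¹, u⁻¹, hu.inv, ?_⟩
        have h0 : d ≠ 0 := by
          rintro rfl
          rw [map_zero, eq_comm, HahnSeries.single_eq_zero_iff] at hd
          exact u.ne_zero hd
        have h1 : Λ.j d * Λ.j d⁻¹ = 1 := by rw [← map_mul, mul_inv_cancel₀ h0, map_one]
        have h2 : HahnSeries.single (-m) ((u⁻¹ : Aˣ) : A) * Λ.j d = 1 := by
          rw [hd, HahnSeries.single_mul_single, neg_add_cancel, Units.inv_mul]; rfl
        exact (left_inv_eq_right_inv h2 h1).symm }
  exact S.mem_of_b_mem M (fun i => ⟨Λ.ξ i, S.z i, homog_z i, Λ.j_ξ i⟩) m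

/-- The polynomial elements of `D`. -/
def poly : Subring D := Subring.closure (Set.range Λ.ε ∪ Set.range Λ.ξ)

lemma j_mem_of_mem_poly {t : D} (ht : t ∈ Λ.poly) : Λ.j t ∈ S.homogSubring := by
  have h : Λ.poly ≤ S.homogSubring.comap Λ.j := by
    rw [poly, Subring.closure_le]
    rintro _ (⟨a, rfl⟩ | ⟨i, rfl⟩)
    · rw [SetLike.mem_coe, Subring.mem_comap, Λ.j_ε]
      exact single_mem_homogSubring (homog_e a)
    · rw [SetLike.mem_coe, Subring.mem_comap, Λ.j_ξ]
      exact single_mem_homogSubring (homog_z i)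
  exact h ht

lemma finite_support_of_mem_poly {t : D} (ht : t ∈ Λ.poly) : (Λ.j t).support.Finite := by
  have hs : ∀ (m : Γ) (a : A), (HahnSeries.single m a).support.Finite := fun m a =>
    (Set.finite_singleton m).subset HahnSeries.support_single_subset
  induction ht using Subring.closure_induction with
  | mem x hx =>
    rcases hx with ⟨a, rfl⟩ | ⟨i, rfl⟩
    · rw [Λ.j_ε]; exact hs _ _
    · rw [Λ.j_ξ]; exact hs _ _
  | zero => simp
  | one => rw [map_one]; exact hs _ _
  | add x y _ _ hx hy =>
    rw [map_add]
    exact (hx.union hy).subset (HahnSeries.support_add_subset _ _)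
  | neg x _ hx => rw [map_neg, HahnSeries.support_neg]; exact hx
  | mul x y _ _ hx hy =>
    rw [map_mul]
    exact (hx.add hy).subset HahnSeries.support_mul_subset

variable [FiniteDimensional k E]

lemma base_mem_homogSubring (q : HahnSeries S.N k) :
    S.base (algebraMap k A) q ∈ S.homogSubring := fun m => by
  by_cases hm : m ∈ S.N
  · rw [base_coeff _ q ⟨m, hm⟩]
    intro c
    rw [mem_N.mp hm, AlgEquiv.one_apply, Algebra.commutes]
  · rw [base_coeff_of_notMem _ _ hm]
    exact Homog.zero m

lemma j_mem_range_base_aux (hgal : IsGalois k (Subring.center E)) {c : D}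
    (hc : c ∈ Subring.center D) (hj : Λ.j c ∈ S.homogSubring) :
    Λ.j c ∈ (S.base (algebraMap k A)).range := by
  rw [Subring.mem_center_iff] at hc
  exact mem_range_base_of_commute hgal hj
    (fun a => by rw [← Λ.j_ε, ← map_mul, ← map_mul, hc])
    (fun i => by rw [← Λ.j_ξ, ← map_mul, ← map_mul, hc])

lemma j_mem (hgal : IsGalois k (Subring.center E)) (d : D) : Λ.j d ∈ S.homogSubring := by
  obtain ⟨t, ht, c, hc, hcc, h0, rfl⟩ := Λ.quot d
  rw [map_mul]
  refine mul_mem (Λ.j_mem_of_mem_poly ht) ?_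
  obtain ⟨q, hq⟩ := Λ.j_mem_range_base_aux hgal hcc (Λ.j_mem_of_mem_poly hc)
  have hq0 : q ≠ 0 := by
    rintro rfl
    rw [map_zero, eq_comm] at hq
    exact h0 ((map_eq_zero_iff _ Λ.j.injective).mp hq)
  have h1 : S.base (algebraMap k A) q⁻¹ * Λ.j c = 1 := by
    rw [← hq, ← map_mul, inv_mul_cancel₀ hq0, map_one]
  have h2 : Λ.j c * Λ.j c⁻¹ = 1 := by rw [← map_mul, mul_inv_cancel₀ h0, map_one]
  rw [← left_inv_eq_right_inv h1 h2]
  exact base_mem_homogSubring _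

lemma isUnit_leadingCoeff_j (hgal : IsGalois k (Subring.center E)) (d : D) (hd : d ≠ 0) :
    IsUnit (Λ.j d).leadingCoeff :=
  isUnit_leadingCoeff (Λ.j_mem hgal d) ((map_ne_zero_iff _ Λ.j.injective).mpr hd)

lemma exists_center_series (hgal : IsGalois k (Subring.center E)) :
    ∃ q : Subring.center D →+* HahnSeries S.N k,
      ∀ f, S.base (algebraMap k A) (q f) = Λ.j f := by
  choose q hq using fun f : Subring.center D => Λ.j_mem_range_base_aux hgal f.2 (Λ.j_mem hgal _)
  have hinj := base_injective (S := S) (algebraMap k A) (FaithfulSMul.algebraMap_injective k A)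
  refine ⟨⟨⟨⟨q, hinj ?_⟩, fun a b => hinj ?_⟩, hinj ?_, fun a b => hinj ?_⟩, hq⟩
  · rw [hq, map_one]; exact map_one _
  · change S.base _ (q (a * b)) = S.base _ (q a * q b)
    rw [map_mul, hq, hq, hq]; exact map_mul _ _ _
  · change S.base _ (q 0) = S.base _ 0
    rw [hq, map_zero]; exact map_zero _
  · change S.base _ (q (a + b)) = S.base _ (q a + q b)
    rw [map_add, hq, hq, hq]; exact map_add _ _ _

/-- Central elements of `D` as Hahn series over `k`. -/
def q (hgal : IsGalois k (Subring.center E)) : Subring.center D →+* HahnSeries S.N k :=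
  (Λ.exists_center_series hgal).choose

lemma base_q (hgal : IsGalois k (Subring.center E)) (f : Subring.center D) :
    S.base (algebraMap k A) (Λ.q hgal f) = Λ.j f :=
  (Λ.exists_center_series hgal).choose_spec f

lemma mem_center_of_j_single {d : D} {n : Γ} {c : k}
    (hd : Λ.j d = HahnSeries.single n (algebraMap k A c)) : d ∈ Subring.center D := by
  rw [Subring.mem_center_iff]
  intro x
  apply Λ.j.injective
  rw [map_mul, map_mul, hd]
  ext m
  have h : m = (m - n) + n := by abel
  rw [h, HahnSeries.coeff_mul_single_add, HahnSeries.coeff_single_mul_add, Algebra.commutes]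

lemma exists_q_eq_single (hgal : IsGalois k (Subring.center E)) (n : S.N) (c : k) :
    ∃ f : Subring.center D, Λ.q hgal f = HahnSeries.single n c := by
  obtain ⟨d, u, hu, hd⟩ := Λ.exists_homog n
  obtain ⟨x, hx⟩ := (homog_iff_mem_range n.2).mp hu
  have hx0 : x ≠ 0 := by
    rintro rfl
    rw [map_zero] at hx
    exact u.ne_zero hx.symm
  have hj : Λ.j (Λ.ε (algebraMap k E c * x⁻¹) * d) =
      HahnSeries.single (n : Γ) (algebraMap k A c) := by
    rw [map_mul, Λ.j_ε, hd, ← hx, HahnSeries.C_apply, HahnSeries.single_mul_single, zero_add,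
      ← map_mul, inv_mul_cancel_right₀ hx0, AlgHom.commutes]
  refine ⟨⟨_, Λ.mem_center_of_j_single hj⟩, ?_⟩
  apply base_injective (S := S) (algebraMap k A) (FaithfulSMul.algebraMap_injective k A)
  rw [base_q, base_single]
  exact hj

lemma q_injective (hgal : IsGalois k (Subring.center E)) : Function.Injective (Λ.q hgal) :=
  (Λ.q hgal).injective

/-- The central element `c yⁿ`. -/
def y (hgal : IsGalois k (Subring.center E)) (n : S.N) (c : k) : Subring.center D :=
  (Λ.exists_q_eq_single hgal n c).choose

lemma q_y (hgal : IsGalois k (Subring.center E)) (n : S.N) (c : k) :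
    Λ.q hgal (Λ.y hgal n c) = HahnSeries.single n c :=
  (Λ.exists_q_eq_single hgal n c).choose_spec

lemma y_mul (hgal : IsGalois k (Subring.center E)) (m n : S.N) (c c' : k) :
    Λ.y hgal m c * Λ.y hgal n c' = Λ.y hgal (m + n) (c * c') := by
  apply Λ.q_injective hgal
  rw [map_mul, q_y, q_y, q_y, HahnSeries.single_mul_single]

/-- The constants of the centre. -/
def κ (hgal : IsGalois k (Subring.center E)) : k →+* Subring.center D where
  toFun c := Λ.y hgal 0 c
  map_one' := Λ.q_injective hgal (by rw [q_y, map_one (Λ.q hgal)]; rfl)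
  map_zero' := Λ.q_injective hgal (by
    rw [q_y, map_zero (Λ.q hgal), map_zero])
  map_mul' a b := by rw [y_mul, add_zero]
  map_add' a b := Λ.q_injective hgal (by
    rw [map_add (Λ.q hgal), q_y, q_y, q_y]
    exact (HahnSeries.single.addMonoidHom (0 : S.N)).map_add a b)

lemma κ_eq (hgal : IsGalois k (Subring.center E)) (c : k) :
    (Λ.κ hgal c : D) = Λ.ε (algebraMap k E c) := by
  apply Λ.j.injective
  rw [← base_q, Λ.j_ε, AlgHom.commutes]
  change S.base _ (Λ.q hgal (Λ.y hgal 0 c)) = _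
  rw [q_y, base_single]
  rfl

/-- A central element is a quotient of finite sums of terms `c yⁿ`. -/
lemma center_eq_div (hgal : IsGalois k (Subring.center E)) (K : Subfield (Subring.center D))
    (hK : ∀ n c, Λ.y hgal n c ∈ K) (f : Subring.center D) : f ∈ K := by
  have key : ∀ t ∈ Λ.poly, ∀ ht : t ∈ Subring.center D, (⟨t, ht⟩ : Subring.center D) ∈ K := by
    intro t htp ht
    have hfin : (Λ.q hgal ⟨t, ht⟩).support.Finite := by
      refine Set.Finite.of_finite_image (f := ((↑) : S.N → Γ))
        ((Λ.finite_support_of_mem_poly htp).subset ?_) Subtype.val_injective.injOn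
      rintro _ ⟨n, hn, rfl⟩
      have := Λ.base_q hgal ⟨t, ht⟩
      rw [HahnSeries.mem_support, ← this, base_coeff]
      exact (map_ne_zero _).mpr hn
    have hsum : (⟨t, ht⟩ : Subring.center D) =
        ∑ n ∈ hfin.toFinset, Λ.y hgal n ((Λ.q hgal ⟨t, ht⟩).coeff n) := by
      apply Λ.q_injective hgal
      rw [map_sum]
      ext m
      simp only [q_y, HahnSeries.coeff_sum]
      by_cases hm : m ∈ hfin.toFinset
      · rw [Finset.sum_eq_single m]
        · simp
        · intro n _ hn
          exact HahnSeries.coeff_single_of_ne hn.symm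
        · exact fun h => absurd hm h
      · rw [Finset.sum_eq_zero]
        · simpa using hm
        · intro n hn
          exact HahnSeries.coeff_single_of_ne fun h => hm (h ▸ hn)
    rw [hsum]
    exact sum_mem fun n _ => hK _ _
  obtain ⟨t, ht, c, hc, hcc, h0, hf⟩ := Λ.quot f
  have hft : (f : D) * c = t := by rw [hf, inv_mul_cancel_right₀ h0]
  have htc : t ∈ Subring.center D := hft ▸ mul_mem f.2 hcc
  have h1 := key t ht htc
  have h2 := key c hc hcc
  have h3 : f = ⟨t, htc⟩ * (⟨c, hcc⟩ : Subring.center D)⁻¹ := by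
    rw [eq_mul_inv_iff_mul_eq₀ (fun h => h0 (congrArg Subtype.val h))]
    exact Subtype.ext hft
  rw [h3]
  exact mul_mem h1 (inv_mem h2)

end TignolData.Lift

end

section

namespace TignolData

/-- The exponents acting trivially form a free abelian group of full rank. -/
lemma nonempty_basis_N {k E A Γ : Type u} [Field k] [DivisionRing E] [Algebra k E] [Ring A]
    [Algebra k A] [AddCommGroup Γ] {r : ℕ} (S : TignolData k E A Γ r)
    [Finite (Subring.center E ≃ₐ[k] Subring.center E)] :
    Nonempty (Module.Basis (Fin r) ℤ S.N) := by
  haveI := Module.Free.of_basis S.b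
  haveI := Module.Finite.of_basis S.b
  let M : Submodule ℤ Γ := AddSubgroup.toIntSubmodule S.N
  have hfin : Finite (Γ ⧸ M) := by
    let g : Γ ⧸ M → (Subring.center E ≃ₐ[k] Subring.center E) :=
      fun x => S.s (Quotient.out x)
    refine Finite.of_injective g fun x y h => ?_
    rw [← Submodule.Quotient.mk_out x, ← Submodule.Quotient.mk_out y, Submodule.Quotient.eq]
    change S.s _ = 1
    rw [sub_eq_add_neg, S.s_add, S.s_neg, mul_inv_eq_one]
    exact h
  have hr : Module.finrank ℤ M = r := by
    rw [(Submodule.finiteQuotient_iff M).mp hfin, Module.finrank_eq_card_basis S.b,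
      Fintype.card_fin]
  exact ⟨Module.finBasisOfFinrankEq ℤ M hr⟩

end TignolData

lemma sum_smul_basis_injective {ι M : Type*} [AddCommGroup M] (b : Module.Basis ι ℤ M) :
    Function.Injective fun s : ι →₀ ℕ => s.sum fun i n => n • b i := by
  have h : ∀ s : ι →₀ ℕ, (s.sum fun i n => n • b i) =
      b.repr.symm (s.mapRange Nat.cast Nat.cast_zero) := by
    intro s
    rw [Module.Basis.repr_symm_apply, Finsupp.linearCombination_apply, Finsupp.sum_mapRange_index]
    · exact Finsupp.sum_congr fun i _ => (natCast_zsmul _ _).symm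
    · intro i; exact zero_smul _ _
  intro s t hst
  simp only [h] at hst
  exact Finsupp.mapRange_injective _ _ Nat.cast_injective (b.repr.symm.injective hst)

namespace TignolData.Lift

variable {k E A Γ : Type u} [Field k] [DivisionRing E] [Algebra k E] [Ring A]
    [Algebra k A] [AddCommGroup Γ] {r : ℕ} {S : TignolData k E A Γ r}
    [LinearOrder Γ] [IsOrderedAddMonoid Γ] [Nontrivial A]
    {D : Type u} [DivisionRing D] (Λ : S.Lift D) [FiniteDimensional k E]

lemma y_pow (hgal : IsGalois k (Subring.center E)) (n : S.N) (l : ℕ) :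
    Λ.y hgal n 1 ^ l = Λ.y hgal (l • n) 1 := by
  induction l with
  | zero => rw [pow_zero, zero_smul]; exact (map_one (Λ.κ hgal)).symm
  | succ l ih => rw [pow_succ, ih, y_mul, one_mul, succ_nsmul]

lemma κ_mul_y (hgal : IsGalois k (Subring.center E)) (n : S.N) (c c' : k) :
    Λ.κ hgal c * Λ.y hgal n c' = Λ.y hgal n (c * c') := by
  change Λ.y hgal 0 c * _ = _
  rw [y_mul, zero_add]

/-- Polynomials over `k` as central elements of `D`. -/
def polyMap (hgal : IsGalois k (Subring.center E)) (b : Module.Basis (Fin r) ℤ S.N) :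
    MvPolynomial (Fin r) k →+* Subring.center D :=
  MvPolynomial.eval₂Hom (Λ.κ hgal) fun i => Λ.y hgal (b i) 1

lemma polyMap_monomial (hgal : IsGalois k (Subring.center E)) (b : Module.Basis (Fin r) ℤ S.N)
    (s : Fin r →₀ ℕ) (c : k) :
    Λ.polyMap hgal b (MvPolynomial.monomial s c) =
      Λ.y hgal (s.sum fun i n => n • b i) c := by
  rw [polyMap, MvPolynomial.eval₂Hom_monomial]
  have h : (s.prod fun i n => Λ.y hgal (b i) 1 ^ n) =
      Λ.y hgal (s.sum fun i n => n • b i) 1 := by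
    rw [Finsupp.prod, Finsupp.sum]
    induction s.support using Finset.induction_on with
    | empty => exact (map_one (Λ.κ hgal)).symm
    | insert i t hi ih =>
      rw [Finset.prod_insert hi, Finset.sum_insert hi, ih, y_pow, y_mul, one_mul]
  rw [h, κ_mul_y, mul_one]

lemma polyMap_injective (hgal : IsGalois k (Subring.center E))
    (b : Module.Basis (Fin r) ℤ S.N) : Function.Injective (Λ.polyMap hgal b) := by
  rw [injective_iff_map_eq_zero]
  intro p hp
  ext s
  have h := congrArg (fun g => (Λ.q hgal g).coeff (s.sum fun i n => n • b i)) hp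
  have hq : Λ.q hgal (Λ.polyMap hgal b p) = ∑ t ∈ p.support,
      HahnSeries.single (t.sum fun i n => n • b i) (p.coeff t) := by
    conv_lhs => rw [p.as_sum]
    rw [map_sum, map_sum]
    exact Finset.sum_congr rfl fun t _ => by rw [polyMap_monomial, q_y]
  simp only [hq, map_zero (Λ.q hgal), HahnSeries.coeff_sum, HahnSeries.coeff_zero] at h
  rw [MvPolynomial.coeff_zero, ← h, Finset.sum_eq_single s]
  · rw [HahnSeries.coeff_single_same]
  · intro t _ hts
    rw [HahnSeries.coeff_single_of_ne]
    exact fun h => hts (sum_smul_basis_injective b h).symm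
  · intro hs
    rw [MvPolynomial.notMem_support_iff.mp hs]
    simp

/-- The centre of `D` is a rational function field. -/
lemma exists_iso (hgal : IsGalois k (Subring.center E)) :
    ∃ iso : Subring.center D ≃+* FractionRing (MvPolynomial (Fin r) k),
      ∀ c : k, iso (Λ.κ hgal c) = algebraMap (MvPolynomial (Fin r) k)
        (FractionRing (MvPolynomial (Fin r) k)) (MvPolynomial.C c) := by
  haveI := finiteDimensional_center k E
  obtain ⟨b⟩ := S.nonempty_basis_N
  let θ : FractionRing (MvPolynomial (Fin r) k) →+* Subring.center D :=
    IsFractionRing.lift (Λ.polyMap_injective hgal b)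
  have hθ : ∀ p, θ (algebraMap _ _ p) = Λ.polyMap hgal b p :=
    fun p => IsFractionRing.lift_algebraMap (Λ.polyMap_injective hgal b) p
  have hκ : ∀ c, θ (algebraMap _ _ (MvPolynomial.C c)) = Λ.κ hgal c := fun c => by
    rw [hθ, polyMap, MvPolynomial.eval₂Hom_C]
  have hy : ∀ n : S.N, Λ.y hgal n 1 ∈ θ.fieldRange := by
    let M : AddSubgroup S.N :=
      { carrier := {n | Λ.y hgal n 1 ∈ θ.fieldRange}
        zero_mem' := by
          change Λ.κ hgal 1 ∈ θ.fieldRange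
          rw [map_one]
          exact one_mem _
        add_mem' := by
          intro m n (hm : _ ∈ θ.fieldRange) (hn : _ ∈ θ.fieldRange)
          have : _ ∈ θ.fieldRange := mul_mem hm hn
          rw [y_mul, one_mul] at this
          exact this
        neg_mem' := by
          intro n (hn : _ ∈ θ.fieldRange)
          have h1 : Λ.y hgal (-n) 1 * Λ.y hgal n 1 = 1 := by
            rw [y_mul, neg_add_cancel, one_mul]
            exact map_one (Λ.κ hgal)
          have h2 := inv_mem hn
          rw [← eq_inv_of_mul_eq_one_left h1] at h2
          exact h2 }
    have h1 : Submodule.span ℤ (Set.range b) ≤ M.toIntSubmodule := by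
      rw [Submodule.span_le]
      rintro _ ⟨i, rfl⟩
      refine ⟨algebraMap (MvPolynomial (Fin r) k) _ (MvPolynomial.X i), ?_⟩
      rw [hθ, polyMap, MvPolynomial.eval₂Hom_X']
    rw [b.span_eq] at h1
    exact fun n => h1 (Submodule.mem_top (x := n))
  have hsurj : Function.Surjective θ := fun f =>
    Λ.center_eq_div hgal θ.fieldRange (fun n c => by
      rw [← mul_one c, ← κ_mul_y, ← hκ]
      exact mul_mem ⟨_, rfl⟩ (hy n)) f
  let Θ := RingEquiv.ofBijective θ ⟨θ.injective, hsurj⟩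
  refine ⟨Θ.symm, fun c => ?_⟩
  rw [← hκ]
  exact Θ.symm_apply_apply _

end TignolData.Lift

end

section

lemma separableVia_algebraMap (k : Type u) (K : Type v) [Field k] [Field K] [i : Algebra k K]
    [h : Algebra.IsSeparable k K] : SeparableVia k K (algebraMap k K) := by
  have : (algebraMap k K).toAlgebra = i := Algebra.algebra_ext _ _ fun _ => rfl
  rw [SeparableVia, this]
  exact h

/-- A field of Hahn series over `k` has an unramified extension into which the separable
extension `K` of `k` embeds. -/
lemma exists_unramified_extension {F k K R Γ : Type u} [Field F] [Field k] [Field K] [Algebra k K]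
    [Algebra.IsSeparable k K] [Ring R] [Nontrivial R] [Algebra k R] [AddCommGroup Γ]
    [LinearOrder Γ] [IsOrderedAddMonoid Γ] (p' : F →+* HahnSeries Γ R)
    (hp' : ∀ f, f ≠ 0 → IsUnit (p' f).leadingCoeff) (p : F →+* HahnSeries Γ K)
    (hpp : ∀ f m, ∃ c : k, (p' f).coeff m = algebraMap k R c ∧ (p f).coeff m = algebraMap k K c)
    (κ : k →+* F) (hκ : ∀ c, p (κ c) = HahnSeries.C (algebraMap k K c))
    (M : Subfield (HahnSeries Γ K)) (hM : ∀ f, p f ∈ M) (hC : ∀ x, HahnSeries.C x ∈ M)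
    (hy : ∀ g ∈ M, g ≠ 0 → ∃ f, f ≠ 0 ∧ g.order = (p f).order) :
    ∃ (L : Type u) (_ : Field L) (_ : Algebra F L) (w : Valuation L (WithZero (Multiplicative Γ)))
      (hext : ∀ x, w (algebraMap F L x) = hahnVal p' hp' x),
      Algebra.IsAlgebraic F L ∧
      (∀ y : L, y ≠ 0 → ∃ x : F, x ≠ 0 ∧ w y = hahnVal p' hp' x) ∧
      (∃ (RF : ResidueFieldData.{u} (hahnVal p' hp')) (RL : ResidueFieldData.{u} w)
        (ι : RF.k →+* RL.k), ResidueCompatFields hext RF RL ι ∧ SeparableVia RF.k RL.k ι) ∧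
      ∃ μ : K →+* L, ∀ c, μ (algebraMap k K c) = algebraMap F L (κ c) := by
  have hR := FaithfulSMul.algebraMap_injective k R
  have hK := FaithfulSMul.algebraMap_injective k K
  have hzero : ∀ f m, (p' f).coeff m = 0 ↔ (p f).coeff m = 0 := by
    intro f m
    obtain ⟨c, h1, h2⟩ := hpp f m
    rw [h1, h2, map_eq_zero_iff _ hR, map_eq_zero_iff _ hK]
  have hord : ∀ f, (p' f).order = (p f).order := fun f => hahn_order_eq_of_support_eq (hzero f)
  have hcoeff : ∀ f m (c : k), (p' f).coeff m = algebraMap k R c ↔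
      (p f).coeff m = algebraMap k K c := by
    intro f m c
    obtain ⟨c', h1, h2⟩ := hpp f m
    rw [h1, h2, hR.eq_iff, hK.eq_iff]
  letI : Algebra F (HahnSeries Γ K) := p.toAlgebra
  have halg : ∀ f, algebraMap F (HahnSeries Γ K) f = p f := fun _ => rfl
  let L : IntermediateField F (HahnSeries Γ K) :=
    IntermediateField.adjoin F (Set.range (HahnSeries.C : K →+* HahnSeries Γ K))
  have hCL : ∀ x : K, HahnSeries.C x ∈ L := fun x =>
    IntermediateField.subset_adjoin F _ ⟨x, rfl⟩
  have hLM : ∀ g ∈ L, g ∈ M := by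
    have : L ≤ M.toIntermediateField hM :=
      IntermediateField.adjoin_le_iff.mpr (by rintro _ ⟨x, rfl⟩; exact hC x)
    exact this
  let jL : L →+* HahnSeries Γ K := L.val
  have hjL : ∀ y, y ≠ 0 → IsUnit (jL y).leadingCoeff := fun y h0 =>
    (HahnSeries.leadingCoeff_ne_zero.mpr
      ((map_ne_zero_iff jL jL.injective).mpr h0)).isUnit
  have hjLalg : ∀ f, jL (algebraMap F L f) = p f := fun _ => rfl
  have hext : ∀ x, hahnVal jL hjL (algebraMap F L x) = hahnVal p' hp' x := by
    intro x
    by_cases hx : x = 0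
    · simp [hx]
    rw [hahnVal_apply _ _ hx, hahnVal_apply _ _ ((map_ne_zero _).mpr hx), hjLalg, hord]
  obtain ⟨πF, hπF, hkerF, hF⟩ := hahnVal_exists_residue p' hp' (algebraMap k R) hR
    (fun f _ => (hpp f 0).imp fun _ h => h.1.symm)
    (fun c => by
      refine ⟨κ c, (hahnVal_le_one_iff _ _ _).mpr fun m hm => ?_, ?_⟩
      · rw [hzero, hκ, HahnSeries.C_apply, HahnSeries.coeff_single_of_ne hm.ne]
      · rw [hcoeff, hκ, HahnSeries.C_apply, HahnSeries.coeff_single_same])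
  obtain ⟨πL, hπL, hkerL, hL⟩ := hahnVal_exists_residue jL hjL (RingHom.id K)
    Function.injective_id (fun f _ => ⟨_, rfl⟩)
    (fun x => by
      refine ⟨⟨HahnSeries.C x, hCL x⟩, (hahnVal_le_one_iff _ _ _).mpr fun m hm => ?_, ?_⟩
      · exact HahnSeries.coeff_single_of_ne hm.ne
      · exact HahnSeries.coeff_single_same _ _)
  refine ⟨L, inferInstance, inferInstance, hahnVal jL hjL, hext, ?_, ?_,
    ⟨⟨k, πF, hπF, hkerF⟩, ⟨K, πL, hπL, hkerL⟩, algebraMap k K, ?_,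
      separableVia_algebraMap k K⟩, ?_⟩
  · refine IntermediateField.isAlgebraic_adjoin ?_
    rintro _ ⟨x, rfl⟩
    refine IsIntegral.map_of_comp_eq κ (HahnSeries.C : K →+* HahnSeries Γ K) ?_
      (Algebra.IsIntegral.isIntegral (R := k) x)
    ext1 c
    exact hκ c
  · intro y hy0
    obtain ⟨f, hf, ho⟩ := hy _ (hLM _ y.2) ((map_ne_zero_iff jL jL.injective).mpr hy0)
    refine ⟨f, hf, ?_⟩
    rw [hahnVal_apply _ _ hf, hahnVal_apply _ _ hy0, hord]
    exact congrArg (fun g => WithZero.exp (-g)) ho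
  · intro x hx
    have h1 := hF ⟨x, (Valuation.mem_integer_iff _ x).mpr hx⟩
    have h2 := hL ⟨algebraMap F L x, by rw [Valuation.mem_integer_iff, hext]; exact hx⟩
    rw [eq_comm, hcoeff] at h1
    exact h1.symm.trans h2.symm
  · refine ⟨(HahnSeries.C : K →+* HahnSeries Γ K).codRestrict L hCL, fun c => ?_⟩
    exact Subtype.ext (hκ c).symm

end

section

instance isCentral_subringCenter (D : Type u) [DivisionRing D] :
    Algebra.IsCentral (Subring.center D) D :=
  ⟨fun x hx => ⟨⟨x, Subring.mem_center_iff.mpr (Subalgebra.mem_center_iff.mp hx)⟩, rfl⟩⟩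

/-- A division algebra over `k` with separable centre is represented by matrices over a separably
closed extension of `k` of size its degree. -/
lemma exists_matrix_representation (k E K : Type u) [Field k] [DivisionRing E] [Algebra k E]
    [FiniteDimensional k E] [Algebra.IsSeparable k (Subring.center E)] [Field K] [Algebra k K]
    [IsSepClosed K] :
    ∃ (d : ℕ) (_ : NeZero d) (ρ : E →+* Matrix (Fin d) (Fin d) K),
      (∀ c, ρ (algebraMap k E c) = algebraMap K _ (algebraMap k K c)) ∧
      Module.finrank k E = Module.finrank k (Subring.center E) * d ^ 2 := by
  let f : Subring.center E →ₐ[k] K := IsSepClosed.lift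
  letI : Algebra (Subring.center E) K := f.toRingHom.toAlgebra
  haveI : IsScalarTower k (Subring.center E) E := IsScalarTower.of_algebraMap_eq fun _ => rfl
  haveI : FiniteDimensional (Subring.center E) E := FiniteDimensional.right k _ E
  haveI : FiniteDimensional K (K ⊗[Subring.center E] E) := inferInstance
  haveI : IsSimpleRing (K ⊗[Subring.center E] E) := isSimpleRing_tensor
  haveI : Algebra.IsCentral K (K ⊗[Subring.center E] E) := isCentral_tensor
  obtain ⟨d, hd, ⟨g⟩⟩ := exists_algEquiv_matrix_of_isSepClosed K (K ⊗[Subring.center E] E)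
  refine ⟨d, hd, (g.toAlgHom.toRingHom).comp
    (Algebra.TensorProduct.includeRight :
      E →ₐ[Subring.center E] K ⊗[Subring.center E] E).toRingHom, fun c => ?_, ?_⟩
  · change g (Algebra.TensorProduct.includeRight
      (algebraMap (Subring.center E) E (algebraMap k (Subring.center E) c))) = _
    rw [AlgHom.commutes, IsScalarTower.algebraMap_apply (Subring.center E) K, AlgEquiv.commutes]
    exact congrArg _ (f.commutes c)
  · have h := g.toLinearEquiv.finrank_eq
    rw [Module.finrank_baseChange, Module.finrank_matrix, Module.finrank_self, Fintype.card_fin,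
      mul_one] at h
    rw [← Module.finrank_mul_finrank k (Subring.center E) E, h, sq]

end

section

namespace TignolData.Lift

variable {k E A Γ : Type u} [Field k] [DivisionRing E] [Algebra k E] [Ring A]
    [Algebra k A] [AddCommGroup Γ] {r : ℕ} {S : TignolData k E A Γ r}
    [LinearOrder Γ] [IsOrderedAddMonoid Γ] [Nontrivial A]
    {D : Type u} [DivisionRing D] (Λ : S.Lift D) [FiniteDimensional k E]

/-- A basis of `E` over `k` remains independent over the centre of `D`. -/
lemma eq_zero_of_sum_center_mul_ε (hgal : IsGalois k (Subring.center E)) {ι : Type*} [Fintype ι]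
    {b : ι → E} (hb : LinearIndependent k b) (c : ι → Subring.center D)
    (h : ∑ i, (c i : D) * Λ.ε (b i) = 0) : c = 0 := by
  funext i
  apply Λ.q_injective hgal
  rw [Pi.zero_apply, map_zero (Λ.q hgal)]
  ext m
  have h1 := congrArg (fun g => (Λ.j g).coeff m) h
  simp only [map_sum, map_mul, ← Λ.base_q hgal, Λ.j_ε, HahnSeries.coeff_sum, map_zero,
    HahnSeries.coeff_zero, HahnSeries.C_apply, HahnSeries.coeff_mul_single_zero, base_coeff] at h1
  have h2 : S.e (∑ i, (Λ.q hgal (c i)).coeff m • b i) = S.e 0 := by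
    rw [map_zero, ← h1, map_sum]
    exact Finset.sum_congr rfl fun i _ => by rw [map_smul, Algebra.smul_def]
  exact Fintype.linearIndependent_iff.mp hb _ (S.e_injective h2) i

/-- `D` is spanned by homogeneous elements representing the Galois group of the centre of `E`. -/
lemma exists_spanning (hgal : IsGalois k (Subring.center E))
    [Fintype (Subring.center E ≃ₐ[k] Subring.center E)] :
    ∃ t : (Subring.center E ≃ₐ[k] Subring.center E) → D,
      ∀ V : AddSubgroup D,
        (∀ g x (c : Subring.center D), (c : D) * Λ.ε x * t g ∈ V) →
        (∀ (c : Subring.center D), ∀ d ∈ V, (c : D) * d ∈ V) → V = ⊤ := by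
  choose m hm using S.s_surjective
  choose t u hu ht using fun g => Λ.exists_homog (m g)
  refine ⟨t, fun V hV hc => eq_top_iff.mpr fun d _ => ?_⟩
  have hpoly : ∀ p ∈ Λ.poly, p ∈ V := by
    intro p hp
    have hfin := Λ.finite_support_of_mem_poly hp
    have hterm : ∀ n : Γ, ∃ v ∈ V, Λ.j v = HahnSeries.single n ((Λ.j p).coeff n) := by
      intro n
      have hn : n - m (S.s n) ∈ S.N := by
        rw [mem_N, sub_eq_add_neg, S.s_add, S.s_neg, hm, mul_inv_cancel]
      obtain ⟨x, hx⟩ := (Λ.j_mem_of_mem_poly hp n).exists_e_mul (hu (S.s n)) (hm _).symm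
      refine ⟨Λ.y hgal ⟨_, hn⟩ 1 * Λ.ε x * t (S.s n), hV _ _ _, ?_⟩
      rw [map_mul, map_mul, ← Λ.base_q hgal, q_y, base_single, Λ.j_ε, ht, HahnSeries.C_apply,
        HahnSeries.single_mul_single, HahnSeries.single_mul_single, map_one, one_mul, add_zero,
        sub_add_cancel, hx]
    choose v hv hjv using hterm
    have hsum : p = ∑ n ∈ hfin.toFinset, v n := by
      apply Λ.j.injective
      rw [map_sum]
      ext l
      simp only [hjv, HahnSeries.coeff_sum]
      by_cases hl : l ∈ hfin.toFinset
      · rw [Finset.sum_eq_single l]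
        · simp
        · intro n _ hn
          exact HahnSeries.coeff_single_of_ne hn.symm
        · exact fun h => absurd hl h
      · rw [Finset.sum_eq_zero]
        · simpa using hl
        · intro n hn
          exact HahnSeries.coeff_single_of_ne fun h => hl (h ▸ hn)
    rw [hsum]
    exact sum_mem fun n _ => hv n
  obtain ⟨p, hp, c, -, hcc, -, rfl⟩ := Λ.quot d
  have hci : c⁻¹ ∈ Subring.center D := Set.inv_mem_center hcc
  rw [Subring.mem_center_iff.mp hci p]
  exact hc ⟨_, hci⟩ _ (hpoly p hp)

/-- `D` is split by every field containing its centre and a separable closure of `k`. -/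
lemma exists_splitting (hgal : IsGalois k (Subring.center E)) {K : Type u} {L : Type*} [Field K]
    [Algebra k K] [IsSepClosed K] [Field L] [Algebra (Subring.center D) L] (μ : K →+* L)
    (hμ : ∀ c, μ (algebraMap k K c) = algebraMap (Subring.center D) L (Λ.κ hgal c)) :
    FiniteDimensional (Subring.center D) D ∧
      ∃ n : ℕ, 0 < n ∧
        Nonempty ((L ⊗[Subring.center D] D) ≃ₐ[L] Matrix (Fin n) (Fin n) L) := by
  classical
  haveI := finiteDimensional_center k E
  haveI : Fintype (Subring.center E ≃ₐ[k] Subring.center E) := Fintype.ofFinite _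
  letI : Algebra k (Subring.center D) := (Λ.κ hgal).toAlgebra
  letI : Algebra k D := ((algebraMap (Subring.center D) D).comp (Λ.κ hgal)).toAlgebra'
    fun c x => (Subring.mem_center_iff.mp (Λ.κ hgal c).2 x).symm
  haveI : IsScalarTower k (Subring.center D) D := IsScalarTower.of_algebraMap_eq fun _ => rfl
  letI : Algebra k L := ((algebraMap (Subring.center D) L).comp (Λ.κ hgal)).toAlgebra
  haveI : IsScalarTower k (Subring.center D) L := IsScalarTower.of_algebraMap_eq fun _ => rfl
  let εk : E →ₐ[k] D := { Λ.ε with commutes' := fun c => (Λ.κ_eq hgal c).symm }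
  let i : (Subring.center D ⊗[k] E) →ₐ[Subring.center D] D :=
    Algebra.TensorProduct.lift (Algebra.ofId _ D) εk fun c x => Algebra.commutes c (εk x)
  have hi : ∀ (c : Subring.center D) x, i (c ⊗ₜ x) = c * Λ.ε x := fun c x => by
    exact Algebra.TensorProduct.lift_tmul _ _ _ c x
  have hinj : Function.Injective i := by
    rw [injective_iff_map_eq_zero]
    intro x hx
    let b := Module.finBasis k E
    let b' := Algebra.TensorProduct.basis (Subring.center D) b
    have h1 : ∑ l, (b'.repr x l : D) * Λ.ε (b l) = 0 := by
      rw [← hx]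
      conv_rhs => rw [← b'.sum_repr x, map_sum]
      refine Finset.sum_congr rfl fun l _ => ?_
      rw [map_smul, Algebra.TensorProduct.basis_apply, hi, Algebra.smul_def]
      simp [Algebra.algebraMap_eq_smul_one]
      rfl
    have h2 := Λ.eq_zero_of_sum_center_mul_ε hgal b.linearIndependent _ h1
    apply b'.repr.injective
    rw [map_zero]
    ext l
    exact congrArg Subtype.val (congrFun h2 l)
  haveI : IsDomain (Subring.center D ⊗[k] E) := hinj.isDomain i.toRingHom
  letI : DivisionRing (Subring.center D ⊗[k] E) :=
    divisionRingOfFiniteDimensional (Subring.center D) _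
  obtain ⟨d, hd, ρE, hρE, hdim⟩ := exists_matrix_representation k E K
  let ρk : E →ₐ[k] Matrix (Fin d) (Fin d) L :=
    { μ.mapMatrix.comp ρE with
      commutes' := fun c => by
        change μ.mapMatrix (ρE _) = _
        rw [hρE, Matrix.algebraMap_eq_diagonal, Matrix.algebraMap_eq_diagonal,
          RingHom.mapMatrix_apply, Matrix.diagonal_map (map_zero μ)]
        congr 1
        funext _
        exact hμ c }
  let ρ' : (Subring.center D ⊗[k] E) →ₐ[Subring.center D] Matrix (Fin d) (Fin d) L :=
    Algebra.TensorProduct.lift (Algebra.ofId _ _) ρk fun c x => Algebra.commutes c (ρk x)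
  let ρ : (Subring.center D ⊗[k] E) →+* Module.End L (Fin d → L) :=
    (Matrix.toLinAlgEquiv' : Matrix (Fin d) (Fin d) L ≃ₐ[L] _).toAlgHom.toRingHom.comp ρ'.toRingHom
  obtain ⟨t, ht⟩ := Λ.exists_spanning hgal
  refine exists_splitting_of_action i ρ ?_ t ?_ ?_
  · intro a w
    change Matrix.toLinAlgEquiv' (ρ' _) w = _
    rw [AlgHom.commutes, IsScalarTower.algebraMap_apply (Subring.center D) L, AlgEquiv.commutes]
    rfl
  · let V : AddSubgroup D :=
      { carrier := {d | ∃ c : (Subring.center E ≃ₐ[k] Subring.center E) →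
          Subring.center D ⊗[k] E, d = ∑ g, i (c g) * t g}
        zero_mem' := ⟨0, by simp⟩
        add_mem' := by
          rintro _ _ ⟨c, rfl⟩ ⟨c', rfl⟩
          exact ⟨c + c', by simp [add_mul, Finset.sum_add_distrib]⟩
        neg_mem' := by
          rintro _ ⟨c, rfl⟩
          exact ⟨-c, by simp⟩ }
    have hV : V = ⊤ := by
      refine ht V (fun g x c => ⟨Pi.single g (c ⊗ₜ x), ?_⟩) ?_
      · rw [Finset.sum_eq_single g]
        · rw [Pi.single_eq_same, hi]
        · intro g' _ hg
          rw [Pi.single_eq_of_ne hg, map_zero, zero_mul]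
        · exact fun h => absurd (Finset.mem_univ g) h
      · rintro c _ ⟨f, rfl⟩
        refine ⟨c • f, ?_⟩
        rw [Finset.mul_sum]
        refine Finset.sum_congr rfl fun g _ => ?_
        rw [Pi.smul_apply, map_smul, Algebra.smul_def, mul_assoc]
        rfl
    intro d
    exact (hV ▸ AddSubgroup.mem_top d : d ∈ V)
  · rw [Module.finrank_fin_fun, Module.finrank_baseChange, hdim, Fintype.card_eq_nat_card,
      IsGalois.card_aut_eq_finrank]

end TignolData.Lift

end

section

namespace TignolData.Lift

variable {k E A Γ : Type u} [Field k] [DivisionRing E] [Algebra k E] [Ring A]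
    [Algebra k A] [AddCommGroup Γ] {r : ℕ} {S : TignolData k E A Γ r}
    [LinearOrder Γ] [IsOrderedAddMonoid Γ] [Nontrivial A]
    {D : Type u} [DivisionRing D] (Λ : S.Lift D) [FiniteDimensional k E]

lemma inertiallySplit (hgal : IsGalois k (Subring.center E))
    (hp' : ∀ f, f ≠ 0 → IsUnit ((Λ.j.comp (Subring.center D).subtype) f).leadingCoeff) :
    FiniteDimensional (Subring.center D) D ∧
      IsInertiallySplit (Subring.center D) D
        (hahnVal (Λ.j.comp (Subring.center D).subtype) hp') := by
  let K := SeparableClosure k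
  have hkK := FaithfulSMul.algebraMap_injective k K
  let p : Subring.center D →+* HahnSeries Γ K := (S.base (algebraMap k K)).comp (Λ.q hgal)
  let M : Subfield (HahnSeries Γ K) := (S.base (RingHom.id K)).fieldRange
  have hp : ∀ f, p f = S.base (algebraMap k K) (Λ.q hgal f) := fun _ => rfl
  have hpN : ∀ f, ∀ m ∉ S.N, (p f).coeff m = 0 := fun f m hm => base_coeff_of_notMem _ _ hm
  obtain ⟨L, iL, iFL, w, hext, halg, hval, hres, μ, hμ⟩ := exists_unramified_extension
    (Λ.j.comp (Subring.center D).subtype) hp' p (fun f m => by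
      change ∃ c, (Λ.j f).coeff m = _ ∧ _
      rw [← Λ.base_q hgal, hp]
      by_cases hm : m ∈ S.N
      · exact ⟨_, base_coeff _ _ ⟨m, hm⟩, base_coeff _ _ ⟨m, hm⟩⟩
      · refine ⟨0, ?_, ?_⟩
        · rw [base_coeff_of_notMem _ _ hm, map_zero]
        · rw [base_coeff_of_notMem _ _ hm, map_zero])
    (Λ.κ hgal) (fun c => by
      rw [hp]
      change S.base _ (Λ.q hgal (Λ.y hgal 0 c)) = _
      rw [q_y, base_single]
      rfl) M
    (fun f => mem_range_base (f := RingHom.id K) Function.injective_id (fun m => ⟨_, rfl⟩) (hpN f))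
    (fun x => ⟨HahnSeries.single 0 x, base_single _ _ _⟩)
    (by
      rintro _ ⟨q, rfl⟩ h0
      have hN : (S.base (RingHom.id K) q).order ∈ S.N := by
        by_contra h
        exact h0 (HahnSeries.coeff_order_eq_zero.mp (base_coeff_of_notMem _ _ h))
      refine ⟨Λ.y hgal ⟨_, hN⟩ 1, ?_, ?_⟩
      · intro h
        have h1 := congrArg (Λ.q hgal) h
        rw [q_y, map_zero (Λ.q hgal), HahnSeries.single_eq_zero_iff] at h1
        exact one_ne_zero h1
      · rw [hp, q_y, base_single, map_one, HahnSeries.order_single one_ne_zero])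
  obtain ⟨hfin, hsplit⟩ := Λ.exists_splitting hgal μ hμ
  exact ⟨hfin, ⟨⟨L, w, hext, halg, hval, hres, hsplit⟩⟩⟩

lemma nonempty_centralLiftWitness [Algebra k D] (hgal : IsGalois k (Subring.center E))
    (hε : ∀ c : k, Λ.ε (algebraMap k E c) = algebraMap k D c) :
    Nonempty (CentralLiftWitness k D E) := by
  have hw := Λ.isUnit_leadingCoeff_j hgal
  have hp' : ∀ f, f ≠ 0 → IsUnit ((Λ.j.comp (Subring.center D).subtype) f).leadingCoeff :=
    fun f hf => hw f fun h => hf (Subtype.ext h)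
  obtain ⟨hfin, hsplit⟩ := Λ.inertiallySplit hgal hp'
  have hle1 : ∀ x, hahnVal Λ.j hw (Λ.ε x) ≤ 1 := fun x =>
    (hahnVal_le_one_iff _ _ _).mpr fun m hm => by
      rw [Λ.j_ε, HahnSeries.C_apply, HahnSeries.coeff_single_of_ne hm.ne]
  have hcoeff : ∀ x, (Λ.j (Λ.ε x)).coeff 0 = S.e x := fun x => by
    rw [Λ.j_ε, HahnSeries.C_apply, HahnSeries.coeff_single_same]
  obtain ⟨π, hπ, hker, hj⟩ := hahnVal_exists_residue Λ.j hw S.e.toRingHom S.e_injective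
    (fun d _ => (homog_iff_mem_range S.s_zero).mp (Λ.j_mem hgal d 0))
    (fun x => ⟨Λ.ε x, hle1 x, hcoeff x⟩)
  refine ⟨⟨WithZero (Multiplicative Γ), hahnVal (Λ.j.comp (Subring.center D).subtype) hp',
    hahnVal Λ.j hw, fun x => ?_, hfin, hsplit, ⟨E, π, hπ, hker⟩, RingEquiv.refl E, ?_⟩⟩
  · by_cases hx : x = 0
    · subst hx
      rw [map_zero]
      exact map_zero _
    · rw [hahnVal_apply _ _ hx, hahnVal_apply _ _ fun h => hx (Subtype.ext h)]
      rfl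
  · intro c h
    refine S.e_injective ((hj _).trans ?_)
    change (Λ.j (algebraMap k D c)).coeff 0 = _
    rw [← hε, hcoeff]

end TignolData.Lift

/-- An action of a free abelian group through given commuting automorphisms. -/
lemma exists_monoidHom_of_basis {G Γ : Type*} [Group G] (hG : ∀ σ τ : G, σ * τ = τ * σ)
    [AddCommGroup Γ] {r : ℕ} (b : Module.Basis (Fin r) ℤ Γ) (σ : Fin r → G) :
    ∃ s : Γ → G, (∀ m n, s (m + n) = s m * s n) ∧ ∀ i, s (b i) = σ i := by
  letI : CommGroup G := { ‹Group G› with mul_comm := hG }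
  let f : Γ →ₗ[ℤ] Additive G := b.constr ℤ fun i => Additive.ofMul (σ i)
  exact ⟨fun m => (f m).toMul, fun m n => congrArg Additive.toMul (map_add f m n),
    fun i => congrArg Additive.toMul (b.constr_basis ℤ _ i)⟩

/-- There are ordered free abelian groups of every finite rank. -/
lemma exists_ordered_free_group (r : ℕ) : ∃ (Γ : Type u) (_ : AddCommGroup Γ) (_ : LinearOrder Γ)
    (_ : IsOrderedAddMonoid Γ), Nonempty (Module.Basis (Fin r) ℤ Γ) :=
  ⟨Lex (ULift.{u} (Fin r) → ℤ), inferInstance, inferInstance, inferInstance,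
    ⟨((Pi.basisFun ℤ (ULift.{u} (Fin r))).map
      (LinearEquiv.refl ℤ (ULift.{u} (Fin r) → ℤ) : _ ≃ₗ[ℤ] Lex (ULift.{u} (Fin r) → ℤ))).reindex
        Equiv.ulift⟩⟩

end

set_option synthInstance.maxHeartbeats 1000000 in
set_option maxHeartbeats 2000000 in
/-- **Theorem 5 (Tignol's construction).**  Let `E` be a finite-dimensional division
algebra over `F̄ = k` with `Z(E)/F̄` abelian Galois, embedded into a central simple
`F̄`-algebra `A` as the centralizer of `Z(E)`.  Choose a minimal generating set
`σ₁,…,σ_r` of `Gal(Z(E)/F̄)` and units `z_i ∈ A*` inducing `σ_i` on `Z(E)` by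
conjugation.  If `D` is the ring of central quotients of the twisted polynomial ring
`E[x₁,…,x_r; z]`, then `D` is an `F`-central lift of `E`, where `F = Z(D)` is
isomorphic to the rational function field `F̄(t₁,…,t_r)`. -/
theorem statement_9 (k : Type u) [Field k]
    (E : Type u) [DivisionRing E] [Algebra k E] [FiniteDimensional k E]
    (hZgal : IsGalois k (Subring.center E))
    (hZab : ∀ σ τ : (Subring.center E ≃ₐ[k] Subring.center E), σ * τ = τ * σ)
    (A : Type u) [Ring A] [Algebra k A] [FiniteDimensional k A]
    [Algebra.IsCentral k A] [IsSimpleRing A]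
    (e : E →ₐ[k] A) (he : Function.Injective e)
    (hcentralizer : e.range = Subalgebra.centralizer k (e '' (Subring.center E : Set E)))
    (r : ℕ) (σ : Fin r → (Subring.center E ≃ₐ[k] Subring.center E))
    (hgen : Subgroup.closure (Set.range σ) = ⊤)
    (hminimal : ∀ (r' : ℕ) (τ : Fin r' → (Subring.center E ≃ₐ[k] Subring.center E)),
      Subgroup.closure (Set.range τ) = ⊤ → r ≤ r')
    (z : Fin r → Aˣ)
    (hz : ∀ (i : Fin r) (a : Subring.center E),
      (z i : A) * e ↑a * ((z i)⁻¹ : Aˣ) = e ↑(σ i a))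
    (conj : Fin r → E → E)
    (hconj : ∀ (i : Fin r) (a : E), e (conj i a) = (z i : A) * e a * ((z i)⁻¹ : Aˣ))
    (cmt : Fin r → Fin r → E)
    (hcmt : ∀ i j : Fin r,
      e (cmt i j) = (z i : A) * (z j : A) * ((z i)⁻¹ : Aˣ) * ((z j)⁻¹ : Aˣ))
    (D : Type u) [DivisionRing D] [Algebra k D]
    (φ : TwistedPolyRing k E r conj cmt →ₐ[k] D)
    (hφinj : Function.Injective φ)
    (hquot : ∀ d : D, ∃ t c : TwistedPolyRing k E r conj cmt,
      c ∈ Subring.center (TwistedPolyRing k E r conj cmt) ∧ φ c ≠ 0 ∧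
        d = φ t * (φ c)⁻¹) :
    Nonempty (CentralLiftWitness k D E) ∧
      ∃ iso : Subring.center D ≃+* FractionRing (MvPolynomial (Fin r) k),
        ∀ c : k, iso (centerRingHom k D c) =
          algebraMap (MvPolynomial (Fin r) k)
            (FractionRing (MvPolynomial (Fin r) k)) (MvPolynomial.C c) := by
  obtain ⟨Γ, _, _, _, ⟨b⟩⟩ := exists_ordered_free_group.{u} r
  obtain ⟨s, s_add, s_b⟩ := exists_monoidHom_of_basis hZab b σ
  let S : TignolData k E A Γ r :=
    { e := e
      e_injective := he
      centralizer := hcentralizer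
      σ := σ
      closure_σ := hgen
      z := z
      z_mul := fun i a => by rw [← hz, Units.inv_mul_cancel_right]
      b := b
      s := s
      s_add := s_add
      s_b := s_b }
  obtain ⟨Λ, hΛ⟩ := S.exists_lift hZgal conj hconj cmt hcmt D φ hφinj hquot
  obtain ⟨iso, hiso⟩ := Λ.exists_iso hZgal
  refine ⟨Λ.nonempty_centralLiftWitness hZgal hΛ, iso, fun c => ?_⟩
  rw [← hiso]
  exact congrArg iso (Subtype.ext ((hΛ c).symm.trans (Λ.κ_eq hZgal c).symm))

end Paper
end
end
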